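/- arXiv:1304.6576 — 5 statements merged into one kernel-verified Lean document; each statement's English description precedes it below -/
import Mathlib

section
/- Let f be a transcendental entire function. Then f has the area property if and only if for every w ∈ ℂ∖S(f) the sum Σ_{z ∈ f⁻¹(w), |z| ≥ 1} 1/(|z|²·|f′(z)|²) is finite. Moreover, if this sum is finite for some w₀ ∈ ℂ∖S(f), then it is finite for every w belonging to the same connected component of ℂ∖S(f) as w₀. -/
open Complex Set Filter Topology Metric MeasureTheory
open scoped ENNReal Real

noncomputable def logPlus (x : ℝ) : ℝ := max 0 (Real.log x)

noncomputable def entireOrder (f : ℂ → ℂ) : ℝ≥0∞ :=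
  Filter.limsup
    (fun z : ℂ => ENNReal.ofReal (logPlus (logPlus ‖f z‖) / Real.log ‖z‖))
    (Filter.comap (fun z : ℂ => ‖z‖) Filter.atTop)

def IsRegularValue (f : ℂ → ℂ) (w : ℂ) : Prop :=
  ∃ U : Set ℂ, IsOpen U ∧ w ∈ U ∧
    ∀ z ∈ f ⁻¹' U,
      ∃ e : ↥(connectedComponentIn (f ⁻¹' U) z) ≃ₜ ↥U,
        ∀ x : ↥(connectedComponentIn (f ⁻¹' U) z), (e x : ℂ) = f ↑x

def singularSet (f : ℂ → ℂ) : Set ℂ := {w : ℂ | ¬ IsRegularValue f w}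

def TranscendentalEntire (f : ℂ → ℂ) : Prop :=
  Differentiable ℂ f ∧ ¬ ∃ p : Polynomial ℂ, ∀ z, f z = p.eval z

def TopEquiv (f g : ℂ → ℂ) : Prop :=
  ∃ φ ψ : ℂ ≃ₜ ℂ, ∀ z, ψ (f z) = g (φ z)

noncomputable def cylArea (A : Set ℂ) : ℝ≥0∞ :=
  ∫⁻ z in A, ENNReal.ofReal (1 / ‖z‖ ^ 2)

def AreaProperty (f : ℂ → ℂ) : Prop :=
  ∀ K : Set ℂ, IsCompact K → K ⊆ (singularSet f)ᶜ →
    cylArea (f ⁻¹' K \ Metric.ball (0 : ℂ) 1) < ⊤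

def FiberSummable (f : ℂ → ℂ) (w : ℂ) : Prop :=
  Summable (fun z : {z : ℂ // f z = w ∧ 1 ≤ ‖z‖} =>
    1 / (‖(z : ℂ)‖ ^ 2 * ‖deriv f (z : ℂ)‖ ^ 2))

/-- A nonvanishing holomorphic function on a disc has a holomorphic logarithm. -/
theorem exists_exp_eq_of_differentiableOn_ball {k : ℂ → ℂ} {c : ℂ} {ρ : ℝ} (hρ : 0 < ρ)
    (hk : DifferentiableOn ℂ k (ball c ρ)) (h0 : ∀ z ∈ ball c ρ, k z ≠ 0) :
    ∃ h : ℂ → ℂ, DifferentiableOn ℂ h (ball c ρ) ∧ ∀ z ∈ ball c ρ, exp (h z) = k z := by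
  have hd : DifferentiableOn ℂ (fun z => deriv k z / k z) (ball c ρ) :=
    (hk.deriv isOpen_ball).div hk h0
  have hex : IsExactOn (fun z => deriv k z / k z) (ball c ρ) :=
    hd.isConservativeOn.isExactOn_ball hd.continuousOn
  obtain ⟨h, hhc, hh⟩ := hex.with_val_at c (log (k c))
  have hc : c ∈ ball c ρ := mem_ball_self hρ
  refine ⟨h, fun z hz => (hh z hz).differentiableAt.differentiableWithinAt, fun z hz => ?_⟩
  have hconst : ∀ x ∈ ball c ρ, HasDerivAt (fun z => k z * exp (-h z)) 0 x := by
    intro x hx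
    have h1 := (hk.differentiableAt (isOpen_ball.mem_nhds hx)).hasDerivAt.mul (hh x hx).neg.cexp
    have h2 : k x * (deriv k x / k x) = deriv k x := mul_div_cancel₀ _ (h0 x hx)
    refine h1.congr_deriv ?_
    change deriv k x * exp (-h x) + k x * (exp (-h x) * -(deriv k x / k x)) = 0
    linear_combination -exp (-h x) * h2
  have := (convex_ball c ρ).is_const_of_fderivWithin_eq_zero (𝕜 := ℂ)
    (f := fun z => k z * exp (-h z))
    (fun x hx => (hconst x hx).differentiableAt.differentiableWithinAt)
    (fun x hx => by
      have := (hconst x hx).hasFDerivAt.hasFDerivWithinAt (s := ball c ρ)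
      rw [this.fderivWithin (isOpen_ball.uniqueDiffWithinAt hx)]
      simp) hz hc
  simp only [hhc, exp_neg, exp_log (h0 c hc)] at this
  rw [mul_inv_cancel₀ (h0 c hc)] at this
  exact ((mul_inv_eq_one₀ (exp_ne_zero _)).1 this).symm

theorem re_le_norm_sq_of_eq_add_mul (a b z q : ℂ) :
    ((‖a‖ ^ 2 : ℝ) + 2 * ((starRingEnd ℂ) a * (z * q)) +
      ((‖z‖ ^ 2 : ℝ) : ℂ) * (2 * ((starRingEnd ℂ) b * q) - (‖b‖ ^ 2 : ℝ))).re ≤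
      ‖a + z * q‖ ^ 2 := by
  have h1 : ‖a + z * q‖ ^ 2 = ‖a‖ ^ 2 + 2 * ((starRingEnd ℂ) a * (z * q)).re
      + ‖z‖ ^ 2 * ‖q‖ ^ 2 := by
    simp only [Complex.sq_norm, normSq_apply]
    simp
    ring
  have h2 : 2 * ((starRingEnd ℂ) b * q).re - ‖b‖ ^ 2 ≤ ‖q‖ ^ 2 := by
    have : ‖q‖ ^ 2 - (2 * ((starRingEnd ℂ) b * q).re - ‖b‖ ^ 2) = ‖q - b‖ ^ 2 := by
      simp only [Complex.sq_norm, normSq_apply]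
      simp
      ring
    nlinarith [sq_nonneg ‖q - b‖]
  rw [h1]
  have h3 := mul_le_mul_of_nonneg_left h2 (sq_nonneg ‖z‖)
  have e : ((‖a‖ ^ 2 : ℝ) + 2 * ((starRingEnd ℂ) a * (z * q)) +
      ((‖z‖ ^ 2 : ℝ) : ℂ) * (2 * ((starRingEnd ℂ) b * q) - (‖b‖ ^ 2 : ℝ))).re
      = ‖a‖ ^ 2 + 2 * ((starRingEnd ℂ) a * (z * q)).re +
        ‖z‖ ^ 2 * (2 * ((starRingEnd ℂ) b * q).re - ‖b‖ ^ 2) := by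
    rw [add_re, add_re, re_ofReal_mul, sub_re, ofReal_re, ofReal_re]
    congr 2
    · rw [show (2 : ℂ) = ((2 : ℝ) : ℂ) by norm_num, re_ofReal_mul]
    · rw [show (2 : ℂ) = ((2 : ℝ) : ℂ) by norm_num, re_ofReal_mul]
  rw [e]
  linarith

/-- Bessel's inequality on a circle for the first two Taylor coefficients. -/
theorem bessel_circle {v : ℂ → ℂ} (hv : DifferentiableOn ℂ v (ball 0 1)) {t : ℝ}
    (ht : 0 < t) (ht1 : t < 1) :
    ENNReal.ofReal (2 * π * (‖v 0‖ ^ 2 + t ^ 2 * ‖deriv v 0‖ ^ 2)) ≤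
      ∫⁻ θ in Ioo (-π) π, ENNReal.ofReal (‖v (circleMap 0 t θ)‖ ^ 2) := by
  have h0 : (0 : ℂ) ∈ ball (0 : ℂ) 1 := mem_ball_self one_pos
  set q := dslope v 0 with hq
  have hqd : DifferentiableOn ℂ q (ball 0 1) :=
    (differentiableOn_dslope (isOpen_ball.mem_nhds h0)).2 hv
  have hvq : ∀ z, v z = v 0 + z * q z := by
    intro z
    have := sub_smul_dslope v 0 z
    simp only [sub_zero, smul_eq_mul] at this
    rw [hq, this]; ring
  set H : ℂ → ℂ := fun z => (‖v 0‖ ^ 2 : ℝ) + 2 * ((starRingEnd ℂ) (v 0) * (z * q z)) +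
      ((t ^ 2 : ℝ) : ℂ) * (2 * ((starRingEnd ℂ) (q 0) * q z) - (‖q 0‖ ^ 2 : ℝ)) with hH
  have hHd : DifferentiableOn ℂ H (ball 0 1) := by
    have := hqd
    fun_prop
  have hsub : closedBall (0 : ℂ) t ⊆ ball 0 1 := closedBall_subset_ball ht1
  have hmap : ∀ θ, circleMap 0 t θ ∈ ball (0 : ℂ) 1 := fun θ =>
    hsub (circleMap_mem_closedBall 0 ht.le θ)
  have hav : Real.circleAverage H 0 t = H 0 := by
    apply DiffContOnCl.circleAverage
    rw [abs_of_pos ht]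
    apply DifferentiableOn.diffContOnCl
    rw [closure_ball _ ht.ne']
    exact hHd.mono hsub
  have hHc : Continuous fun θ => H (circleMap 0 t θ) :=
    hHd.continuousOn.comp_continuous (continuous_circleMap 0 t) hmap
  have hvc : Continuous fun θ => ‖v (circleMap 0 t θ)‖ ^ 2 :=
    (hv.continuousOn.comp_continuous (continuous_circleMap 0 t) hmap).norm.pow 2
  have hint : ∫ θ in (-π)..π, (H (circleMap 0 t θ)).re =
      2 * π * (‖v 0‖ ^ 2 + t ^ 2 * ‖deriv v 0‖ ^ 2) := by
    have hper : Function.Periodic (fun θ => H (circleMap 0 t θ)) (2 * π) := by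
      intro θ; simp only [periodic_circleMap 0 t θ]
    have h1 := hper.intervalIntegral_add_eq (-π) 0
    rw [show -π + 2 * π = π by ring, zero_add] at h1
    have h2 : ∫ θ in (0 : ℝ)..2 * π, H (circleMap 0 t θ) = ((2 * π : ℝ) : ℂ) * H 0 := by
      rw [← hav, Real.circleAverage, ← real_smul, smul_smul, mul_inv_cancel₀ (by positivity), one_smul]
    have h3 := reCLM.intervalIntegral_comp_comm
      (hHc.intervalIntegrable (μ := volume) (-π) π)
    simp only [reCLM_apply] at h3
    rw [h3, h1, h2, re_ofReal_mul]
    congr 1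
    have hq0 : q 0 = deriv v 0 := dslope_same v 0
    have hb : (starRingEnd ℂ) (q 0) * q 0 = ((‖q 0‖ ^ 2 : ℝ) : ℂ) := by
      rw [mul_comm, mul_conj, Complex.sq_norm]
    simp only [hH, hb, ← hq0]
    rw [show ((‖v 0‖ ^ 2 : ℝ) : ℂ) + 2 * ((starRingEnd ℂ) (v 0) * (0 * q 0)) +
      ((t ^ 2 : ℝ) : ℂ) * (2 * ((‖q 0‖ ^ 2 : ℝ) : ℂ) - ((‖q 0‖ ^ 2 : ℝ) : ℂ)) =
      ((‖v 0‖ ^ 2 + t ^ 2 * ‖q 0‖ ^ 2 : ℝ) : ℂ) by push_cast; ring, ofReal_re]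
  rw [← ofReal_integral_eq_lintegral_ofReal
    ((hvc.integrableOn_Icc (a := -π) (b := π)).mono_set Ioo_subset_Icc_self)
    (Eventually.of_forall fun θ => by positivity)]
  apply ENNReal.ofReal_le_ofReal
  rw [← hint, ← integral_Ioc_eq_integral_Ioo,
    ← intervalIntegral.integral_of_le (by linarith [Real.pi_pos])]
  apply intervalIntegral.integral_mono_on (by linarith [Real.pi_pos])
    ((continuous_re.comp hHc).intervalIntegrable _ _) (hvc.intervalIntegrable _ _)
  intro θ _
  have := re_le_norm_sq_of_eq_add_mul (v 0) (q 0) (circleMap 0 t θ) (q (circleMap 0 t θ))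
  rw [norm_circleMap_zero, abs_of_pos ht, ← hvq] at this
  exact this

theorem abs_det_restrictScalars_toSpanSingleton (a : ℂ) :
    |((ContinuousLinearMap.toSpanSingleton ℂ a).restrictScalars ℝ).det| = ‖a‖ ^ 2 := by
  have h : (((ContinuousLinearMap.toSpanSingleton ℂ a).restrictScalars ℝ : ℂ →L[ℝ] ℂ) : ℂ →ₗ[ℝ] ℂ) =
      LinearMap.mul ℝ ℂ a := by
    ext
    all_goals simp [mul_comm]
  rw [ContinuousLinearMap.det, h]
  have := Algebra.norm_complex_apply a
  rw [Algebra.norm_apply] at this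
  erw [this]
  rw [abs_of_nonneg (normSq_nonneg a), normSq_eq_norm_sq]

/-- Change of variables for an injective holomorphic function. -/
theorem lintegral_image_eq_lintegral_norm_deriv_sq_mul {φ : ℂ → ℂ} {s : Set ℂ}
    (hs : MeasurableSet s) (hd : ∀ z ∈ s, DifferentiableAt ℂ φ z) (hi : InjOn φ s)
    (g : ℂ → ℝ≥0∞) :
    ∫⁻ w in φ '' s, g w = ∫⁻ z in s, ENNReal.ofReal (‖deriv φ z‖ ^ 2) * g (φ z) := by
  rw [lintegral_image_eq_lintegral_abs_det_fderiv_mul volume hs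
    (f' := fun z => (ContinuousLinearMap.toSpanSingleton ℂ (deriv φ z)).restrictScalars ℝ)
    (fun z hz => ((hd z hz).hasDerivAt.hasFDerivAt.restrictScalars ℝ).hasFDerivWithinAt) hi]
  simp_rw [abs_det_restrictScalars_toSpanSingleton]

theorem lintegral_eq_lintegral_circleMap {F : ℂ → ℝ≥0∞} (hF : Measurable F) :
    ∫⁻ z, F z =
      ∫⁻ t in Ioi (0 : ℝ), ENNReal.ofReal t * ∫⁻ θ in Ioo (-π) π, F (circleMap 0 t θ) := by
  have hc : ∀ p : ℝ × ℝ, Complex.polarCoord.symm p = circleMap 0 p.1 p.2 := by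
    intro p
    rw [Complex.polarCoord_symm_apply, circleMap, exp_mul_I, ofReal_cos, ofReal_sin]
    simp
  have hm : Measurable fun p : ℝ × ℝ => F (circleMap 0 p.1 p.2) := by
    apply hF.comp
    unfold circleMap
    fun_prop
  rw [← Complex.lintegral_comp_polarCoord_symm, polarCoord_target, Measure.volume_eq_prod,
    ← Measure.prod_restrict]
  simp_rw [hc, smul_eq_mul]
  rw [lintegral_prod _ (by
    exact ((ENNReal.measurable_ofReal.comp measurable_fst).mul hm).aemeasurable)]
  refine lintegral_congr fun t => ?_
  have hmt : Measurable fun θ => F (circleMap 0 t θ) := hm.comp measurable_prodMk_left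
  exact lintegral_const_mul (ENNReal.ofReal t) hmt

theorem lintegral_norm_ge_inv_cube {m : ℝ} (hm : 0 < m) :
    ∫⁻ w in {w : ℂ | m ≤ ‖w‖}, ENNReal.ofReal (1 / ‖w‖ ^ 3) = ENNReal.ofReal (2 * π / m) := by
  have hs : MeasurableSet {w : ℂ | m ≤ ‖w‖} := measurableSet_le measurable_const measurable_norm
  rw [← lintegral_indicator hs, lintegral_eq_lintegral_circleMap
    (Measurable.indicator (by fun_prop) hs)]
  have h1 : ∀ t ∈ Ioi (0 : ℝ), ENNReal.ofReal t * ∫⁻ θ in Ioo (-π) π,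
      {w : ℂ | m ≤ ‖w‖}.indicator (fun w => ENNReal.ofReal (1 / ‖w‖ ^ 3)) (circleMap 0 t θ) =
      (Ici m).indicator (fun t => ENNReal.ofReal (2 * π * t ^ (-2 : ℝ))) t := by
    intro t ht
    have ht : 0 < t := ht
    by_cases hmt : m ≤ t
    · have : ∀ θ, circleMap 0 t θ ∈ {w : ℂ | m ≤ ‖w‖} := by
        intro θ; simp [abs_of_pos ht, hmt]
      simp only [indicator_of_mem (this _), norm_circleMap_zero, abs_of_pos ht, lintegral_const,
        indicator_of_mem (mem_Ici.2 hmt)]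
      rw [Measure.restrict_apply_univ, Real.volume_Ioo, ← ENNReal.ofReal_mul (by positivity),
        ← ENNReal.ofReal_mul ht.le]
      congr 1
      rw [Real.rpow_neg ht.le]
      norm_num
      field_simp
      ring
    · have : ∀ θ, circleMap 0 t θ ∉ {w : ℂ | m ≤ ‖w‖} := by
        intro θ; simp [abs_of_pos ht]; linarith
      simp only [indicator_of_notMem (this _), lintegral_zero, mul_zero]
      rw [indicator_of_notMem (by simpa using hmt)]
  rw [setLIntegral_congr_fun measurableSet_Ioi h1, setLIntegral_indicator measurableSet_Ici,
    inter_eq_self_of_subset_left (Ici_subset_Ioi.2 hm), setLIntegral_congr Ioi_ae_eq_Ici.symm,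
    ← ofReal_integral_eq_lintegral_ofReal]
  · rw [integral_const_mul, integral_Ioi_rpow_of_lt (by norm_num) hm]
    congr 1
    norm_num
    rw [Real.rpow_neg_one]
    field_simp
  · exact (integrableOn_Ioi_rpow_of_lt (by norm_num) hm).const_mul _
  · filter_upwards [ae_restrict_mem measurableSet_Ioi] with t ht
    have : 0 < t := hm.trans ht
    positivity

theorem le_lintegral_annulus {v : ℂ → ℂ} (hv : DifferentiableOn ℂ v (ball 0 1)) {r : ℝ}
    (hr : 0 < r) (hr1 : r < 1) :
    ENNReal.ofReal (2 * π * (‖v 0‖ ^ 2 * (1 / r - 1) + ‖deriv v 0‖ ^ 2 * (1 - r))) ≤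
      ∫⁻ z in {z : ℂ | r < ‖z‖ ∧ ‖z‖ < 1}, ENNReal.ofReal (‖v z‖ ^ 2 / ‖z‖ ^ 3) := by
  set A : Set ℂ := {z : ℂ | r < ‖z‖ ∧ ‖z‖ < 1} with hA
  have hs : MeasurableSet A := (measurableSet_lt measurable_const measurable_norm).inter
    (measurableSet_lt measurable_norm measurable_const)
  have hcont : ContinuousOn (fun z => ENNReal.ofReal (‖v z‖ ^ 2 / ‖z‖ ^ 3)) A := by
    apply ENNReal.continuous_ofReal.comp_continuousOn
    apply ContinuousOn.div
    · exact ((hv.continuousOn.mono fun z hz => by simpa using hz.2).norm).pow 2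
    · fun_prop
    · intro z hz
      have : 0 < ‖z‖ := hr.trans hz.1
      positivity
  have hmeas : Measurable (A.indicator fun z => ENNReal.ofReal (‖v z‖ ^ 2 / ‖z‖ ^ 3)) := by
    classical
    rw [← piecewise_eq_indicator]
    exact hcont.measurable_piecewise continuousOn_const hs
  rw [← lintegral_indicator hs, lintegral_eq_lintegral_circleMap hmeas]
  have h1 : ∀ t ∈ Ioo r 1,
      ENNReal.ofReal (2 * π * (‖v 0‖ ^ 2 * t ^ (-2 : ℝ) + ‖deriv v 0‖ ^ 2)) ≤
      ENNReal.ofReal t * ∫⁻ θ in Ioo (-π) π,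
      A.indicator (fun z => ENNReal.ofReal (‖v z‖ ^ 2 / ‖z‖ ^ 3)) (circleMap 0 t θ) := by
    intro t ht
    have ht0 : 0 < t := hr.trans ht.1
    have : ∀ θ, circleMap 0 t θ ∈ A := by
      intro θ; simpa [hA, abs_of_pos ht0] using ht
    simp only [indicator_of_mem (this _), norm_circleMap_zero, abs_of_pos ht0]
    simp_rw [fun θ => div_eq_inv_mul (‖v (circleMap 0 t θ)‖ ^ 2) (t ^ 3),
      ENNReal.ofReal_mul (inv_nonneg.2 (pow_nonneg ht0.le 3))]
    rw [lintegral_const_mul' _ _ ENNReal.ofReal_ne_top]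
    calc _ = ENNReal.ofReal t * (ENNReal.ofReal (t ^ 3)⁻¹ *
          ENNReal.ofReal (2 * π * (‖v 0‖ ^ 2 + t ^ 2 * ‖deriv v 0‖ ^ 2))) := by
          rw [← ENNReal.ofReal_mul (by positivity), ← ENNReal.ofReal_mul (by positivity)]
          congr 1
          rw [Real.rpow_neg ht0.le]
          norm_num
          field_simp
      _ ≤ _ := by gcongr; exact bessel_circle hv ht0 ht.2
  have hii : IntervalIntegrable (fun t : ℝ => t ^ (-2 : ℝ)) volume r 1 :=
    intervalIntegral.intervalIntegrable_rpow (Or.inr (by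
      rw [uIcc_of_le hr1.le]; intro h; exact absurd h.1 (not_le.2 hr)))
  have hii2 : IntervalIntegrable (fun t : ℝ =>
      2 * π * (‖v 0‖ ^ 2 * t ^ (-2 : ℝ) + ‖deriv v 0‖ ^ 2)) volume r 1 :=
    ((hii.const_mul _).add intervalIntegrable_const).const_mul _
  calc _ = ∫⁻ t in Ioo r 1,
        ENNReal.ofReal (2 * π * (‖v 0‖ ^ 2 * t ^ (-2 : ℝ) + ‖deriv v 0‖ ^ 2)) := by
        rw [← ofReal_integral_eq_lintegral_ofReal]
        · rw [← integral_Ioc_eq_integral_Ioo, ← intervalIntegral.integral_of_le hr1.le,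
            intervalIntegral.integral_const_mul, intervalIntegral.integral_add
            (hii.const_mul _) intervalIntegrable_const, intervalIntegral.integral_const_mul,
            integral_rpow (Or.inr ⟨by norm_num, by
              rw [uIcc_of_le hr1.le]; intro h; exact absurd h.1 (not_le.2 hr)⟩)]
          congr 2
          norm_num
          rw [Real.rpow_neg_one]
          ring
        · exact ((intervalIntegrable_iff_integrableOn_Ioc_of_le hr1.le).1 hii2).mono_set
            Ioo_subset_Ioc_self
        · filter_upwards [ae_restrict_mem measurableSet_Ioo] with t ht
          have : 0 < t := hr.trans ht.1
          positivity
    _ ≤ ∫⁻ t in Ioo r 1, _ := setLIntegral_mono' measurableSet_Ioo h1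
    _ ≤ _ := lintegral_mono_set fun t ht => hr.trans ht.1

/-- An injective holomorphic function on the unit disc fixing `0` maps the complement of a
concentric disc outside the disc whose radius is the minimum modulus on the circle. -/
theorem le_norm_of_le_norm_sphere {φ : ℂ → ℂ} (hφ : DifferentiableOn ℂ φ (ball 0 1))
    (hi : InjOn φ (ball 0 1)) (h0 : φ 0 = 0) {r m : ℝ} (hr : 0 < r) (hr1 : r < 1)
    (hm : ∀ z, ‖z‖ = r → m ≤ ‖φ z‖) {z : ℂ} (hz : r < ‖z‖) (hz1 : ‖z‖ < 1) : m ≤ ‖φ z‖ := by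
  by_contra! hlt
  have hsub : closedBall (0 : ℂ) r ⊆ ball 0 1 := closedBall_subset_ball hr1
  have hzb : z ∈ ball (0 : ℂ) 1 := by simpa using hz1
  have h0b : (0 : ℂ) ∈ ball (0 : ℂ) 1 := mem_ball_self one_pos
  have hopen : IsOpen (φ '' ball 0 r) := by
    rcases (hφ.analyticOnNhd isOpen_ball).is_constant_or_isOpen
      (convex_ball (0 : ℂ) 1).isPreconnected with ⟨w, hw⟩ | h
    · exact absurd (hi hzb h0b ((hw z hzb).trans (hw 0 h0b).symm)) (by
        rintro rfl; simp at hz; linarith)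
    · exact h _ (ball_subset_ball hr1.le) isOpen_ball
  have hclosed : IsClosed (φ '' closedBall 0 r) :=
    ((isCompact_closedBall 0 r).image_of_continuousOn (hφ.continuousOn.mono hsub)).isClosed
  have hmpos : 0 < m := (norm_nonneg _).trans_lt hlt
  have key : ball (0 : ℂ) m ⊆ φ '' ball 0 r := by
    apply (convex_ball (0 : ℂ) m).isPreconnected.subset_left_of_subset_union hopen
      hclosed.isOpen_compl
    · exact disjoint_compl_right.mono_left (image_mono ball_subset_closedBall)
    · intro w hw
      by_cases h : w ∈ φ '' closedBall 0 r
      · left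
        obtain ⟨x, hx, rfl⟩ := h
        refine ⟨x, ?_, rfl⟩
        rcases (mem_closedBall_zero_iff.1 hx).lt_or_eq with h | h
        · simpa using h
        · have := hm x h
          simp at hw
          linarith
      · exact Or.inr h
    · exact ⟨0, mem_ball_self hmpos, 0, mem_ball_self hr, h0⟩
  obtain ⟨x, hx, hxz⟩ := key (show φ z ∈ ball (0 : ℂ) m by simpa using hlt)
  have := hi (ball_subset_ball hr1.le hx) hzb hxz
  subst this
  simp at hx
  linarith

/-- The coefficient bound obtained from the area principle for `φ = z / u²`. -/
theorem norm_deriv_le_of_injOn_div_sq {u : ℂ → ℂ} (hu : DifferentiableOn ℂ u (ball 0 1))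
    (hu0 : ∀ z ∈ ball (0 : ℂ) 1, u z ≠ 0) (hu1 : ‖u 0‖ = 1)
    (hi : InjOn (fun z => z / u z ^ 2) (ball 0 1)) : ‖deriv u 0‖ ≤ 5 := by
  have h0b : (0 : ℂ) ∈ ball (0 : ℂ) 1 := mem_ball_self one_pos
  set φ : ℂ → ℂ := fun z => z / u z ^ 2 with hφ
  set b := ‖deriv u 0‖ with hb
  set v : ℂ → ℂ := fun z => u z - 2 * z * deriv u z with hv
  have hat : ∀ z ∈ ball (0 : ℂ) 1, DifferentiableAt ℂ u z := fun z hz =>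
    hu.differentiableAt (isOpen_ball.mem_nhds hz)
  have hdu : DifferentiableOn ℂ (deriv u) (ball 0 1) := hu.deriv isOpen_ball
  have hvd : DifferentiableOn ℂ v (ball 0 1) := by fun_prop
  have hv0 : ‖v 0‖ = 1 := by simp [hv, hu1]
  have hv1 : ‖deriv v 0‖ = b := by
    have h1 := (hat 0 h0b).hasDerivAt
    have h2 := (hdu.differentiableAt (isOpen_ball.mem_nhds h0b)).hasDerivAt
    have h3 := h1.sub (((hasDerivAt_id (0 : ℂ)).const_mul 2).mul h2)
    have h4 : HasDerivAt v (-deriv u 0) 0 := by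
      refine h3.congr_deriv ?_
      simp
      ring
    rw [h4.deriv, norm_neg]
  have hφd : ∀ z ∈ ball (0 : ℂ) 1, HasDerivAt φ (v z / u z ^ 3) z := by
    intro z hz
    have h1 := (hasDerivAt_id z).div ((hat z hz).hasDerivAt.pow 2) (pow_ne_zero 2 (hu0 z hz))
    refine h1.congr_deriv ?_
    have := hu0 z hz
    simp [hv]
    field_simp
  have hφdiff : DifferentiableOn ℂ φ (ball 0 1) := fun z hz =>
    (hφd z hz).differentiableAt.differentiableWithinAt
  obtain ⟨r, hr, hr2, hru⟩ : ∃ r : ℝ, 0 < r ∧ r ≤ 1 / 2 ∧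
      ∀ z, ‖z‖ = r → ‖u z‖ ^ 2 ≤ 1 + (2 * b + 1) * r := by
    have h1 := ((hat 0 h0b).hasDerivAt.pow 2).isLittleO.def one_pos
    obtain ⟨δ, hδ, h2⟩ := Metric.eventually_nhds_iff.1 h1
    refine ⟨min (δ / 2) (1 / 2), by positivity, min_le_right _ _, fun z hz => ?_⟩
    have h3 := @h2 z (by
      rw [dist_zero_right, hz]
      exact (min_le_left _ _).trans_lt (by linarith))
    rw [← hz]
    simp only [Pi.pow_apply, sub_zero, one_mul, smul_eq_mul] at h3
    have e : u z ^ 2 = (u z ^ 2 - u 0 ^ 2 - z * (((2 : ℕ) : ℂ) * u 0 ^ (2 - 1) * deriv u 0)) +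
        u 0 ^ 2 + z * (2 * u 0 * deriv u 0) := by
      push_cast; ring
    rw [← norm_pow, e]
    refine (norm_add₃_le).trans ?_
    have : ‖z * (2 * u 0 * deriv u 0)‖ = ‖z‖ * (2 * b) := by
      simp [hu1, hb]
    rw [this, norm_pow, hu1]
    linarith
  have hr1 : r < 1 := by linarith
  have hb0 : 0 ≤ b := norm_nonneg _
  set m : ℝ := r / (1 + (2 * b + 1) * r) with hm
  have hden : 0 < 1 + (2 * b + 1) * r := by positivity
  have hmpos : 0 < m := by positivity
  set A : Set ℂ := {z : ℂ | r < ‖z‖ ∧ ‖z‖ < 1} with hA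
  have hAs : MeasurableSet A := (measurableSet_lt measurable_const measurable_norm).inter
    (measurableSet_lt measurable_norm measurable_const)
  have hAb : A ⊆ ball 0 1 := fun z hz => by simpa using hz.2
  have himg : φ '' A ⊆ {w : ℂ | m ≤ ‖w‖} := by
    rintro _ ⟨z, hz, rfl⟩
    refine le_norm_of_le_norm_sphere hφdiff hi (by simp [hφ]) hr hr1 (fun x hx => ?_) hz.1 hz.2
    rw [hm, hφ]
    simp only [norm_div, norm_pow, hx]
    have : 0 < ‖u x‖ := norm_pos_iff.2 (hu0 x (by simpa [hx] using hr1))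
    gcongr
    exact hru x hx
  have harea : ENNReal.ofReal (2 * π * (‖v 0‖ ^ 2 * (1 / r - 1) + ‖deriv v 0‖ ^ 2 * (1 - r))) ≤
      ENNReal.ofReal (2 * π / m) := by
    refine (le_lintegral_annulus hvd hr hr1).trans ?_
    rw [← lintegral_norm_ge_inv_cube hmpos]
    refine le_trans (le_of_eq ?_) (lintegral_mono_set himg)
    rw [lintegral_image_eq_lintegral_norm_deriv_sq_mul hAs
      (fun z hz => (hφd z (hAb hz)).differentiableAt) (hi.mono hAb)]
    refine setLIntegral_congr_fun hAs fun z hz => ?_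
    have hz0 : 0 < ‖z‖ := hr.trans hz.1
    have hu' : 0 < ‖u z‖ := norm_pos_iff.2 (hu0 z (hAb hz))
    rw [(hφd z (hAb hz)).deriv, ← ENNReal.ofReal_mul (by positivity)]
    congr 1
    simp only [hφ, norm_div, norm_pow]
    field_simp
  rw [ENNReal.ofReal_le_ofReal_iff (by positivity), hv0, hv1] at harea
  have h1 : 2 * π / m = 2 * π * (1 / r + (2 * b + 1)) := by
    rw [hm]; field_simp
  rw [h1] at harea
  have h2 := le_of_mul_le_mul_left harea (by positivity)
  nlinarith [sq_nonneg b, mul_nonneg (sq_nonneg b) (sub_nonneg.2 hr2)]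

/-- A weak form of Bieberbach's inequality for the second coefficient of a univalent function. -/
theorem norm_deriv_deriv_le_of_injOn {φ : ℂ → ℂ} (hφ : DifferentiableOn ℂ φ (ball 0 1))
    (hi : InjOn φ (ball 0 1)) (h0 : φ 0 = 0) (h1 : deriv φ 0 = 1) :
    ‖deriv (deriv φ) 0‖ ≤ 20 := by
  have h0b : (0 : ℂ) ∈ ball (0 : ℂ) 1 := mem_ball_self one_pos
  set k := dslope φ 0 with hk
  have hkd : DifferentiableOn ℂ k (ball 0 1) :=
    (differentiableOn_dslope (isOpen_ball.mem_nhds h0b)).2 hφ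
  have hφk : ∀ z, φ z = z * k z := by
    intro z
    have := sub_smul_dslope φ 0 z
    simp only [sub_zero, smul_eq_mul, h0] at this
    rw [hk, this]
  have hk0 : k 0 = 1 := by rw [hk, dslope_same, h1]
  have hkne : ∀ z ∈ ball (0 : ℂ) 1, k z ≠ 0 := by
    intro z hz hkz
    by_cases hz0 : z = 0
    · rw [hz0, hk0] at hkz; exact one_ne_zero hkz
    · exact hz0 (hi hz h0b (by rw [hφk z, hkz, h0, mul_zero]))
  obtain ⟨h, hhd, hh⟩ := exists_exp_eq_of_differentiableOn_ball one_pos hkd hkne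
  set u : ℂ → ℂ := fun z => exp (-h z / 2) with hu
  have hune : ∀ z, u z ≠ 0 := fun z => exp_ne_zero _
  have hud : DifferentiableOn ℂ u (ball 0 1) := by fun_prop
  have huk : ∀ z ∈ ball (0 : ℂ) 1, u z ^ 2 * k z = 1 := by
    intro z hz
    rw [← hh z hz, hu, ← exp_nat_mul, ← exp_add]
    simp
    ring_nf
    simp
  have hφu : ∀ z ∈ ball (0 : ℂ) 1, φ z = z / u z ^ 2 := by
    intro z hz
    rw [hφk z, eq_div_iff (pow_ne_zero 2 (hune z))]
    linear_combination z * huk z hz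
  have hu1 : ‖u 0‖ = 1 := by
    have := huk 0 h0b
    rw [hk0, mul_one] at this
    have h2 : ‖u 0‖ ^ 2 = 1 := by rw [← norm_pow, this, norm_one]
    exact (pow_eq_one_iff_of_nonneg (norm_nonneg _) two_ne_zero).1 h2
  have hb := norm_deriv_le_of_injOn_div_sq hud (fun z _ => hune z) hu1 (hi.congr hφu)
  have hat : ∀ z ∈ ball (0 : ℂ) 1, DifferentiableAt ℂ u z := fun z hz =>
    hud.differentiableAt (isOpen_ball.mem_nhds hz)
  have hφ' : ∀ z ∈ ball (0 : ℂ) 1, deriv φ z = (u z - 2 * z * deriv u z) / u z ^ 3 := by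
    intro z hz
    have h1 := (hasDerivAt_id z).div ((hat z hz).hasDerivAt.pow 2) (pow_ne_zero 2 (hune z))
    have h2 := h1.congr_of_eventuallyEq
      (by filter_upwards [isOpen_ball.mem_nhds hz] with x hx using hφu x hx)
    rw [h2.deriv]
    have := hune z
    simp
    field_simp
  have hd2 : HasDerivAt (fun z => (u z - 2 * z * deriv u z) / u z ^ 3)
      (-4 * deriv u 0 / u 0 ^ 3) 0 := by
    have h1 := (hat 0 h0b).hasDerivAt
    have h2 := ((hud.deriv isOpen_ball).differentiableAt (isOpen_ball.mem_nhds h0b)).hasDerivAt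
    have h3 := (h1.sub (((hasDerivAt_id (0 : ℂ)).const_mul 2).mul h2)).div (h1.pow 3)
      (pow_ne_zero 3 (hune 0))
    refine h3.congr_deriv ?_
    have := hune 0
    simp
    field_simp
    ring
  have he : deriv φ =ᶠ[𝓝 0] fun z => (u z - 2 * z * deriv u z) / u z ^ 3 :=
    by filter_upwards [isOpen_ball.mem_nhds h0b] with x hx using hφ' x hx
  rw [he.deriv_eq, hd2.deriv, norm_div, norm_pow, hu1, norm_mul]
  norm_num
  linarith

/-- The bound on the pre-Schwarzian of a univalent function at the centre of a disc. -/
theorem mul_norm_deriv_deriv_le_of_injOn {ψ : ℂ → ℂ} {c : ℂ} {ρ : ℝ} (hρ : 0 < ρ)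
    (hψ : DifferentiableOn ℂ ψ (ball c ρ)) (hi : InjOn ψ (ball c ρ)) (h1 : deriv ψ c ≠ 0) :
    ρ * ‖deriv (deriv ψ) c‖ ≤ 20 * ‖deriv ψ c‖ := by
  have hρ' : (ρ : ℂ) ≠ 0 := by exact_mod_cast hρ.ne'
  have hmap : ∀ z ∈ ball (0 : ℂ) 1, c + ρ * z ∈ ball c ρ := by
    intro z hz
    simp only [mem_ball, dist_eq_norm, sub_zero] at hz ⊢
    rw [add_sub_cancel_left, norm_mul, norm_real, Real.norm_of_nonneg hρ.le]
    nlinarith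
  set a : ℂ := (ρ * deriv ψ c)⁻¹ with ha
  have ha0 : a ≠ 0 := inv_ne_zero (mul_ne_zero hρ' h1)
  set φ : ℂ → ℂ := fun z => a * (ψ (c + ρ * z) - ψ c) with hφ
  have hlin : ∀ z : ℂ, HasDerivAt (fun z : ℂ => c + ρ * z) (ρ : ℂ) z := fun z => by
    simpa using ((hasDerivAt_id z).const_mul (ρ : ℂ)).const_add c
  have hφd : ∀ z ∈ ball (0 : ℂ) 1, HasDerivAt φ (a * (deriv ψ (c + ρ * z) * ρ)) z := by
    intro z hz
    have h2 := (hψ.differentiableAt (isOpen_ball.mem_nhds (hmap z hz))).hasDerivAt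
    exact ((h2.comp z (hlin z)).sub_const _).const_mul a
  have h0b : (0 : ℂ) ∈ ball (0 : ℂ) 1 := mem_ball_self one_pos
  have hinj : InjOn φ (ball 0 1) := by
    intro x hx y hy hxy
    have h2 : ψ (c + ρ * x) = ψ (c + ρ * y) := by
      have := mul_left_cancel₀ ha0 hxy
      linear_combination this
    have h3 := hi (hmap x hx) (hmap y hy) h2
    exact mul_left_cancel₀ hρ' (add_left_cancel h3)
  have key := norm_deriv_deriv_le_of_injOn (φ := φ)
    (fun z hz => (hφd z hz).differentiableAt.differentiableWithinAt) hinj (by simp [hφ])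
    (by
      rw [(hφd 0 h0b).deriv, ha]
      simp only [mul_zero, add_zero]
      field_simp)
  have he : deriv φ =ᶠ[𝓝 0] fun z => a * (deriv ψ (c + ρ * z) * ρ) :=
    by filter_upwards [isOpen_ball.mem_nhds h0b] with x hx using (hφd x hx).deriv
  have hd2 : HasDerivAt (fun z : ℂ => a * (deriv ψ (c + ρ * z) * ρ))
      (a * (deriv (deriv ψ) c * ρ * ρ)) 0 := by
    have h2 := ((hψ.deriv isOpen_ball).differentiableAt
      (isOpen_ball.mem_nhds (hmap 0 h0b))).hasDerivAt
    have h3 := ((h2.comp 0 (hlin 0)).mul_const (ρ : ℂ)).const_mul a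
    simpa using h3
  have hn : 0 < ‖deriv ψ c‖ := norm_pos_iff.2 h1
  rw [he.deriv_eq, hd2.deriv, ha] at key
  simp only [norm_mul, norm_inv, norm_real, Real.norm_of_nonneg hρ.le] at key
  have e : (ρ * ‖deriv ψ c‖)⁻¹ * (‖deriv (deriv ψ) c‖ * ρ * ρ) =
      ρ * ‖deriv (deriv ψ) c‖ / ‖deriv ψ c‖ := by field_simp
  rwa [e, div_le_iff₀ hn] at key

/-- A weak form of Koebe's distortion theorem. -/
theorem norm_deriv_le_exp_mul_norm_deriv_of_injOn {ψ : ℂ → ℂ} {c : ℂ} {ρ : ℝ}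
    (hψ : DifferentiableOn ℂ ψ (ball c ρ)) (hi : InjOn ψ (ball c ρ))
    (h1 : ∀ z ∈ ball c ρ, deriv ψ z ≠ 0) {x y : ℂ} (hx : x ∈ ball c (ρ / 2))
    (hy : y ∈ ball c (ρ / 2)) : ‖deriv ψ y‖ ≤ Real.exp 40 * ‖deriv ψ x‖ := by
  have hρ2 : 0 < ρ / 2 := pos_of_mem_ball hx
  have hρ : 0 < ρ := by linarith
  have hsub : ∀ z ∈ ball c (ρ / 2), ball z (ρ / 2) ⊆ ball c ρ := fun z hz =>
    ball_subset_ball' (by have := mem_ball.1 hz; linarith)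
  have hbig : ball c (ρ / 2) ⊆ ball c ρ := ball_subset_ball (by linarith)
  have hbound : ∀ z ∈ ball c (ρ / 2), ‖deriv (deriv ψ) z‖ ≤ 40 / ρ * ‖deriv ψ z‖ := by
    intro z hz
    have := mul_norm_deriv_deriv_le_of_injOn hρ2 (hψ.mono (hsub z hz)) (hi.mono (hsub z hz))
      (h1 z (hbig hz))
    rw [div_mul_eq_mul_div, le_div_iff₀ hρ]
    linarith
  have hline : ∀ t ∈ Icc (0 : ℝ) 1, x + t * (y - x) ∈ ball c (ρ / 2) := by
    intro t ht
    have := (convex_ball c (ρ / 2)).add_smul_sub_mem hx hy ht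
    simpa using this
  have hder : ∀ t ∈ Icc (0 : ℝ) 1, HasDerivAt (fun t : ℝ => deriv ψ (x + t * (y - x)))
      (deriv (deriv ψ) (x + t * (y - x)) * (y - x)) t := by
    intro t ht
    have h2 := ((hψ.deriv isOpen_ball).differentiableAt
      (isOpen_ball.mem_nhds (hbig (hline t ht)))).hasDerivAt
    have h3 : HasDerivAt (fun t : ℝ => x + (t : ℂ) * (y - x)) (y - x) t := by
      simpa using ((ofRealCLM.hasDerivAt (x := t)).mul_const (y - x)).const_add x
    exact h2.comp t h3
  have hxy : ‖y - x‖ ≤ ρ := by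
    rw [← dist_eq_norm]
    have := dist_triangle_right y x c
    have := mem_ball.1 hx
    have := mem_ball.1 hy
    linarith
  have := norm_le_gronwallBound_of_norm_deriv_right_le (δ := ‖deriv ψ x‖) (K := 40) (ε := 0)
    (fun t ht => (hder t ht).continuousAt.continuousWithinAt)
    (fun t ht => (hder t (Ico_subset_Icc_self ht)).hasDerivWithinAt) (by simp)
    (fun t ht => by
      have h2 := hbound _ (hline t (Ico_subset_Icc_self ht))
      rw [norm_mul, add_zero]
      calc _ ≤ 40 / ρ * ‖deriv ψ (x + t * (y - x))‖ * ρ := by gcongr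
        _ = _ := by field_simp) 1 (right_mem_Icc.2 zero_le_one)
  rw [gronwallBound_ε0] at this
  simpa [mul_comm] using this

/-- Distortion of the logarithmic derivative of a nonvanishing univalent function. -/
theorem norm_logDeriv_le_exp_mul_of_injOn {φ : ℂ → ℂ} {c : ℂ} {ρ : ℝ}
    (hφ : DifferentiableOn ℂ φ (ball c ρ)) (hi : InjOn φ (ball c ρ))
    (h0 : ∀ z ∈ ball c ρ, φ z ≠ 0) (h1 : ∀ z ∈ ball c ρ, deriv φ z ≠ 0) {x y : ℂ}
    (hx : x ∈ ball c (ρ / 2)) (hy : y ∈ ball c (ρ / 2)) :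
    ‖deriv φ y‖ / ‖φ y‖ ≤ Real.exp 40 * (‖deriv φ x‖ / ‖φ x‖) := by
  have hρ2 : 0 < ρ / 2 := pos_of_mem_ball hx
  obtain ⟨ψ, hψ, hexp⟩ := exists_exp_eq_of_differentiableOn_ball (by linarith) hφ h0
  have hbig : ball c (ρ / 2) ⊆ ball c ρ := ball_subset_ball (by linarith)
  have hder : ∀ z ∈ ball c ρ, deriv ψ z = deriv φ z / φ z := by
    intro z hz
    have h2 := (hψ.differentiableAt (isOpen_ball.mem_nhds hz)).hasDerivAt.cexp
    have h3 : deriv φ z = exp (ψ z) * deriv ψ z := by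
      rw [← h2.deriv]
      exact EventuallyEq.deriv_eq
        (by filter_upwards [isOpen_ball.mem_nhds hz] with w hw using (hexp w hw).symm)
    rw [h3, hexp z hz, mul_div_cancel_left₀ _ (h0 z hz)]
  have := norm_deriv_le_exp_mul_norm_deriv_of_injOn hψ
    (fun a ha b hb hab => hi ha hb (by rw [← hexp a ha, ← hexp b hb, hab]))
    (fun z hz => by rw [hder z hz]; exact div_ne_zero (h1 z hz) (h0 z hz)) hx hy
  rwa [hder y (hbig hy), hder x (hbig hx), norm_div, norm_div] at this

theorem differentiableOn_of_continuousOn_of_rightInvOn {f φ : ℂ → ℂ} {U : Set ℂ}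
    (hf : Differentiable ℂ f) (hU : IsOpen U) (hφ : ContinuousOn φ U)
    (hr : ∀ w ∈ U, f (φ w) = w) : DifferentiableOn ℂ φ U := by
  have hgood : ∀ w ∈ U, deriv f (φ w) ≠ 0 → DifferentiableAt ℂ φ w := fun w hw h =>
    (HasDerivAt.of_local_left_inverse (hφ.continuousAt (hU.mem_nhds hw))
      (hf _).hasDerivAt h
      (by filter_upwards [hU.mem_nhds hw] with y hy using hr y hy)).differentiableAt
  intro w hw
  have hcw := hφ.continuousAt (hU.mem_nhds hw)
  have hf' : AnalyticOnNhd ℂ (deriv f) univ := fun z _ => (hf.analyticAt z).deriv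
  rcases (hf' (φ w) (mem_univ _)).eventually_eq_zero_or_eventually_ne_zero with h | h
  · exfalso
    have h0 : ∀ z, deriv f z = 0 := fun z =>
      hf'.eqOn_zero_of_preconnected_of_eventuallyEq_zero isPreconnected_univ
        (mem_univ (φ w)) h (mem_univ z)
    have hne : ∀ᶠ y in 𝓝[≠] w, y ∈ U ∧ y ≠ w :=
      Filter.Eventually.and (mem_nhdsWithin_of_mem_nhds (hU.mem_nhds hw)) self_mem_nhdsWithin
    obtain ⟨y, hy, hyw⟩ := hne.exists
    apply hyw
    rw [← hr y hy, ← hr w hw]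
    exact is_const_of_deriv_eq_zero hf h0 _ _
  · refine (Complex.analyticAt_of_differentiable_on_punctured_nhds_of_continuousAt ?_
      hcw).differentiableAt.differentiableWithinAt
    have h1 : ∀ᶠ y in 𝓝 w, φ y ≠ φ w → deriv f (φ y) ≠ 0 :=
      hcw.eventually (eventually_nhdsWithin_iff.1 h)
    filter_upwards [mem_nhdsWithin_of_mem_nhds h1,
      mem_nhdsWithin_of_mem_nhds (hU.mem_nhds hw), self_mem_nhdsWithin] with y hy1 hyU hyw
    refine hgood y hyU (hy1 fun h2 => hyw ?_)
    rw [mem_singleton_iff, ← hr y hyU, h2, hr w hw]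

/-- `φ z`, for `z` in the fiber over `w₀`, are the inverse branches of `f` over the ball of
radius `R` about `w₀`; a branch may vanish only if it belongs to the point `0`. -/
structure IsInverseBranches (f : ℂ → ℂ) (w₀ : ℂ) (R : ℝ) (φ : {z // f z = w₀} → ℂ → ℂ) :
    Prop where
  pos : 0 < R
  differentiableOn : ∀ z, DifferentiableOn ℂ (φ z) (ball w₀ R)
  apply_apply : ∀ z, ∀ w ∈ ball w₀ R, f (φ z w) = w
  apply_center : ∀ z, φ z w₀ = z
  exists_apply_eq : ∀ p, f p ∈ ball w₀ R → ∃ z, φ z (f p) = p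
  eq_of_apply_eq : ∀ z z', ∀ w ∈ ball w₀ R, φ z w = φ z' w → z = z'
  isOpen_image : ∀ z, IsOpen (φ z '' ball w₀ R)
  ne_zero : ∀ z : {z // f z = w₀}, (z : ℂ) ≠ 0 → ∀ w ∈ ball w₀ R, φ z w ≠ 0

theorem IsRegularValue.exists_isInverseBranches {f : ℂ → ℂ} (hf : Differentiable ℂ f) {w₀ : ℂ}
    (h : IsRegularValue f w₀) :
    ∃ R φ, IsInverseBranches f w₀ R φ ∧ ball w₀ R ⊆ (singularSet f)ᶜ := by
  obtain ⟨U, hU, hwU, hcov⟩ := h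
  have hR : ∃ R > 0, ball w₀ R ⊆ U ∧ (f 0 ∈ ball w₀ R → f 0 = w₀) := by
    obtain ⟨R, hR, hRU⟩ := Metric.isOpen_iff.1 hU w₀ hwU
    by_cases h0 : f 0 = w₀
    · exact ⟨R, hR, hRU, fun _ => h0⟩
    · refine ⟨min R (dist (f 0) w₀), lt_min hR (dist_pos.2 h0),
        (ball_subset_ball (min_le_left _ _)).trans hRU, fun h => absurd (mem_ball.1 h) ?_⟩
      exact not_lt.2 (min_le_right _ _)
  obtain ⟨R, hR, hRU, hf0⟩ := hR
  choose e he using hcov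
  have hm : ∀ z : {z // f z = w₀}, (z : ℂ) ∈ f ⁻¹' U := fun z => by
    rw [mem_preimage, z.2]; exact hwU
  classical
  let φ : {z // f z = w₀} → ℂ → ℂ := fun z w =>
    if h : w ∈ U then ((e z (hm z)).symm ⟨w, h⟩ : ℂ) else 0
  have hφ : ∀ z w (h : w ∈ U), φ z w = ((e z (hm z)).symm ⟨w, h⟩ : ℂ) := fun z w h => dif_pos h
  have hmem : ∀ z : {z // f z = w₀}, ∀ w ∈ U, φ z w ∈ connectedComponentIn (f ⁻¹' U) z := by
    intro z w h
    rw [hφ z w h]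
    exact Subtype.coe_prop _
  have hfφ : ∀ z, ∀ w ∈ U, f (φ z w) = w := by
    intro z w h
    rw [hφ z w h, ← he z (hm z), Homeomorph.apply_symm_apply]
  have hφf : ∀ z : {z // f z = w₀}, ∀ x ∈ connectedComponentIn (f ⁻¹' U) (z : ℂ), φ z (f x) = x := by
    intro z x hx
    have hxU : f x ∈ U := connectedComponentIn_subset (f ⁻¹' U) _ hx
    rw [hφ z _ hxU]
    have : (⟨f x, hxU⟩ : U) = e z (hm z) ⟨x, hx⟩ := Subtype.ext (he z (hm z) ⟨x, hx⟩).symm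
    rw [this, Homeomorph.symm_apply_apply]
  have hcen : ∀ z, φ z w₀ = z := fun z => by
    conv_lhs => rw [← z.2]
    exact hφf z z (mem_connectedComponentIn (hm z))
  have hcont : ∀ z, ContinuousOn (φ z) U := by
    intro z
    rw [continuousOn_iff_continuous_domRestrict]
    have : U.domRestrict (φ z) = fun w => ((e z (hm z)).symm w : ℂ) := by
      ext w
      exact hφ z w w.2
    rw [this]
    exact continuous_subtype_val.comp (e z (hm z)).symm.continuous
  refine ⟨R, φ, ⟨hR, fun z => ?_, fun z w hw => hfφ z w (hRU hw), hcen, fun p hp => ?_,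
    fun z z' w hw hzz => ?_, fun z => ?_, fun z hz w hw h0 => ?_⟩,
    fun w hw => not_not.2 ⟨U, hU, hRU hw, fun z hz => ⟨e z hz, he z hz⟩⟩⟩
  · exact (differentiableOn_of_continuousOn_of_rightInvOn hf hU (hcont z) (hfφ z)).mono hRU
  · have hpU : p ∈ f ⁻¹' U := hRU hp
    set q := (e p hpU).symm ⟨w₀, hwU⟩ with hq
    have hfq : f q = w₀ := by rw [← he p hpU, hq, Homeomorph.apply_symm_apply]
    refine ⟨⟨q, hfq⟩, hφf _ p ?_⟩
    rw [← connectedComponentIn_eq q.2]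
    exact mem_connectedComponentIn hpU
  · have h1 := connectedComponentIn_eq (hmem z w (hRU hw))
    have h2 := connectedComponentIn_eq (hmem z' w (hRU hw))
    rw [hzz, ← h2] at h1
    have h3 := hφf z z' (by rw [h1]; exact mem_connectedComponentIn (hm z'))
    rw [z'.2, hcen] at h3
    exact Subtype.ext h3
  · have : φ z '' ball w₀ R = connectedComponentIn (f ⁻¹' U) (z : ℂ) ∩ f ⁻¹' ball w₀ R := by
      ext x
      constructor
      · rintro ⟨w, hw, rfl⟩
        refine ⟨hmem z w (hRU hw), ?_⟩
        rw [mem_preimage, hfφ z w (hRU hw)]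
        exact hw
      · rintro ⟨hx, hxR⟩
        exact ⟨f x, hxR, hφf z x hx⟩
    rw [this]
    exact ((hU.preimage hf.continuous).connectedComponentIn).inter
      (isOpen_ball.preimage hf.continuous)
  · have h1 := hfφ z w (hRU hw)
    rw [h0] at h1
    have h2 : w = w₀ := by rw [← h1]; exact hf0 (h1 ▸ hw)
    rw [h2, hcen] at h0
    exact hz h0

theorem eventually_cofinite_coe_ne_zero (p : ℂ → Prop) :
    ∀ᶠ z : {z // p z} in cofinite, (z : ℂ) ≠ 0 :=
  Subtype.val_injective.tendsto_cofinite.eventually (eventually_cofinite_ne (0 : ℂ))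

namespace IsInverseBranches

variable {f : ℂ → ℂ} {w₀ w : ℂ} {R : ℝ} {φ : {z // f z = w₀} → ℂ → ℂ}

theorem center_mem (hB : IsInverseBranches f w₀ R φ) : w₀ ∈ ball w₀ R :=
  mem_ball_self hB.pos

theorem differentiableAt (hB : IsInverseBranches f w₀ R φ) (z) (hw : w ∈ ball w₀ R) :
    DifferentiableAt ℂ (φ z) w :=
  (hB.differentiableOn z).differentiableAt (isOpen_ball.mem_nhds hw)

theorem injOn (hB : IsInverseBranches f w₀ R φ) (z) : InjOn (φ z) (ball w₀ R) :=
  fun a ha b hb h => by rw [← hB.apply_apply z a ha, h, hB.apply_apply z b hb]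

theorem deriv_mul_deriv (hf : Differentiable ℂ f) (hB : IsInverseBranches f w₀ R φ) (z)
    (hw : w ∈ ball w₀ R) : deriv f (φ z w) * deriv (φ z) w = 1 := by
  have h1 := (hf (φ z w)).hasDerivAt.comp w (hB.differentiableAt z hw).hasDerivAt
  have h2 : f ∘ φ z =ᶠ[𝓝 w] id := by
    filter_upwards [isOpen_ball.mem_nhds hw] with x hx using hB.apply_apply z x hx
  rw [← h1.deriv, h2.deriv_eq, deriv_id]

theorem deriv_ne_zero (hf : Differentiable ℂ f) (hB : IsInverseBranches f w₀ R φ) (z)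
    (hw : w ∈ ball w₀ R) : deriv (φ z) w ≠ 0 :=
  right_ne_zero_of_mul_eq_one (hB.deriv_mul_deriv hf z hw)

theorem one_div_norm_sq_mul_norm_deriv_sq (hf : Differentiable ℂ f)
    (hB : IsInverseBranches f w₀ R φ) (z) (hw : w ∈ ball w₀ R) :
    1 / (‖φ z w‖ ^ 2 * ‖deriv f (φ z w)‖ ^ 2) = (‖deriv (φ z) w‖ / ‖φ z w‖) ^ 2 := by
  have h : ‖deriv f (φ z w)‖ * ‖deriv (φ z) w‖ = 1 := by
    rw [← norm_mul, hB.deriv_mul_deriv hf z hw, norm_one]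
  rw [eq_one_div_of_mul_eq_one_right h, div_div, mul_comm, ← mul_pow, one_div, one_div, inv_pow]

theorem disjoint_image (hB : IsInverseBranches f w₀ R φ) :
    Pairwise (Function.onFun Disjoint fun z => φ z '' ball w₀ R) := by
  intro z z' hzz
  rw [Function.onFun, Set.disjoint_left]
  rintro _ ⟨w, hw, rfl⟩ ⟨w', hw', h⟩
  have : w' = w := by rw [← hB.apply_apply z' w' hw', h, hB.apply_apply z w hw]
  subst this
  exact hzz (hB.eq_of_apply_eq z z' _ hw h.symm)

theorem countable (hB : IsInverseBranches f w₀ R φ) : Countable {z // f z = w₀} :=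
  hB.disjoint_image.countable_of_isOpen_disjoint hB.isOpen_image
    fun _ => ⟨_, mem_image_of_mem _ hB.center_mem⟩

theorem finite_inter_nonempty (hf : Differentiable ℂ f) (hB : IsInverseBranches f w₀ R φ)
    {r : ℝ} (hr : r < R) :
    {z | (φ z '' closedBall w₀ r ∩ closedBall 0 1).Nonempty}.Finite := by
  have hK : IsCompact (f ⁻¹' closedBall w₀ r ∩ closedBall 0 1) :=
    (isCompact_closedBall 0 1).inter_left (isClosed_closedBall.preimage hf.continuous)
  have hsub := closedBall_subset_ball hr (x := w₀)
  obtain ⟨t, ht⟩ := hK.elim_finite_subcover _ hB.isOpen_image fun p hp => by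
    obtain ⟨z, hz⟩ := hB.exists_apply_eq p (hsub hp.1)
    exact mem_iUnion.2 ⟨z, f p, hsub hp.1, hz⟩
  refine t.finite_toSet.subset ?_
  rintro z ⟨_, ⟨w, hw, rfl⟩, h1⟩
  have hwR := hsub hw
  have hmem : φ z w ∈ ⋃ i ∈ t, φ i '' ball w₀ R :=
    ht ⟨by rw [mem_preimage, hB.apply_apply z w hwR]; exact hw, h1⟩
  obtain ⟨i, hi, w', hw', h⟩ := mem_iUnion₂.1 hmem
  have hiz : i = z := by
    by_contra hne
    exact Set.disjoint_left.1 (hB.disjoint_image hne) ⟨w', hw', h⟩ ⟨w, hwR, rfl⟩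
  exact hiz ▸ hi

theorem fiberSummable_iff (hf : Differentiable ℂ f) (hB : IsInverseBranches f w₀ R φ)
    (hw : w ∈ ball w₀ R) :
    FiberSummable f w ↔ Summable fun z => (‖deriv (φ z) w‖ / ‖φ z w‖) ^ 2 := by
  set s : Set {z // f z = w₀} := {z | ‖φ z w‖ < 1} with hs
  have hsf : s.Finite := by
    refine (hB.finite_inter_nonempty hf (mem_ball.1 hw)).subset fun z hz => ?_
    refine ⟨φ z w, mem_image_of_mem _ (mem_closedBall.2 le_rfl), ?_⟩
    rw [mem_closedBall_zero_iff]
    exact le_of_lt hz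
  have hbij : Function.Bijective fun z : ↥sᶜ =>
      (⟨φ z w, hB.apply_apply z w hw, not_lt.1 z.2⟩ : {p // f p = w ∧ 1 ≤ ‖p‖}) := by
    constructor
    · intro z z' h
      exact Subtype.ext (hB.eq_of_apply_eq _ _ w hw (congrArg Subtype.val h))
    · rintro ⟨p, rfl, hp⟩
      obtain ⟨z, hz⟩ := hB.exists_apply_eq p hw
      exact ⟨⟨z, fun h => by rw [hs, mem_ofPred_eq, hz] at h; exact not_lt.2 hp h⟩,
        Subtype.ext hz⟩
  rw [← hsf.summable_compl_iff, FiberSummable, ← (Equiv.ofBijective _ hbij).summable_iff]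
  refine summable_congr fun z => ?_
  exact hB.one_div_norm_sq_mul_norm_deriv_sq hf z hw

theorem norm_logDeriv_le (hf : Differentiable ℂ f) (hB : IsInverseBranches f w₀ R φ)
    {z : {z // f z = w₀}} (hz : (z : ℂ) ≠ 0) {x y : ℂ} (hx : x ∈ ball w₀ (R / 2))
    (hy : y ∈ ball w₀ (R / 2)) :
    ‖deriv (φ z) y‖ / ‖φ z y‖ ≤ Real.exp 40 * (‖deriv (φ z) x‖ / ‖φ z x‖) :=
  norm_logDeriv_le_exp_mul_of_injOn (hB.differentiableOn z) (hB.injOn z) (hB.ne_zero z hz)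
    (fun _ hw => hB.deriv_ne_zero hf z hw) hx hy

theorem fiberSummable_of_mem_ball (hf : Differentiable ℂ f) (hB : IsInverseBranches f w₀ R φ)
    {x y : ℂ} (hx : x ∈ ball w₀ (R / 2)) (hy : y ∈ ball w₀ (R / 2)) (h : FiberSummable f x) :
    FiberSummable f y := by
  have hsub : ball w₀ (R / 2) ⊆ ball w₀ R := ball_subset_ball (by linarith [hB.pos])
  rw [hB.fiberSummable_iff hf (hsub hx)] at h
  rw [hB.fiberSummable_iff hf (hsub hy)]
  refine (h.mul_left (Real.exp 40 ^ 2)).of_norm_bounded_eventually ?_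
  filter_upwards [eventually_cofinite_coe_ne_zero _] with z hz
  rw [Real.norm_of_nonneg (by positivity), ← mul_pow]
  exact pow_le_pow_left₀ (by positivity) (hB.norm_logDeriv_le hf hz hx hy) 2

theorem image_ball_eq (hB : IsInverseBranches f w₀ R φ) (z) {r : ℝ} (hr : r ≤ R) :
    φ z '' ball w₀ r = φ z '' ball w₀ R ∩ f ⁻¹' ball w₀ r := by
  have hsub := ball_subset_ball (x := w₀) hr
  ext p
  constructor
  · rintro ⟨w, hw, rfl⟩
    refine ⟨⟨w, hsub hw, rfl⟩, ?_⟩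
    rw [mem_preimage, hB.apply_apply z w (hsub hw)]
    exact hw
  · rintro ⟨⟨w, hw, rfl⟩, h⟩
    rw [mem_preimage, hB.apply_apply z w hw] at h
    exact ⟨w, h, rfl⟩

theorem measurableSet_image (hf : Differentiable ℂ f) (hB : IsInverseBranches f w₀ R φ) (z)
    {r : ℝ} (hr : r ≤ R) : MeasurableSet (φ z '' ball w₀ r) := by
  rw [hB.image_ball_eq z hr]
  exact ((hB.isOpen_image z).inter (isOpen_ball.preimage hf.continuous)).measurableSet

theorem cylArea_image (hB : IsInverseBranches f w₀ R φ) (z) {r : ℝ} (hr : r ≤ R) :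
    cylArea (φ z '' ball w₀ r) =
      ∫⁻ w in ball w₀ r, ENNReal.ofReal ((‖deriv (φ z) w‖ / ‖φ z w‖) ^ 2) := by
  have hsub := ball_subset_ball (x := w₀) hr
  rw [cylArea, lintegral_image_eq_lintegral_norm_deriv_sq_mul measurableSet_ball
    (fun w hw => hB.differentiableAt z (hsub hw)) ((hB.injOn z).mono hsub)]
  refine lintegral_congr fun w => ?_
  rw [← ENNReal.ofReal_mul (by positivity), mul_one_div, div_pow]

theorem cylArea_image_le (hf : Differentiable ℂ f) (hB : IsInverseBranches f w₀ R φ)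
    {z : {z // f z = w₀}} (hz : (z : ℂ) ≠ 0) :
    cylArea (φ z '' ball w₀ (R / 2)) ≤
      ENNReal.ofReal (Real.exp 40 ^ 2 * (‖deriv (φ z) w₀‖ / ‖φ z w₀‖) ^ 2) *
        volume (ball w₀ (R / 2)) := by
  rw [hB.cylArea_image z (by linarith [hB.pos]), ← setLIntegral_const]
  refine setLIntegral_mono measurable_const fun w hw => ENNReal.ofReal_le_ofReal ?_
  rw [← mul_pow]
  exact pow_le_pow_left₀ (by positivity)
    (hB.norm_logDeriv_le hf hz (mem_ball_self (half_pos hB.pos)) hw) 2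

theorem le_cylArea_image (hf : Differentiable ℂ f) (hB : IsInverseBranches f w₀ R φ)
    {z : {z // f z = w₀}} (hz : (z : ℂ) ≠ 0) :
    ENNReal.ofReal ((‖deriv (φ z) w₀‖ / ‖φ z w₀‖) ^ 2) * volume (ball w₀ (R / 2)) ≤
      ENNReal.ofReal (Real.exp 40 ^ 2) * cylArea (φ z '' ball w₀ (R / 2)) := by
  rw [hB.cylArea_image z (by linarith [hB.pos]), ← setLIntegral_const,
    ← lintegral_const_mul' _ _ ENNReal.ofReal_ne_top]
  refine setLIntegral_mono' measurableSet_ball fun w hw => ?_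
  rw [← ENNReal.ofReal_mul (by positivity), ← mul_pow]
  exact ENNReal.ofReal_le_ofReal (pow_le_pow_left₀ (by positivity)
    (hB.norm_logDeriv_le hf hz hw (mem_ball_self (half_pos hB.pos))) 2)

theorem cylArea_image_diff_lt_top (hB : IsInverseBranches f w₀ R φ) (z) :
    cylArea (φ z '' ball w₀ (R / 2) \ ball 0 1) < ⊤ := by
  have hR := hB.pos
  have hK : IsCompact (φ z '' closedBall w₀ (R / 2)) :=
    (isCompact_closedBall _ _).image_of_continuousOn
      ((hB.differentiableOn z).continuousOn.mono (closedBall_subset_ball (by linarith)))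
  calc cylArea (φ z '' ball w₀ (R / 2) \ ball 0 1)
      ≤ cylArea (φ z '' closedBall w₀ (R / 2) \ ball 0 1) :=
        lintegral_mono_set (sdiff_subset_sdiff_left (image_mono ball_subset_closedBall))
    _ ≤ ∫⁻ _ in φ z '' closedBall w₀ (R / 2) \ ball 0 1, 1 := by
        refine setLIntegral_mono measurable_const fun p hp => ?_
        have hp1 : 1 ≤ ‖p‖ := by simpa using hp.2
        rw [ENNReal.ofReal_le_one, div_le_one (by positivity)]
        exact one_le_pow₀ hp1
    _ = volume (φ z '' closedBall w₀ (R / 2) \ ball 0 1) := setLIntegral_one _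
    _ < ⊤ := (measure_mono sdiff_subset).trans_lt hK.measure_lt_top

theorem cylArea_preimage_diff_lt_top (hf : Differentiable ℂ f)
    (hB : IsInverseBranches f w₀ R φ) (h : FiberSummable f w₀) :
    cylArea (f ⁻¹' ball w₀ (R / 2) \ ball 0 1) < ⊤ := by
  have := hB.countable
  have hR := hB.pos
  rw [hB.fiberSummable_iff hf hB.center_mem] at h
  set v := volume (ball w₀ (R / 2)) with hv
  have hvt : v ≠ ⊤ := measure_ball_lt_top.ne
  have hfin := hB.cylArea_image_diff_lt_top
  have hsum : Summable fun z => (cylArea (φ z '' ball w₀ (R / 2) \ ball 0 1)).toReal := by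
    refine ((h.mul_left (Real.exp 40 ^ 2)).mul_right v.toReal).of_norm_bounded_eventually ?_
    filter_upwards [eventually_cofinite_coe_ne_zero _] with z hz
    rw [Real.norm_of_nonneg ENNReal.toReal_nonneg]
    have h1 : cylArea (φ z '' ball w₀ (R / 2) \ ball 0 1) ≤ _ :=
      (lintegral_mono_set sdiff_subset).trans (hB.cylArea_image_le hf hz)
    have h2 := ENNReal.toReal_mono (ENNReal.mul_ne_top ENNReal.ofReal_ne_top hvt) h1
    rwa [ENNReal.toReal_mul, ENNReal.toReal_ofReal (by positivity)] at h2
  calc cylArea (f ⁻¹' ball w₀ (R / 2) \ ball 0 1)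
      ≤ cylArea (⋃ z, φ z '' ball w₀ (R / 2) \ ball 0 1) := by
        refine lintegral_mono_set fun p hp => ?_
        obtain ⟨z, hz⟩ := hB.exists_apply_eq p (ball_subset_ball (by linarith) hp.1)
        exact mem_iUnion.2 ⟨z, ⟨f p, hp.1, hz⟩, hp.2⟩
    _ ≤ ∑' z, cylArea (φ z '' ball w₀ (R / 2) \ ball 0 1) := lintegral_iUnion_le _ _
    _ = ∑' z, ENNReal.ofReal (cylArea (φ z '' ball w₀ (R / 2) \ ball 0 1)).toReal :=
        tsum_congr fun z => (ENNReal.ofReal_toReal (hfin z).ne).symm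
    _ < ⊤ := hsum.tsum_ofReal_lt_top

theorem fiberSummable_of_cylArea_lt_top (hf : Differentiable ℂ f)
    (hB : IsInverseBranches f w₀ R φ)
    (h : cylArea (f ⁻¹' ball w₀ (R / 2) \ ball 0 1) < ⊤) : FiberSummable f w₀ := by
  have := hB.countable
  have hR := hB.pos
  rw [hB.fiberSummable_iff hf hB.center_mem]
  set v := volume (ball w₀ (R / 2)) with hv
  have hvt : v ≠ ⊤ := measure_ball_lt_top.ne
  have hv0 : 0 < v.toReal := ENNReal.toReal_pos (measure_ball_pos _ _ (half_pos hR)).ne' hvt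
  have hsub := ball_subset_ball (x := w₀) (by linarith : R / 2 ≤ R)
  have htsum : ∑' z, cylArea (φ z '' ball w₀ (R / 2) \ ball 0 1) ≠ ⊤ := by
    refine ne_top_of_le_ne_top h.ne ?_
    have := lintegral_iUnion (μ := volume)
      (fun z => (hB.measurableSet_image hf z (by linarith : R / 2 ≤ R)).diff
        (measurableSet_ball (x := (0 : ℂ)) (ε := 1)))
      (fun z z' hzz => (hB.disjoint_image hzz).mono (sdiff_subset.trans (image_mono hsub))
        (sdiff_subset.trans (image_mono hsub)))
      (fun p : ℂ => ENNReal.ofReal (1 / ‖p‖ ^ 2))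
    refine this.symm.trans_le (lintegral_mono_set (iUnion_subset fun z => ?_))
    refine sdiff_subset_sdiff_left ?_
    rw [hB.image_ball_eq z (by linarith)]
    exact inter_subset_right
  have hsum := ENNReal.summable_toReal htsum
  refine ((hsum.mul_left (Real.exp 40 ^ 2)).mul_right v.toReal⁻¹).of_norm_bounded_eventually ?_
  filter_upwards [eventually_cofinite_coe_ne_zero _,
    (hB.finite_inter_nonempty hf (by linarith : R / 2 < R)).compl_mem_cofinite] with z hz hz1
  have hdiff : φ z '' ball w₀ (R / 2) \ ball 0 1 = φ z '' ball w₀ (R / 2) := by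
    refine sdiff_eq_left.2 (Set.disjoint_left.2 fun p hp hp1 => hz1 ?_)
    exact ⟨p, image_mono ball_subset_closedBall hp, ball_subset_closedBall hp1⟩
  have hzt := ENNReal.ne_top_of_tsum_ne_top htsum z
  have h2 := ENNReal.toReal_mono
    (ENNReal.mul_ne_top ENNReal.ofReal_ne_top (hdiff ▸ hzt)) (hB.le_cylArea_image hf hz)
  rw [ENNReal.toReal_mul, ENNReal.toReal_mul, ENNReal.toReal_ofReal (by positivity),
    ENNReal.toReal_ofReal (by positivity)] at h2
  rw [Real.norm_of_nonneg (by positivity), hdiff, ← div_eq_mul_inv, le_div_iff₀ hv0]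
  exact h2

end IsInverseBranches

theorem FiberSummable.of_mem_connectedComponentIn {f : ℂ → ℂ} (hf : Differentiable ℂ f)
    {w₀ w : ℂ} (h : FiberSummable f w₀) (hw : w ∈ connectedComponentIn (singularSet f)ᶜ w₀) :
    FiberSummable f w := by
  have hloc : ∀ x ∉ singularSet f, ∀ᶠ y in 𝓝 x, FiberSummable f y ↔ FiberSummable f x := by
    intro x hx
    obtain ⟨R, φ, hB, -⟩ := (not_not.1 hx).exists_isInverseBranches hf
    have hx' := mem_ball_self (x := x) (half_pos hB.pos)
    filter_upwards [ball_mem_nhds x (half_pos hB.pos)] with y hy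
    exact ⟨hB.fiberSummable_of_mem_ball hf hy hx',
      hB.fiberSummable_of_mem_ball hf hx' hy⟩
  have hw₀ : w₀ ∈ (singularSet f)ᶜ := by
    by_contra h0
    rw [connectedComponentIn_eq_empty h0] at hw
    exact hw
  set S : Set ℂ := {x | FiberSummable f x}
  have hsub := connectedComponentIn_subset (singularSet f)ᶜ w₀
  have key : connectedComponentIn (singularSet f)ᶜ w₀ ⊆ interior S := by
    refine isPreconnected_connectedComponentIn.subset_left_of_subset_union isOpen_interior
      (isOpen_interior (s := Sᶜ)) (disjoint_compl_right.mono interior_subset interior_subset)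
      (fun x hx => ?_) ⟨w₀, mem_connectedComponentIn hw₀, ?_⟩
    · by_cases hxS : FiberSummable f x
      · exact Or.inl (mem_interior_iff_mem_nhds.2 ((hloc x (hsub hx)).mono fun y hy => hy.2 hxS))
      · exact Or.inr (mem_interior_iff_mem_nhds.2
          ((hloc x (hsub hx)).mono fun y hy hyS => hxS (hy.1 hyS)))
    · exact mem_interior_iff_mem_nhds.2 ((hloc w₀ hw₀).mono fun y hy => hy.2 h)
  exact (interior_subset (key hw) : w ∈ S)

theorem areaProperty_iff_forall_fiberSummable {f : ℂ → ℂ} (hf : Differentiable ℂ f) :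
    AreaProperty f ↔ ∀ w ∉ singularSet f, FiberSummable f w := by
  constructor
  · intro h w hw
    obtain ⟨R, φ, hB, hsub⟩ := (not_not.1 hw).exists_isInverseBranches hf
    have hK := h (closedBall w (R / 2)) (isCompact_closedBall _ _)
      ((closedBall_subset_ball (by linarith [hB.pos])).trans hsub)
    exact hB.fiberSummable_of_cylArea_lt_top hf ((lintegral_mono_set
      (sdiff_subset_sdiff_left (preimage_mono ball_subset_closedBall))).trans_lt hK)
  · intro h K hK hKs
    refine hK.induction_on (p := fun K => cylArea (f ⁻¹' K \ ball 0 1) < ⊤) ?_ ?_ ?_ ?_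
    · simp [cylArea]
    · exact fun s t hst ht => (lintegral_mono_set
        (sdiff_subset_sdiff_left (preimage_mono hst))).trans_lt ht
    · intro s t hs ht
      rw [preimage_union, union_sdiff_distrib]
      exact (lintegral_union_le _ _ _).trans_lt (ENNReal.add_lt_top.2 ⟨hs, ht⟩)
    · intro w hw
      obtain ⟨R, φ, hB, -⟩ := (not_not.1 (hKs hw)).exists_isInverseBranches hf
      exact ⟨ball w (R / 2), mem_nhdsWithin_of_mem_nhds (ball_mem_nhds w (half_pos hB.pos)),
        hB.cylArea_preimage_diff_lt_top hf (h w (hKs hw))⟩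

theorem infinitesimal_area_property (f : ℂ → ℂ) (hf : TranscendentalEntire f) :
    (AreaProperty f ↔ ∀ w ∉ singularSet f, FiberSummable f w) ∧
      (∀ w₀ ∉ singularSet f, FiberSummable f w₀ →
        ∀ w ∈ connectedComponentIn (singularSet f)ᶜ w₀, FiberSummable f w) := by
  exact ⟨areaProperty_iff_forall_fiberSummable hf.1,
    fun _ _ h _ hw => h.of_mem_connectedComponentIn hf.1 hw⟩
end

section
/- Let f be a transcendental entire function, let w ∈ ℂ∖S(f), and let K ⊆ ℂ∖{w} be a closed connected set containing S(f) and having at least two points. Then Σ_{z ∈ f⁻¹(w), |z| ≥ 1} 1/(|z|²·|f′(z)|²) < ∞ if and only if Σ_{z ∈ f⁻¹(w), |z| ≥ 1} dist(z, f⁻¹(K))²/|z|² < ∞, where dist(z, f⁻¹(K)) denotes the Euclidean distance from z to the set f⁻¹(K). -/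
open Complex Set Filter Topology Metric MeasureTheory
open scoped ENNReal Real

/-- A nonvanishing holomorphic function on a disk has a holomorphic logarithm. -/
lemma exists_log_of_differentiableOn_ball {g : ℂ → ℂ} {c : ℂ} {R : ℝ} (hR : 0 < R)
    (hg : DifferentiableOn ℂ g (ball c R)) (h0 : ∀ x ∈ ball c R, g x ≠ 0) :
    ∃ L : ℂ → ℂ, L c = 0 ∧ (∀ x ∈ ball c R, HasDerivAt L (deriv g x / g x) x) ∧
      ∀ x ∈ ball c R, g x = g c * exp (L x) := by
  obtain ⟨L, hLc, hL⟩ := (((hg.deriv isOpen_ball).div hg h0).isExactOn_ball).with_val_at c 0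
  refine ⟨L, hLc, hL, fun x hx => ?_⟩
  have hd : ∀ y ∈ ball c R, HasDerivAt (fun y => g y * exp (-L y)) 0 y := fun y hy => by
    have h1 := (hg.differentiableAt (isOpen_ball.mem_nhds hy)).hasDerivAt
    refine (h1.mul (hL y hy).neg.cexp).congr_deriv ?_
    have := h0 y hy
    simp only [Pi.div_apply]
    field_simp
    ring
  have hconst := isOpen_ball.is_const_of_deriv_eq_zero (convex_ball c R).isPreconnected
    (fun y hy => (hd y hy).differentiableAt.differentiableWithinAt)
    (fun y hy => (hd y hy).deriv) hx (mem_ball_self hR)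
  simp only [hLc, neg_zero, exp_zero, mul_one] at hconst
  rw [← hconst, mul_assoc, ← exp_add]
  simp

/-- If the derivative is bounded by twice its value at the centre, the image of a disk contains a
disk of comparable size about the image of the centre. -/
lemma ball_subset_image_ball_of_norm_deriv_le {F : ℂ → ℂ} {a : ℂ} {t : ℝ} (ht : 0 < t)
    (hF : DifferentiableOn ℂ F (ball a t)) (h0 : deriv F a ≠ 0)
    (hb : ∀ x ∈ ball a t, ‖deriv F x‖ ≤ 2 * ‖deriv F a‖) :
    ball (F a) (t * ‖deriv F a‖ / 32) ⊆ F '' ball a t := by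
  set A := ‖deriv F a‖ with hA
  have hA0 : 0 < A := norm_pos_iff.mpr h0
  have hdF := hF.deriv isOpen_ball
  have hschwarz : ∀ x ∈ ball a t, dist (deriv F x) (deriv F a) ≤ 3 * A / t * dist x a := by
    intro x hx
    refine dist_le_div_mul_dist_of_mapsTo_ball hdF (fun y hy => ?_) hx
    rw [mem_closedBall_iff_norm]
    calc ‖deriv F y - deriv F a‖ ≤ ‖deriv F y‖ + ‖deriv F a‖ := norm_sub_le _ _
      _ ≤ 2 * A + A := by gcongr; exact hb y hy
      _ = 3 * A := by ring
  have hsub : closedBall a (t / 8) ⊆ ball a t := closedBall_subset_ball (by linarith)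
  have hlow : ∀ x ∈ sphere a (t / 8), t * A / 16 ≤ ‖F x - F a‖ := by
    intro x hx
    have hmv := (convex_closedBall a (t / 8)).norm_image_sub_le_of_norm_hasDerivWithin_le
      (f := fun y => F y - deriv F a * y) (f' := fun y => deriv F y - deriv F a) (C := A / 2)
      (x := a) (y := x) (fun y hy => by
        have h1 := (hF.differentiableAt (isOpen_ball.mem_nhds (hsub hy))).hasDerivAt
        simpa using! (h1.sub ((hasDerivAt_id y).const_mul (deriv F a))).hasDerivWithinAt)
      (fun y hy => by
        rw [← dist_eq_norm]
        refine (hschwarz y (hsub hy)).trans ?_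
        rw [mem_closedBall] at hy
        calc 3 * A / t * dist y a ≤ 3 * A / t * (t / 8) := by gcongr
          _ = 3 / 8 * A := by field_simp
          _ ≤ A / 2 := by linarith)
      (mem_closedBall_self (by positivity)) (sphere_subset_closedBall hx)
    have hxa : ‖x - a‖ = t / 8 := by simpa [dist_eq_norm] using hx
    have hlin : ‖deriv F a * (x - a)‖ = A * (t / 8) := by rw [norm_mul, hxa]
    have htri := norm_sub_norm_le (deriv F a * (x - a))
      (-(F x - deriv F a * x - (F a - deriv F a * a)))
    rw [norm_neg, hlin] at htri
    rw [hxa] at hmv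
    have he : deriv F a * (x - a) - -(F x - deriv F a * x - (F a - deriv F a * a)) = F x - F a := by
      ring
    rw [he] at htri
    linarith
  have hfreq : ∃ᶠ x in 𝓝 a, F x ≠ F a := by
    have h1 := (hF.differentiableAt (ball_mem_nhds a ht)).hasDerivAt
    exact (h1.eventually_ne h0).frequently.filter_mono nhdsWithin_le_nhds
  have := DiffContOnCl.ball_subset_image_closedBall (hF.diffContOnCl_ball hsub)
    (by positivity) hlow hfreq
  rw [show t * A / 32 = t * A / 16 / 2 by ring]
  exact this.trans (image_mono hsub)

/-- Bloch's theorem, with an explicit non-optimal constant. -/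
lemma exists_ball_subset_image_ball {F : ℂ → ℂ} {c : ℂ} {R : ℝ} (hR : 0 < R)
    (hF : DifferentiableOn ℂ F (ball c R)) (h0 : deriv F c ≠ 0) :
    ∃ b, ball b (R * ‖deriv F c‖ / 128) ⊆ F '' ball c R := by
  have hsub : closedBall c (R / 2) ⊆ ball c R := closedBall_subset_ball (by linarith)
  have hcont : ContinuousOn (fun x => (R / 2 - dist x c) * ‖deriv F x‖) (closedBall c (R / 2)) :=
    (continuous_const.sub (continuous_id.dist continuous_const)).continuousOn.mul
      ((hF.deriv isOpen_ball).continuousOn.mono hsub).norm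
  obtain ⟨a, ha, hmax⟩ := (isCompact_closedBall c (R / 2)).exists_isMaxOn
    ⟨c, mem_closedBall_self (by positivity)⟩ hcont
  have hmax' : ∀ x ∈ closedBall c (R / 2),
      (R / 2 - dist x c) * ‖deriv F x‖ ≤ (R / 2 - dist a c) * ‖deriv F a‖ := fun x hx => hmax hx
  have hc := hmax' c (mem_closedBall_self (by positivity))
  rw [dist_self, sub_zero] at hc
  have hpos : 0 < R / 2 * ‖deriv F c‖ := by positivity
  rw [mem_closedBall] at ha
  have hprod := hpos.trans_le hc
  have hda : 0 < ‖deriv F a‖ := pos_of_mul_pos_right hprod (by linarith)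
  have ht2 : 0 < R / 2 - dist a c := pos_of_mul_pos_left hprod hda.le
  set t := (R / 2 - dist a c) / 2 with ht
  have ht0 : 0 < t := by positivity
  have hball : ball a t ⊆ closedBall c (R / 2) := fun x hx => by
    rw [mem_ball] at hx
    rw [mem_closedBall]
    linarith [dist_triangle x a c]
  refine ⟨F a, (ball_subset_ball ?_).trans ((ball_subset_image_ball_of_norm_deriv_le ht0
    (hF.mono (hball.trans hsub)) (norm_pos_iff.mp hda) fun x hx => ?_).trans
      (image_mono (hball.trans hsub)))⟩
  · rw [show t * ‖deriv F a‖ / 32 = (R / 2 - dist a c) * ‖deriv F a‖ / 64 by rw [ht]; ring]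
    linarith
  · have h1 := hmax' x (hball hx)
    have h2 : t ≤ R / 2 - dist x c := by
      rw [mem_ball] at hx
      linarith [dist_triangle x a c]
    have h3 : t * ‖deriv F x‖ ≤ t * (2 * ‖deriv F a‖) :=
      (mul_le_mul_of_nonneg_right h2 (norm_nonneg _)).trans (h1.trans_eq (by rw [ht]; ring))
    exact le_of_mul_le_mul_left h3 ht0

/-- A weak form of the Koebe quarter theorem. -/
lemma mul_norm_deriv_le_of_injOn_ball {φ : ℂ → ℂ} {c p : ℂ} {r : ℝ} (hr : 0 < r)
    (hφ : DifferentiableOn ℂ φ (ball c r)) (hinj : InjOn φ (ball c r))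
    (hp : p ∉ φ '' ball c r) :
    r * ‖deriv φ c‖ ≤ 256 * π * ‖φ c - p‖ := by
  obtain ⟨L, -, hL, hexp⟩ := exists_log_of_differentiableOn_ball hr (hφ.sub_const p)
    (fun x hx h => hp ⟨x, hx, sub_eq_zero.mp h⟩)
  have hc0 : φ c - p ≠ 0 := fun h => hp ⟨c, mem_ball_self hr, sub_eq_zero.mp h⟩
  have hd : deriv L c = deriv φ c / (φ c - p) := by
    rw [(hL c (mem_ball_self hr)).deriv, deriv_sub_const]
  rcases eq_or_ne (deriv L c) 0 with h0 | h0
  · have : deriv φ c = 0 := by simpa [hd, hc0] using h0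
    rw [this, norm_zero, mul_zero]
    positivity
  obtain ⟨b, hb⟩ := exists_ball_subset_image_ball hr
    (fun x hx => (hL x hx).differentiableAt.differentiableWithinAt) h0
  have hle : r * ‖deriv L c‖ / 128 ≤ 2 * π := by
    by_contra! hlt
    have hpi := Real.pi_pos
    obtain ⟨x, hx, hxb⟩ := hb (mem_ball_self (hlt.trans' (by positivity)))
    obtain ⟨y, hy, hyb⟩ := hb (show b + 2 * π * I ∈ _ by
      simpa [mem_ball_iff_norm, abs_of_pos hpi] using hlt)
    have hxy : φ x - p = φ y - p := by
      rw [hexp x hx, hexp y hy, hxb, hyb, exp_periodic]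
    have := hinj hx hy (sub_left_injective hxy)
    rw [← this, hxb] at hyb
    simp at hyb
  rw [hd, norm_div, mul_div_assoc', div_div, div_le_iff₀ (by positivity)] at hle
  linarith

lemma re_div_sub_pos {v w k : ℂ} (h : dist v w < dist w k) : 0 < ((v - k) / (w - k)).re := by
  have hwk : w - k ≠ 0 := fun h0 => by
    rw [sub_eq_zero.mp h0, dist_self] at h
    exact absurd h (not_lt.mpr dist_nonneg)
  have he : (v - k) / (w - k) = 1 + (v - w) / (w - k) := by field_simp; ring
  have h1 : ‖(v - w) / (w - k)‖ < 1 := by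
    rw [norm_div, div_lt_one (norm_pos_iff.mpr hwk), ← dist_eq_norm, ← dist_eq_norm]
    exact h
  rw [he, add_re, one_re]
  linarith [neg_abs_le ((v - w) / (w - k)).re, abs_re_le_norm ((v - w) / (w - k))]

/-- The variation along a radius of the logarithms of `f - k` depends on `k ∈ K` only through the
endpoint values of `f`, as long as `K` is connected and the endpoint value is close to the initial
value. -/
lemma log_branch_sub_log_eq {K : Set ℂ} (hK : IsPreconnected K) {w : ℂ} {δ : ℝ}
    (hKδ : ∀ k ∈ K, δ ≤ dist w k) {f : ℂ → ℂ} {z : ℂ} {R : ℝ} (hR : 0 < R)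
    (hf : DifferentiableOn ℂ f (ball z R)) (hz : f z = w) (hfK : ∀ x ∈ ball z R, f x ∉ K)
    {L : ℂ → ℂ → ℂ} (hL0 : ∀ k ∈ K, L k z = 0)
    (hL : ∀ k ∈ K, ∀ x ∈ ball z R, HasDerivAt (L k) (deriv f x / (f x - k)) x)
    (hexp : ∀ k ∈ K, ∀ x ∈ ball z R, f x - k = (w - k) * exp (L k x))
    {u : ℂ} (hu : u ∈ ball z R) (hfu : dist (f u) w < δ) {a b : ℂ} (ha : a ∈ K) (hb : b ∈ K) :
    L a u - log ((f u - a) / (w - a)) = L b u - log ((f u - b) / (w - b)) := by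
  have hwK : ∀ k ∈ K, w - k ≠ 0 := fun k hk h =>
    hfK z (mem_ball_self hR) (by rw [hz, sub_eq_zero.mp h]; exact hk)
  have hfK' : ∀ x ∈ ball z R, ∀ k ∈ K, f x - k ≠ 0 := fun x hx k hk h =>
    hfK x hx (by rw [sub_eq_zero.mp h]; exact hk)
  set s : ℝ → ℝ := fun t => max 0 (min t 1) with hs
  set γ : ℝ → ℂ := fun t => z + s t * (u - z) with hγ
  have hsc : Continuous s := by fun_prop
  have hγc : Continuous γ := by fun_prop
  have hs1 : ∀ t, |s t| ≤ 1 := fun t => by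
    rw [abs_of_nonneg (le_max_left _ _)]
    exact max_le zero_le_one (min_le_right _ _)
  have hγball : ∀ t, γ t ∈ ball z R := fun t => by
    rw [mem_ball_iff_norm] at hu ⊢
    simp only [hγ, add_sub_cancel_left, norm_mul, norm_real, Real.norm_eq_abs]
    exact (mul_le_of_le_one_left (norm_nonneg _) (hs1 t)).trans_lt hu
  have hfγ : Continuous fun t => f (γ t) := hf.continuousOn.comp_continuous hγc hγball
  have hdfγ : Continuous fun t => deriv f (γ t) :=
    (hf.deriv isOpen_ball).continuousOn.comp_continuous hγc hγball
  have hint : ∀ k ∈ K, L k u = ∫ t in (0 : ℝ)..1, deriv f (γ t) / (f (γ t) - k) * (u - z) := by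
    intro k hk
    have hcont : Continuous fun t => deriv f (γ t) / (f (γ t) - k) * (u - z) :=
      (hdfγ.div (hfγ.sub continuous_const) fun t => hfK' _ (hγball t) k hk).mul continuous_const
    rw [intervalIntegral.integral_eq_sub_of_hasDerivAt
      (f := fun t : ℝ => L k (z + t * (u - z))) (fun t ht => ?_) (hcont.intervalIntegrable _ _)]
    · simp [hL0 k hk]
    · rw [uIcc_of_le zero_le_one] at ht
      have hst : s t = t := by simp [hs, ht.1, ht.2]
      have hb := hγball t
      simp only [hγ, hst] at hb ⊢
      have h1 : HasDerivAt (fun t : ℝ => z + t * (u - z)) (u - z) t := by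
        simpa using! ((ofRealCLM.hasDerivAt (x := t)).mul_const (u - z)).const_add z
      exact (hL k hk _ hb).comp t h1
  have hcontL : ContinuousOn (fun k => L k u) K := by
    refine ContinuousOn.congr ?_ hint
    rw [continuousOn_iff_continuous_domRestrict]
    refine intervalIntegral.continuous_parametric_intervalIntegral_of_continuous'
      (f := fun (k : K) t => deriv f (γ t) / (f (γ t) - k) * (u - z)) ?_ 0 1
    refine Continuous.mul (Continuous.div (hdfγ.comp continuous_snd)
      ((hfγ.comp continuous_snd).sub (continuous_subtype_val.comp continuous_fst)) ?_)
      continuous_const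
    exact fun p => hfK' _ (hγball _) _ p.1.2
  have hcontlog : ContinuousOn (fun k => log ((f u - k) / (w - k))) K := by
    refine ContinuousOn.clog ((continuousOn_const.sub continuousOn_id).div
      (continuousOn_const.sub continuousOn_id) hwK) fun k hk => ?_
    exact Or.inl (re_div_sub_pos (hfu.trans_le (hKδ k hk)))
  have hmaps : MapsTo (fun k => L k u - log ((f u - k) / (w - k))) K
      (AddSubgroup.zmultiples (2 * π * I) : Set ℂ) := by
    intro k hk
    have h1 : exp (L k u) = exp (log ((f u - k) / (w - k))) := by
      rw [exp_log (div_ne_zero (hfK' u hu k hk) (hwK k hk)), eq_div_iff (hwK k hk), mul_comm]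
      exact (hexp k hk u hu).symm
    obtain ⟨n, hn⟩ := exp_eq_exp_iff_exists_int.mp h1
    refine AddSubgroup.mem_zmultiples_iff.mpr ⟨n, ?_⟩
    simp [hn]
  exact hK.constant_of_mapsTo (isDiscrete_iff_discreteTopology.mpr
    (NormedSpace.discreteTopology_zmultiples _)) (hcontL.sub hcontlog) hmaps ha hb

/-- A Landau-type theorem: the derivative at the centre of a disk of a holomorphic function omitting
a connected set with at least two points is controlled by its value there. -/
lemma exists_norm_deriv_mul_le_of_omits {K : Set ℂ} (hK : IsPreconnected K) {w : ℂ} {δ : ℝ}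
    (hδ : 0 < δ) (hKδ : ∀ k ∈ K, δ ≤ dist w k) {a b : ℂ} (ha : a ∈ K) (hb : b ∈ K) (hab : a ≠ b) :
    ∃ C : ℝ, ∀ (f : ℂ → ℂ) (z : ℂ) (R : ℝ), 0 < R → DifferentiableOn ℂ f (ball z R) → f z = w →
      (∀ x ∈ ball z R, f x ∉ K) → ‖deriv f z‖ * R ≤ C := by
  have hwK : ∀ k ∈ K, w - k ≠ 0 := fun k hk h => by
    have := hKδ k hk
    rw [sub_eq_zero.mp h, dist_self] at this
    linarith
  have hwa := hwK a ha
  have hwb := hwK b hb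
  set q := (w - a) / (w - b) with hq
  have hq1 : 1 - q ≠ 0 := fun h => hab <| by
    rw [hq, sub_eq_zero, eq_comm, div_eq_one_iff_eq hwb] at h
    linear_combination -h
  set T : ℂ → ℂ := fun h => (a - b * (q * exp h)) / (1 - q * exp h) with hT
  have hT1 : 1 - q * exp (2 * π * I) ≠ 0 := by simpa [exp_two_pi_mul_I] using hq1
  have hT0 : T (2 * π * I) = w := by
    simp only [hT, exp_two_pi_mul_I, mul_one]
    rw [div_eq_iff hq1, hq]
    field_simp
    ring
  have hTc : ContinuousAt T (2 * π * I) := by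
    refine ContinuousAt.div ?_ ?_ hT1 <;> fun_prop
  have hev : ∀ᶠ h in 𝓝 (2 * π * I : ℂ), dist (T h) w < δ ∧ 1 - q * exp h ≠ 0 := by
    refine Filter.Eventually.and ?_ ?_
    · rw [ContinuousAt, hT0] at hTc
      exact hTc.eventually (ball_mem_nhds w hδ)
    · exact ContinuousAt.eventually_ne (by fun_prop) hT1
  obtain ⟨ε, hε, hεT⟩ := Metric.eventually_nhds_iff.mp
    (hev.and (ball_mem_nhds (2 * π * I : ℂ) Real.pi_pos))
  set κ := ‖1 / (w - a) - 1 / (w - b)‖ with hκ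
  have hκ0 : 0 < κ := by
    rw [hκ, norm_pos_iff, div_sub_div _ _ hwa hwb]
    refine div_ne_zero (fun h => hab ?_) (mul_ne_zero hwa hwb)
    linear_combination h
  refine ⟨8 * π ^ 2 / (ε * κ), fun f z R hR hf hz hfK => ?_⟩
  have hne : ∀ k ∈ K, ∀ x ∈ ball z R, f x - k ≠ 0 := fun k hk x hx h =>
    hfK x hx (by rw [sub_eq_zero.mp h]; exact hk)
  have hlog : ∀ k, ∃ L : ℂ → ℂ, k ∈ K → L z = 0 ∧
      (∀ x ∈ ball z R, HasDerivAt L (deriv f x / (f x - k)) x) ∧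
      ∀ x ∈ ball z R, f x - k = (w - k) * exp (L x) := fun k => by
    by_cases hk : k ∈ K
    · obtain ⟨L, h1, h2, h3⟩ :=
        exists_log_of_differentiableOn_ball hR (hf.sub_const k) (hne k hk)
      simp only [deriv_sub_const, hz] at h2 h3
      exact ⟨L, fun _ => ⟨h1, h2, h3⟩⟩
    · exact ⟨0, fun h => absurd h hk⟩
  choose L hL using hlog
  have hzR := mem_ball_self (x := z) hR
  have havoid : ∀ x ∈ ball z R, ε ≤ ‖L a x - L b x - 2 * π * I‖ := by
    intro x hx
    by_contra! hlt
    rw [← dist_eq_norm] at hlt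
    obtain ⟨⟨hTx, hTne⟩, hπ⟩ := hεT hlt
    have hqexp : q * exp (L a x - L b x) = (f x - a) / (f x - b) := by
      rw [(hL a ha).2.2 x hx, (hL b hb).2.2 x hx, exp_sub, hq]
      have := exp_ne_zero (L b x)
      field_simp
    have hTf : T (L a x - L b x) = f x := by
      simp only [hT]
      rw [div_eq_iff hTne, hqexp]
      have := hne b hb x hx
      field_simp
      ring
    rw [hTf] at hTx
    have heq := log_branch_sub_log_eq hK hKδ hR hf hz hfK (fun k hk => (hL k hk).1)
      (fun k hk => (hL k hk).2.1) (fun k hk => (hL k hk).2.2) hx hTx ha hb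
    have harg : ∀ k ∈ K, |(log ((f x - k) / (w - k))).im| < π / 2 := fun k hk => by
      rw [log_im, abs_arg_lt_pi_div_two_iff]
      exact Or.inl (re_div_sub_pos (hTx.trans_le (hKδ k hk)))
    have him : (L a x - L b x).im =
        (log ((f x - a) / (w - a))).im - (log ((f x - b) / (w - b))).im := by
      rw [← sub_im]
      congr 1
      linear_combination heq
    have h1 := abs_lt.mp (harg a ha)
    have h2 := abs_lt.mp (harg b hb)
    rw [dist_eq_norm] at hπ
    have h3 := (abs_le.mp (abs_im_le_norm (L a x - L b x - 2 * π * I))).1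
    rw [sub_im, him] at h3
    have h4 : (2 * π * I : ℂ).im = 2 * π := by simp
    rw [h4] at h3
    linarith
  set G : ℂ → ℂ := fun x => (L a x - L b x - 2 * π * I)⁻¹ with hG
  have hdH : ∀ x ∈ ball z R, HasDerivAt (fun x => L a x - L b x - 2 * π * I)
      (deriv f x / (f x - a) - deriv f x / (f x - b)) x := fun x hx =>
    (((hL a ha).2.1 x hx).sub ((hL b hb).2.1 x hx)).sub_const _
  have hdG : ∀ x ∈ ball z R, HasDerivAt G
      (-(deriv f x / (f x - a) - deriv f x / (f x - b)) / (L a x - L b x - 2 * π * I) ^ 2) x :=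
    fun x hx => (hdH x hx).fun_inv (norm_pos_iff.mp (hε.trans_le (havoid x hx)))
  have hGd : DifferentiableOn ℂ G (ball z R) := fun x hx =>
    (hdG x hx).differentiableAt.differentiableWithinAt
  have hsub : closedBall z (R / 2) ⊆ ball z R := closedBall_subset_ball (by linarith)
  have hcauchy := norm_deriv_le_of_forall_mem_sphere_norm_le (half_pos hR)
    (hGd.diffContOnCl_ball hsub) (C := ε⁻¹) (fun x hx => by
      simp only [hG, norm_inv]
      exact inv_anti₀ hε (havoid x (hsub (sphere_subset_closedBall hx))))
  have hnorm : ‖deriv G z‖ = ‖deriv f z‖ * κ / (4 * π ^ 2) := by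
    rw [(hdG z hzR).deriv, (hL a ha).1, (hL b hb).1, hz, hκ, ← norm_mul, norm_div, norm_neg]
    congr 1
    · congr 1
      ring
    · simp [mul_pow, abs_of_pos Real.pi_pos]
      norm_num
  rw [hnorm, div_le_div_iff₀ (by positivity) (by positivity)] at hcauchy
  rw [le_div_iff₀ (by positivity)]
  have : ε * (‖deriv f z‖ * κ * (R / 2)) ≤ ε * (ε⁻¹ * (4 * π ^ 2)) := by gcongr
  rw [mul_inv_cancel_left₀ hε.ne'] at this
  linarith

/-- A continuous right inverse of an entire function on an open connected set is holomorphic. -/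
lemma differentiableOn_of_continuousOn_rightInverse {f : ℂ → ℂ} (hf : Differentiable ℂ f)
    {φ : ℂ → ℂ} {V : Set ℂ} (hV : IsOpen V) (hφ : ContinuousOn φ V)
    (hfφ : ∀ u ∈ V, f (φ u) = u) : DifferentiableOn ℂ φ V := by
  have hne : ∀ u ∈ V, deriv f (φ u) ≠ 0 → DifferentiableAt ℂ φ u := fun u hu h =>
    (HasDerivAt.of_local_left_inverse (hφ.continuousAt (hV.mem_nhds hu))
      (hf (φ u)).hasDerivAt h
      (eventually_of_mem (hV.mem_nhds hu) hfφ)).differentiableAt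
  intro u hu
  refine DifferentiableAt.differentiableWithinAt ?_
  have hcont := hφ.continuousAt (hV.mem_nhds hu)
  refine (analyticAt_of_differentiable_on_punctured_nhds_of_continuousAt ?_ hcont).differentiableAt
  have hpunct : Tendsto φ (𝓝[≠] u) (𝓝[≠] (φ u)) := by
    refine tendsto_nhdsWithin_iff.mpr ⟨hcont.tendsto.mono_left nhdsWithin_le_nhds, ?_⟩
    filter_upwards [self_mem_nhdsWithin, nhdsWithin_le_nhds (hV.mem_nhds hu)] with v hv hvV h
    exact hv (by rw [mem_singleton_iff, ← hfφ v hvV, h, hfφ u hu])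
  have hVev : ∀ᶠ v in 𝓝[≠] u, v ∈ V := nhdsWithin_le_nhds (hV.mem_nhds hu)
  have hdf : AnalyticOnNhd ℂ (deriv f) univ := fun x _ => (hf.analyticAt x).deriv
  rcases (hdf (φ u) trivial).eventually_eq_zero_or_eventually_ne_zero with h0 | h0
  · have hall := hdf.eqOn_zero_of_preconnected_of_eventuallyEq_zero isPreconnected_univ trivial h0
    have hconst := is_const_of_deriv_eq_zero hf (fun x => hall (mem_univ x))
    obtain ⟨v, hvV, hvu⟩ := (hVev.and self_mem_nhdsWithin).exists
    exact absurd (by rw [← hfφ v hvV, ← hfφ u hu]; exact hconst _ _) hvu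
  · filter_upwards [hpunct.eventually h0, hVev] with v hv hvV
    exact hne v hvV hv

/-- Holomorphic inverse branches on a uniform disk about a regular value. -/
lemma IsRegularValue.exists_inverse_branch {f : ℂ → ℂ} (hf : Differentiable ℂ f) {w : ℂ}
    (hw : IsRegularValue f w) :
    ∃ ρ > 0, ∀ z, f z = w → ∃ φ : ℂ → ℂ, DifferentiableOn ℂ φ (ball w ρ) ∧ φ w = z ∧
      ∀ u ∈ ball w ρ, f (φ u) = u := by
  obtain ⟨U, hU, hwU, hcov⟩ := hw
  obtain ⟨ρ, hρ, hρU⟩ := Metric.isOpen_iff.mp hU w hwU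
  refine ⟨ρ, hρ, fun z hz => ?_⟩
  have hzU : z ∈ f ⁻¹' U := by rwa [mem_preimage, hz]
  obtain ⟨e, he⟩ := hcov z hzU
  classical
  set φ : ℂ → ℂ := fun u => if h : u ∈ U then (e.symm ⟨u, h⟩ : ℂ) else 0 with hφ
  have hφU : ∀ u (h : u ∈ U), φ u = (e.symm ⟨u, h⟩ : ℂ) := fun u h => by simp [hφ, h]
  have hfφ : ∀ u ∈ U, f (φ u) = u := fun u h => by
    rw [hφU u h, ← he, e.apply_symm_apply]
  have hφc : ContinuousOn φ U := by
    rw [continuousOn_iff_continuous_domRestrict]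
    exact (continuous_subtype_val.comp e.symm.continuous).congr fun u => (hφU u u.2).symm
  refine ⟨φ, (differentiableOn_of_continuousOn_rightInverse hf hU hφc hfφ).mono hρU, ?_,
    fun u hu => hfφ u (hρU hu)⟩
  have hez : e ⟨z, mem_connectedComponentIn hzU⟩ = ⟨w, hwU⟩ := Subtype.ext (by rw [he, hz])
  rw [hφU w hwU, ← hez, e.symm_apply_apply]

theorem distances_and_area_property (f : ℂ → ℂ) (hf : TranscendentalEntire f)
    (w : ℂ) (hw : w ∉ singularSet f)
    (K : Set ℂ) (hKclosed : IsClosed K) (hKconn : IsConnected K)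
    (hKsing : singularSet f ⊆ K) (hwK : w ∉ K) (hKcard : 1 < K.encard) :
    FiberSummable f w ↔
      Summable (fun z : {z : ℂ // f z = w ∧ 1 ≤ ‖z‖} =>
        Metric.infDist (z : ℂ) (f ⁻¹' K) ^ 2 / ‖(z : ℂ)‖ ^ 2) := by
  have hd := hf.1
  obtain ⟨ρ, hρ, hbranch⟩ := (not_not.mp hw : IsRegularValue f w).exists_inverse_branch hd
  obtain ⟨δ, hδ, hδK⟩ := Metric.isOpen_iff.mp hKclosed.isOpen_compl w hwK
  obtain ⟨a, b, ha, hb, hab⟩ := Set.one_lt_encard_iff.mp hKcard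
  have hKδ : ∀ k ∈ K, δ ≤ dist w k := fun k hk => by
    by_contra! h
    exact hδK (mem_ball'.mpr h) hk
  obtain ⟨C, hC⟩ := exists_norm_deriv_mul_le_of_omits hKconn.isPreconnected hδ hKδ ha hb hab
  set r := min ρ δ with hr
  have hr0 : 0 < r := lt_min hρ hδ
  have hlower : ∀ z, f z = w → deriv f z ≠ 0 ∧
      ∀ p ∈ f ⁻¹' K, r ≤ 256 * π * (‖deriv f z‖ * dist z p) := by
    intro z hz
    obtain ⟨φ, hφ, hφw, hfφ⟩ := hbranch z hz
    have hwρ := mem_ball_self (x := w) hρ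
    have hprod : deriv f z * deriv φ w = 1 := by
      have h1 := (hφ.differentiableAt (isOpen_ball.mem_nhds hwρ)).hasDerivAt
      have h2 : HasDerivAt (f ∘ φ) (deriv f z * deriv φ w) w :=
        HasDerivAt.comp w (by rw [hφw]; exact (hd z).hasDerivAt) h1
      refine h2.unique ((hasDerivAt_id w).congr_of_eventuallyEq ?_)
      exact eventually_of_mem (isOpen_ball.mem_nhds hwρ) hfφ
    refine ⟨left_ne_zero_of_mul_eq_one hprod, fun p hp => ?_⟩
    have hsub : ball w r ⊆ ball w ρ := ball_subset_ball (min_le_left _ _)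
    have hinj : InjOn φ (ball w r) := fun u hu v hv huv => by
      rw [← hfφ u (hsub hu), ← hfφ v (hsub hv), huv]
    have hkoebe := mul_norm_deriv_le_of_injOn_ball hr0 (hφ.mono hsub) hinj (p := p) (by
      rintro ⟨u, hu, rfl⟩
      rw [mem_preimage, hfφ u (hsub hu)] at hp
      exact hδK (ball_subset_ball (min_le_right _ _) hu) hp)
    have hn : ‖deriv f z‖ * ‖deriv φ w‖ = 1 := by rw [← norm_mul, hprod, norm_one]
    rw [hφw, ← dist_eq_norm] at hkoebe
    calc r = ‖deriv f z‖ * (r * ‖deriv φ w‖) := by linear_combination -r * hn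
      _ ≤ ‖deriv f z‖ * (256 * π * dist z p) := by gcongr
      _ = _ := by ring
  unfold FiberSummable
  rcases (f ⁻¹' K).eq_empty_or_nonempty with hempty | hne
  · have : IsEmpty {z : ℂ // f z = w ∧ 1 ≤ ‖z‖} := by
      refine ⟨fun z => (hlower z z.2.1).1 ?_⟩
      by_contra h0
      have hpos := norm_pos_iff.mpr h0
      have h := hC f z ((|C| + 1) / ‖deriv f z‖) (by positivity) hd.differentiableOn z.2.1
        (fun x _ hx => (hempty ▸ (show x ∈ f ⁻¹' K from hx) : x ∈ (∅ : Set ℂ)))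
      rw [mul_div_cancel₀ _ hpos.ne'] at h
      linarith [le_abs_self C]
    exact iff_of_true hasSum_empty.summable hasSum_empty.summable
  have hupper : ∀ z, f z = w → ‖deriv f z‖ * infDist z (f ⁻¹' K) ≤ |C| := by
    intro z hz
    rcases (infDist_nonneg (x := z) (s := f ⁻¹' K)).eq_or_lt with h0 | h0
    · rw [← h0, mul_zero]
      positivity
    · refine (hC f z _ h0 hd.differentiableOn hz fun x hx hxK => ?_).trans (le_abs_self C)
      exact (mem_ball'.mp hx).not_ge (infDist_le_dist_of_mem hxK)
  have hlower' : ∀ z, f z = w → r ≤ 256 * π * (‖deriv f z‖ * infDist z (f ⁻¹' K)) := by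
    intro z hz
    have hpos := norm_pos_iff.mpr (hlower z hz).1
    have hpi := Real.pi_pos
    have : r / (256 * π * ‖deriv f z‖) ≤ infDist z (f ⁻¹' K) :=
      (le_infDist hne).mpr fun p hp => by
        rw [div_le_iff₀ (by positivity)]
        linarith [(hlower z hz).2 p hp]
    rw [div_le_iff₀ (by positivity)] at this
    linarith
  constructor <;> intro hs
  · refine Summable.of_nonneg_of_le (fun z => by positivity) (fun z => ?_) (hs.mul_left (|C| ^ 2))
    have hz : (0 : ℝ) < ‖(z : ℂ)‖ := one_pos.trans_le z.2.2
    have hpos := norm_pos_iff.mpr (hlower z z.2.1).1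
    rw [mul_one_div, div_le_div_iff₀ (by positivity) (by positivity)]
    have h := pow_le_pow_left₀ (mul_nonneg hpos.le infDist_nonneg) (hupper z z.2.1) 2
    calc _ = (‖deriv f z‖ * infDist (z : ℂ) (f ⁻¹' K)) ^ 2 * ‖(z : ℂ)‖ ^ 2 := by ring
      _ ≤ _ := by gcongr
  · refine Summable.of_nonneg_of_le (fun z => by positivity) (fun z => ?_)
      (hs.mul_left ((256 * π / r) ^ 2))
    have hz : (0 : ℝ) < ‖(z : ℂ)‖ := one_pos.trans_le z.2.2
    have hpos := norm_pos_iff.mpr (hlower z z.2.1).1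
    have h : 1 ≤ 256 * π / r * (‖deriv f z‖ * infDist (z : ℂ) (f ⁻¹' K)) := by
      rw [div_mul_eq_mul_div, one_le_div hr0]
      exact hlower' z z.2.1
    have h2 := one_le_pow₀ h (n := 2)
    rw [← mul_div_assoc, div_le_div_iff₀ (by positivity) (by positivity), one_mul]
    calc ‖(z : ℂ)‖ ^ 2
        ≤ (256 * π / r * (‖deriv f z‖ * infDist (z : ℂ) (f ⁻¹' K))) ^ 2 * ‖(z : ℂ)‖ ^ 2 :=
          le_mul_of_one_le_left (by positivity) h2
      _ = _ := by ring
end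

section
/- Let p be a polynomial of degree ≥ 2 with p(0) = 0 and |λ| > 1 where λ = p′(0), and let f be the Poincaré function of p at 0 (the entire function with f(0) = 0, f′(0) = 1 and f(λz) = p(f(z)) for all z). Let w ∈ ℂ with w ∉ P(p), where P(p) is the closure of ⋃_{n ≥ 1} pⁿ({c ∈ ℂ : p′(c) = 0}). If the Poincaré series Σ_{n ≥ 1} Σ_{ζ ∈ ℂ : pⁿ(ζ) = w} 1/|(pⁿ)′(ζ)|² converges, then Σ_{z ∈ f⁻¹(w), |z| ≥ 1} 1/(|z|²·|f′(z)|²) < ∞. -/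
open Complex Set Filter Topology Metric MeasureTheory
open scoped ENNReal Real

/-- The postcritical set of a polynomial. -/
noncomputable def postcriticalSet (p : Polynomial ℂ) : Set ℂ :=
  closure (⋃ n ∈ {n : ℕ | 1 ≤ n},
    (fun z : ℂ => p.eval z)^[n] '' {c : ℂ | p.derivative.eval c = 0})

/-- An entire function with derivative `1` at `0` is injective, with derivative bounded below, on
a small ball around `0`. -/
theorem exists_ball_injOn_half_le_norm_deriv {f : ℂ → ℂ} (hf : Differentiable ℂ f)
    (hf1 : deriv f 0 = 1) :
    ∃ ρ : ℝ, 0 < ρ ∧ ρ ≤ 1 ∧ InjOn f (ball 0 ρ) ∧ ∀ u ∈ ball (0 : ℂ) ρ, 1 / 2 ≤ ‖deriv f u‖ := by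
  have hs : HasStrictDerivAt f (deriv f 0) 0 := (hf.analyticAt 0).hasStrictDerivAt
  have hinv := hs.eventually_left_inverse (by simp [hf1])
  have hcont : Continuous (deriv f) := (hf.contDiff (n := 1)).continuous_deriv le_rfl
  have hd : ∀ᶠ u in 𝓝 (0 : ℂ), 1 / 2 < ‖deriv f u‖ :=
    hcont.norm.continuousAt.eventually_const_lt (by norm_num [hf1])
  obtain ⟨r, hr, h⟩ := Metric.eventually_nhds_iff_ball.1 (hinv.and hd)
  have hsub : ball (0 : ℂ) (min r 1) ⊆ ball 0 r := ball_subset_ball (min_le_left _ _)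
  refine ⟨min r 1, lt_min hr one_pos, min_le_right _ _, ?_, fun u hu => (h u (hsub hu)).2.le⟩
  intro x hx y hy hxy
  rw [← (h x (hsub hx)).1, ← (h y (hsub hy)).1, hxy]

/-- Iterating the linearization equation `f (μ z) = g (f z)`. -/
theorem linearization_iterate {f g : ℂ → ℂ} {μ : ℂ} (hfun : ∀ z, f (μ * z) = g (f z))
    (n : ℕ) (z : ℂ) : f (μ ^ n * z) = g^[n] (f z) := by
  induction n generalizing z with
  | zero => simp
  | succ n ih => rw [pow_succ, mul_assoc, ih, hfun, Function.iterate_succ_apply]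

/-- Chain rule for the iterated linearization equation. -/
theorem linearization_iterate_deriv {f g : ℂ → ℂ} {μ : ℂ} (hf : Differentiable ℂ f)
    (hg : Differentiable ℂ g) (hfun : ∀ z, f (μ * z) = g (f z)) (n : ℕ) (z : ℂ) :
    deriv f (μ ^ n * z) * μ ^ n = deriv g^[n] (f z) * deriv f z := by
  have h1 : HasDerivAt (fun z => f (μ ^ n * z)) (deriv f (μ ^ n * z) * μ ^ n) z := by
    have := (hf (μ ^ n * z)).hasDerivAt.comp z ((hasDerivAt_id z).const_mul (μ ^ n))
    rwa [mul_one] at this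
  have h2 : HasDerivAt (fun z => g^[n] (f z)) (deriv g^[n] (f z) * deriv f z) z :=
    (hg.iterate n (f z)).hasDerivAt.comp z (hf z).hasDerivAt
  rw [funext fun z => linearization_iterate hfun n z] at h1
  exact h1.unique h2

/-- Every point outside the ball of radius `ρ` lies in a forward image of the fundamental annulus
`ρ / ‖μ‖ ≤ ‖u‖ < ρ` of the map `u ↦ μ u`. -/
theorem exists_pow_mul_mem_annulus {μ : ℂ} (hμ : 1 < ‖μ‖) {ρ : ℝ} (hρ : 0 < ρ) {z : ℂ}
    (hz : ρ ≤ ‖z‖) :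
    ∃ (n : ℕ) (u : ℂ), 1 ≤ n ∧ z = μ ^ n * u ∧ ρ / ‖μ‖ ≤ ‖u‖ ∧ ‖u‖ < ρ := by
  have hμ0 : 0 < ‖μ‖ := one_pos.trans hμ
  obtain ⟨n, h1, h2⟩ := exists_nat_pow_near ((one_le_div hρ).2 hz) hμ
  have hpow : μ ^ (n + 1) ≠ 0 := pow_ne_zero _ (norm_pos_iff.1 hμ0)
  have hpos : 0 < ‖μ‖ ^ (n + 1) := by positivity
  refine ⟨n + 1, z / μ ^ (n + 1), by omega, by field_simp, ?_, ?_⟩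
  · rw [norm_div, norm_pow, div_le_div_iff₀ hμ0 hpos]
    rw [le_div_iff₀ hρ] at h1
    calc ρ * ‖μ‖ ^ (n + 1) = ‖μ‖ ^ n * ρ * ‖μ‖ := by ring
      _ ≤ ‖z‖ * ‖μ‖ := by gcongr
  · rw [norm_div, norm_pow, div_lt_iff₀ hpos]
    rwa [div_lt_iff₀ hρ, mul_comm] at h2

theorem poincare_series_controls_area_property (p : Polynomial ℂ)
    (hD : 2 ≤ p.natDegree)
    (hfix : p.eval 0 = 0) (hrep : 1 < ‖p.derivative.eval 0‖)
    (f : ℂ → ℂ) (hf : Differentiable ℂ f)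
    (hf0 : f 0 = 0) (hf1 : deriv f 0 = 1)
    (hfun : ∀ z : ℂ, f (p.derivative.eval 0 * z) = p.eval (f z))
    (w : ℂ) (hw : w ∉ postcriticalSet p)
    (hPoincare : Summable
      (fun x : {x : ℕ × ℂ // 1 ≤ x.1 ∧ (fun z : ℂ => p.eval z)^[x.1] x.2 = w} =>
        1 / ‖deriv ((fun z : ℂ => p.eval z)^[x.1.1]) x.1.2‖ ^ 2)) :
    FiberSummable f w := by
  obtain ⟨ρ, hρ, hρ1, hinj, hder⟩ := exists_ball_injOn_half_le_norm_deriv hf hf1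
  set μ := p.derivative.eval 0
  have hg : Differentiable ℂ fun z : ℂ => p.eval z := p.differentiable
  have hann : ∀ z : {z : ℂ // f z = w ∧ 1 ≤ ‖z‖}, ∃ (n : ℕ) (u : ℂ),
      1 ≤ n ∧ (z : ℂ) = μ ^ n * u ∧ ρ / ‖μ‖ ≤ ‖u‖ ∧ ‖u‖ < ρ :=
    fun z => exists_pow_mul_mem_annulus hrep hρ (hρ1.trans z.2.2)
  choose n u hn hz hlow hup using hann
  let Φ : {z : ℂ // f z = w ∧ 1 ≤ ‖z‖} →
      {x : ℕ × ℂ // 1 ≤ x.1 ∧ (fun z : ℂ => p.eval z)^[x.1] x.2 = w} := fun z =>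
    ⟨(n z, f (u z)), hn z, by
      rw [← linearization_iterate (g := fun z : ℂ => p.eval z) hfun, ← hz]; exact z.2.1⟩
  have hΦ : Function.Injective Φ := by
    intro x y hxy
    have h := Prod.mk.inj (Subtype.mk.inj hxy)
    have hu : u x = u y := hinj (by simpa using hup x) (by simpa using hup y) h.2
    exact Subtype.ext (by rw [hz x, hz y, h.1, hu])
  have hμ0 : 0 < ‖μ‖ := one_pos.trans hrep
  set c : ℝ := ρ / ‖μ‖ * (1 / 2)
  have hc : 0 < c := by positivity
  refine Summable.of_nonneg_of_le (fun z => by positivity) (fun z => ?_)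
    ((hPoincare.comp_injective hΦ).mul_left (1 / c ^ 2))
  have hfu : 1 / 2 ≤ ‖deriv f (u z)‖ := hder _ (by simpa using hup z)
  have hchain : ‖(z : ℂ)‖ * ‖deriv f z‖ =
      ‖u z‖ * ‖deriv f (u z)‖ * ‖deriv (fun z : ℂ => p.eval z)^[n z] (f (u z))‖ := by
    have h := congrArg norm (linearization_iterate_deriv hf hg hfun (n z) (u z))
    rw [← hz, norm_mul, norm_mul] at h
    rw [mul_assoc, mul_comm ‖deriv f (u z)‖, ← h]
    conv_lhs => rw [congrArg norm (hz z), norm_mul]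
    ring
  rw [← mul_pow, hchain]
  change _ ≤ 1 / c ^ 2 * (1 / ‖deriv (fun z : ℂ => p.eval z)^[n z] (f (u z))‖ ^ 2)
  rw [mul_pow, one_div_mul_one_div, mul_comm, ← one_div_mul_one_div, mul_comm (c ^ 2),
    ← one_div_mul_one_div]
  have hcu : c ≤ ‖u z‖ * ‖deriv f (u z)‖ :=
    mul_le_mul (hlow z) hfu (by norm_num) (norm_nonneg _)
  gcongr
end

section
/- There exists a transcendental entire function f with finite singular set S(f), having no finite asymptotic values, such that for some R > 0, liminf_{r→∞} (1/log r)·∫_{{z : 1 ≤ |z| ≤ r, |f(z)| ≤ R}} dx dy/|z|² > 0. In particular, the Eremenko–Lyubich conjecture that condition (★) implies the existence of a finite asymptotic value is false. -/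
open Complex Set Filter Topology Metric MeasureTheory
open scoped ENNReal Real

def asymptoticValues (f : ℂ → ℂ) : Set ℂ :=
  {a : ℂ | ∃ γ : ℝ → ℂ, ContinuousOn γ (Set.Ico 0 1) ∧
    Filter.Tendsto (fun t => ‖γ t‖) (nhdsWithin 1 (Set.Ico (0 : ℝ) 1)) Filter.atTop ∧
    Filter.Tendsto (fun t => f (γ t)) (nhdsWithin 1 (Set.Ico (0 : ℝ) 1)) (nhds a)}

/-! ### Linearization at a repelling fixed point of multiplier `6` -/

/-- The cubic `u ↦ 6 u + c u² + u³ / 2`. -/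
noncomputable def cubicGerm (c : ℝ) (u : ℂ) : ℂ := 6 * u + c * u ^ 2 + u ^ 3 / 2

lemma one_add_norm_cubicGerm_le {c : ℝ} (hc : 0 ≤ c) (hc' : c ≤ 15) (u : ℂ) :
    1 + ‖cubicGerm c u‖ ≤ (1 + ‖u‖) ^ 6 := by
  have h : ‖cubicGerm c u‖ ≤ 6 * ‖u‖ + c * ‖u‖ ^ 2 + ‖u‖ ^ 3 / 2 := by
    refine (norm_add₃_le).trans ?_
    simp [abs_of_nonneg hc]
  have h0 := norm_nonneg u
  have h1 : c * ‖u‖ ^ 2 ≤ 15 * ‖u‖ ^ 2 := by gcongr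
  have : 0 ≤ ‖u‖ ^ 3 * 19.5 + 15 * ‖u‖ ^ 4 + 6 * ‖u‖ ^ 5 + ‖u‖ ^ 6 := by positivity
  nlinarith

lemma norm_cubicGerm_sub_le {c x : ℝ} (hc : 0 ≤ c) (hc' : c ≤ 15) {u v : ℂ}
    (hu : ‖u‖ ≤ x) (hv : ‖v‖ ≤ x) :
    ‖cubicGerm c u - cubicGerm c v‖ ≤ 6 * (1 + x) ^ 5 * ‖u - v‖ := by
  have hx : 0 ≤ x := (norm_nonneg u).trans hu
  have e : cubicGerm c u - cubicGerm c v
      = (6 + c * (u + v) + (u ^ 2 + u * v + v ^ 2) / 2) * (u - v) := by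
    simp only [cubicGerm]; ring
  rw [e, norm_mul]
  gcongr
  have h1 : ‖(c : ℂ) * (u + v)‖ ≤ 15 * (x + x) := by
    rw [norm_mul, norm_real, Real.norm_of_nonneg hc]
    exact mul_le_mul hc' ((norm_add_le _ _).trans (add_le_add hu hv)) (norm_nonneg _) (by norm_num)
  have h2 : ‖(u ^ 2 + u * v + v ^ 2) / 2‖ ≤ (x ^ 2 + x * x + x ^ 2) / 2 := by
    rw [norm_div, norm_ofNat]
    gcongr
    refine norm_add₃_le.trans ?_
    rw [norm_pow, norm_mul, norm_pow]
    gcongr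
  calc ‖6 + c * (u + v) + (u ^ 2 + u * v + v ^ 2) / 2‖
      ≤ ‖(6 : ℂ)‖ + ‖(c : ℂ) * (u + v)‖ + ‖(u ^ 2 + u * v + v ^ 2) / 2‖ := norm_add₃_le
    _ ≤ 6 + 15 * (x + x) + (x ^ 2 + x * x + x ^ 2) / 2 := by
        rw [norm_ofNat]; gcongr
    _ ≤ 6 * (1 + x) ^ 5 := by
        have : 0 ≤ x ^ 2 * 58.5 + 60 * x ^ 3 + 30 * x ^ 4 + 6 * x ^ 5 := by positivity
        nlinarith

lemma one_add_norm_iterate_cubicGerm_le {c : ℝ} (hc : 0 ≤ c) (hc' : c ≤ 15) (u : ℂ) (n : ℕ) :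
    1 + ‖(cubicGerm c)^[n] u‖ ≤ (1 + ‖u‖) ^ 6 ^ n := by
  induction n with
  | zero => simp
  | succ n ih =>
    rw [Function.iterate_succ_apply', pow_succ, pow_mul]
    exact (one_add_norm_cubicGerm_le hc hc' _).trans (pow_le_pow_left₀ (by positivity) ih 6)

lemma norm_iterate_cubicGerm_sub_le {c x : ℝ} (hc : 0 ≤ c) (hc' : c ≤ 15) {u v : ℂ}
    (hu : ‖u‖ ≤ x) (hv : ‖v‖ ≤ x) (n : ℕ) :
    ‖(cubicGerm c)^[n] u - (cubicGerm c)^[n] v‖ ≤ 6 ^ n * (1 + x) ^ 6 ^ n * ‖u - v‖ := by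
  have hx : 0 ≤ x := (norm_nonneg u).trans hu
  induction n with
  | zero =>
    have := norm_nonneg (u - v)
    simp only [Function.iterate_zero, id, pow_zero, pow_one, one_mul]
    nlinarith
  | succ n ih =>
    have key : ∀ w : ℂ, ‖w‖ ≤ x → ‖(cubicGerm c)^[n] w‖ ≤ (1 + x) ^ 6 ^ n - 1 := by
      intro w hw
      have h1 := one_add_norm_iterate_cubicGerm_le hc hc' w n
      have h2 : (1 + ‖w‖) ^ 6 ^ n ≤ (1 + x) ^ 6 ^ n := by gcongr
      linarith
    rw [Function.iterate_succ_apply', Function.iterate_succ_apply']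
    calc _ ≤ 6 * (1 + ((1 + x) ^ 6 ^ n - 1)) ^ 5 * ‖(cubicGerm c)^[n] u - (cubicGerm c)^[n] v‖ :=
          norm_cubicGerm_sub_le hc hc' (key u hu) (key v hv)
      _ ≤ 6 * (1 + ((1 + x) ^ 6 ^ n - 1)) ^ 5 * (6 ^ n * (1 + x) ^ 6 ^ n * ‖u - v‖) := by
          refine mul_le_mul_of_nonneg_left ih ?_
          rw [add_sub_cancel]; positivity
      _ = _ := by
          rw [add_sub_cancel, pow_succ 6 n, pow_succ 6 n, pow_mul]; ring

/-- The approximants `z ↦ Pⁿ(z / 6ⁿ)` of the linearizer of `P = cubicGerm c` at `0`. -/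
noncomputable def linApprox (c : ℝ) (n : ℕ) (z : ℂ) : ℂ := (cubicGerm c)^[n] (z / 6 ^ n)

lemma linApprox_succ_mul (c : ℝ) (n : ℕ) (z : ℂ) :
    linApprox c (n + 1) (6 * z) = cubicGerm c (linApprox c n z) := by
  rw [linApprox, linApprox, Function.iterate_succ_apply', pow_succ']
  congr 2
  field_simp

lemma norm_linApprox_sub_le {c : ℝ} (hc : 0 ≤ c) (hc' : c ≤ 15) {M : ℝ} {z : ℂ} (hz : ‖z‖ ≤ M)
    (n : ℕ) :
    ‖linApprox c (n + 1) z - linApprox c n z‖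
      ≤ Real.exp M * (15 * M ^ 2 + M ^ 3) * (1 / 6) ^ n := by
  have hM : 0 ≤ M := (norm_nonneg z).trans hz
  set q : ℝ := M / 6 ^ (n + 1) with hq
  have hq0 : 0 ≤ q := by positivity
  have hzq : ‖z / 6 ^ (n + 1)‖ ≤ q := by
    rw [norm_div, norm_pow, norm_ofNat]
    exact div_le_div_of_nonneg_right hz (by positivity)
  have hu : ‖cubicGerm c (z / 6 ^ (n + 1))‖ ≤ (1 + q) ^ 6 - 1 := by
    have h1 := one_add_norm_cubicGerm_le hc hc' (z / 6 ^ (n + 1))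
    have h2 : (1 + ‖z / 6 ^ (n + 1)‖) ^ 6 ≤ (1 + q) ^ 6 := by gcongr
    linarith
  have hv : ‖z / 6 ^ n‖ ≤ (1 + q) ^ 6 - 1 := by
    have h1 : ‖z / 6 ^ n‖ ≤ 6 * q := by
      rw [norm_div, norm_pow, norm_ofNat, hq, pow_succ']
      calc ‖z‖ / 6 ^ n ≤ M / 6 ^ n := by gcongr
        _ = _ := by field_simp
    have h2 := one_add_mul_le_pow (a := q) (by linarith) 6
    push_cast at h2
    linarith
  have hd : ‖cubicGerm c (z / 6 ^ (n + 1)) - z / 6 ^ n‖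
      ≤ (15 * M ^ 2 + M ^ 3) / 36 ^ (n + 1) := by
    have e : cubicGerm c (z / 6 ^ (n + 1)) - z / 6 ^ n
        = c * (z / 6 ^ (n + 1)) ^ 2 + (z / 6 ^ (n + 1)) ^ 3 / 2 := by
      have : 6 * (z / 6 ^ (n + 1)) = z / 6 ^ n := by rw [pow_succ']; field_simp
      rw [cubicGerm, this]; ring
    have h1 : ‖(c : ℂ) * (z / 6 ^ (n + 1)) ^ 2‖ ≤ 15 * q ^ 2 := by
      rw [norm_mul, norm_real, Real.norm_of_nonneg hc, norm_pow]; gcongr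
    have h2 : ‖(z / 6 ^ (n + 1)) ^ 3 / 2‖ ≤ q ^ 3 / 2 := by
      rw [norm_div, norm_pow, norm_ofNat]; gcongr
    have h3 : q ^ 3 / 2 ≤ M * q ^ 2 := by
      have : q ≤ M := div_le_self hM (one_le_pow₀ (by norm_num))
      nlinarith [sq_nonneg q, mul_le_mul_of_nonneg_right this (sq_nonneg q)]
    have h4 : (15 * M ^ 2 + M ^ 3) / 36 ^ (n + 1) = 15 * q ^ 2 + M * q ^ 2 := by
      have : (36 : ℝ) ^ (n + 1) = (6 ^ (n + 1)) ^ 2 := by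
        rw [← pow_mul, mul_comm, pow_mul]; norm_num
      rw [hq, this]; field_simp
    rw [e, h4]
    exact (norm_add_le _ _).trans (by linarith)
  have hexp : (1 + ((1 + q) ^ 6 - 1)) ^ 6 ^ n ≤ Real.exp M := by
    rw [add_sub_cancel, ← pow_mul, ← pow_succ']
    calc (1 + q) ^ 6 ^ (n + 1) ≤ (Real.exp q) ^ 6 ^ (n + 1) := by
          gcongr; linarith [Real.add_one_le_exp q]
      _ = Real.exp M := by
          rw [← Real.exp_nat_mul]; congr 1; push_cast; rw [hq]; field_simp
  calc ‖linApprox c (n + 1) z - linApprox c n z‖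
      ≤ 6 ^ n * (1 + ((1 + q) ^ 6 - 1)) ^ 6 ^ n
          * ‖cubicGerm c (z / 6 ^ (n + 1)) - z / 6 ^ n‖ :=
        norm_iterate_cubicGerm_sub_le hc hc' hu hv n
    _ ≤ 6 ^ n * Real.exp M * ((15 * M ^ 2 + M ^ 3) / 36 ^ (n + 1)) := by gcongr
    _ = Real.exp M * (15 * M ^ 2 + M ^ 3) * (1 / 6) ^ n / 36 := by
        have : (36 : ℝ) ^ (n + 1) = 6 ^ n * 6 ^ n * 36 := by
          rw [pow_succ, ← mul_pow]; norm_num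
        rw [this, one_div, inv_pow]; field_simp
    _ ≤ _ := div_le_self (by positivity) (by norm_num)

lemma differentiable_linApprox (c : ℝ) (n : ℕ) : Differentiable ℂ (linApprox c n) := by
  have h : Differentiable ℂ (cubicGerm c) := by unfold cubicGerm; fun_prop
  exact (h.iterate n).comp (differentiable_id.div_const _)

lemma exists_iterate_cubicGerm_ofReal {c : ℝ} (hc : 0 ≤ c) (n : ℕ) {x : ℝ} (hx : 0 ≤ x) :
    ∃ y : ℝ, 6 ^ n * x ≤ y ∧ (cubicGerm c)^[n] x = y := by
  induction n with
  | zero => exact ⟨x, by simp, rfl⟩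
  | succ n ih =>
    obtain ⟨y, hy, e⟩ := ih
    have hy0 : 0 ≤ y := le_trans (by positivity) hy
    refine ⟨6 * y + c * y ^ 2 + y ^ 3 / 2, ?_, ?_⟩
    · have : 0 ≤ c * y ^ 2 + y ^ 3 / 2 := by positivity
      rw [pow_succ]; linarith
    · rw [Function.iterate_succ_apply', e, cubicGerm]; push_cast; ring

lemma exists_linearizer {c : ℝ} (hc : 0 ≤ c) (hc' : c ≤ 15) :
    ∃ F : ℂ → ℂ, Differentiable ℂ F ∧ F 0 = 0 ∧ (∀ z, F (6 * z) = cubicGerm c (F z)) ∧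
      F 1 ≠ 0 := by
  set d : ℕ → ℂ → ℂ := fun n z => linApprox c (n + 1) z - linApprox c n z with hd
  have hsum : ∀ M : ℝ, Summable fun n : ℕ => Real.exp M * (15 * M ^ 2 + M ^ 3) * (1 / 6) ^ n :=
    fun M => (summable_geometric_of_lt_one (by norm_num) (by norm_num)).mul_left _
  have hlim : ∀ z, Tendsto (fun n => linApprox c n z) atTop (𝓝 (z + ∑' n, d n z)) := by
    intro z
    have hs : Summable fun n => d n z :=
      Summable.of_norm_bounded (hsum ‖z‖) fun n => norm_linApprox_sub_le hc hc' le_rfl n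
    have := (hs.hasSum.tendsto_sum_nat).const_add z
    refine this.congr fun n => ?_
    simp only [hd]
    rw [Finset.sum_range_sub (fun n => linApprox c n z)]
    simp [linApprox]
  refine ⟨fun z => z + ∑' n, d n z, ?_, ?_, ?_, ?_⟩
  · intro z
    have hU : IsOpen (ball (0 : ℂ) (‖z‖ + 1)) := isOpen_ball
    have h1 : DifferentiableOn ℂ (fun z => ∑' n, d n z) (ball (0 : ℂ) (‖z‖ + 1)) :=
      differentiableOn_tsum_of_summable_norm (hsum (‖z‖ + 1))
        (fun n =>
          ((differentiable_linApprox c _).sub (differentiable_linApprox c _)).differentiableOn)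
        hU (fun n w hw => norm_linApprox_sub_le hc hc' (mem_ball_zero_iff.1 hw).le n)
    exact differentiableAt_id.add (h1.differentiableAt (hU.mem_nhds (by simp)))
  · refine tendsto_nhds_unique (hlim 0) ?_
    have h0 : Function.IsFixedPt (cubicGerm c) 0 := by simp [Function.IsFixedPt, cubicGerm]
    have : (fun n => linApprox c n 0) = fun _ => 0 := by
      funext n
      simpa [linApprox] using (h0.iterate n).eq
    rw [this]
    exact tendsto_const_nhds
  · intro z
    have h1 := (hlim (6 * z)).comp (tendsto_add_atTop_nat 1)
    have h2 : Continuous (cubicGerm c) := by unfold cubicGerm; fun_prop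
    refine tendsto_nhds_unique h1 (((h2.tendsto _).comp (hlim z)).congr fun n => ?_)
    exact (linApprox_succ_mul c n z).symm
  · intro h
    have h1 := (continuous_re.tendsto _).comp (hlim 1)
    have h2 : ∀ n, 1 ≤ (linApprox c n 1).re := by
      intro n
      obtain ⟨y, hy, e⟩ := exists_iterate_cubicGerm_ofReal hc n (x := 1 / 6 ^ n) (by positivity)
      have e' : linApprox c n 1 = y := by rw [← e, linApprox]; push_cast; rfl
      rw [e', ofReal_re]
      refine le_trans (le_of_eq ?_) hy
      field_simp
    have h3 : 1 ≤ (1 + ∑' n, d n 1 : ℂ).re := ge_of_tendsto' h1 h2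
    have h : (1 + ∑' n, d n 1 : ℂ) = 0 := h
    rw [h] at h3
    norm_num at h3

/-! ### The Poincaré function of the cubic `(w³ - 3 w) / 2` at `√5` -/

/-- The cubic `w ↦ (w³ - 3 w) / 2`, whose critical points `1` and `-1` form a `2`-cycle. -/
noncomputable def cubic (w : ℂ) : ℂ := (w ^ 3 - 3 * w) / 2

/-- `f` is a Poincaré function of `cubic` at the repelling fixed point `√5` (multiplier `6`). -/
structure IsPoincare (f : ℂ → ℂ) : Prop where
  differentiable : Differentiable ℂ f
  map_zero : f 0 = √5
  map_mul : ∀ z, f (6 * z) = cubic (f z)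
  exists_ne : ∃ z, f z ≠ √5

lemma ofReal_sqrt_five_sq : ((√5 : ℝ) : ℂ) ^ 2 = 5 := by
  rw [← ofReal_pow, Real.sq_sqrt (by norm_num)]; norm_num

lemma exists_isPoincare : ∃ f, IsPoincare f := by
  have hs : √5 ≤ 3 := Real.sqrt_le_iff.2 (by norm_num)
  obtain ⟨F, hF, h0, hm, h1⟩ := exists_linearizer (c := 3 * √5 / 2) (by positivity) (by linarith)
  refine ⟨fun z => √5 + F z, hF.const_add _, by simp [h0], fun z => ?_, 1, by simpa using h1⟩
  simp only [hm, cubicGerm, cubic]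
  push_cast
  linear_combination (-(√5 : ℂ) / 2 - 3 / 2 * F z) * ofReal_sqrt_five_sq

lemma cubic_re (w : ℂ) : (cubic w).re = w.re * (w.re ^ 2 - 3 * w.im ^ 2 - 3) / 2 := by
  have : cubic w = ((w.re * (w.re ^ 2 - 3 * w.im ^ 2 - 3) / 2 : ℝ) : ℂ)
      + ((w.im * (3 * w.re ^ 2 - w.im ^ 2 - 3) / 2 : ℝ) : ℂ) * I := by
    conv_lhs => rw [← re_add_im w]
    rw [cubic]
    push_cast
    linear_combination (3 * (w.re : ℂ) * w.im ^ 2 + w.im ^ 3 * I) / 2 * I_sq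
  rw [this, add_re, ofReal_re, re_ofReal_mul, I_re, mul_zero, add_zero]

lemma norm_le_of_norm_cubic_le {B : ℝ} (hB : 3 ≤ B) {w : ℂ} (h : ‖cubic w‖ ≤ B) : ‖w‖ ≤ B := by
  by_contra! hw
  have e : cubic w = w * (w ^ 2 - 3) / 2 := by rw [cubic]; ring
  have h1 : ‖w‖ ^ 2 - 3 ≤ ‖w ^ 2 - 3‖ := by
    have := norm_sub_norm_le (w ^ 2) 3
    rwa [norm_pow, norm_ofNat] at this
  rw [e, norm_div, norm_mul, norm_ofNat] at h
  nlinarith [mul_le_mul_of_nonneg_left h1 (norm_nonneg w)]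

/-- On the part of the right half-plane that `cubic` maps into the right half-plane, `cubic`
expands distances to its fixed point `√5`. -/
lemma norm_sub_le_norm_cubic_sub {w : ℂ} (hw : 0 < w.re) (h : 0 < (cubic w).re) :
    4 * ‖w - √5‖ ≤ ‖cubic w - √5‖ := by
  have hs := Real.sqrt_nonneg 5
  have e : cubic w - √5 = (w ^ 2 + √5 * w + 2) / 2 * (w - √5) := by
    rw [cubic]
    linear_combination (w / 2) * ofReal_sqrt_five_sq
  have h3 : 3 + 3 * w.im ^ 2 < w.re ^ 2 := by
    rw [cubic_re] at h
    by_contra! hle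
    nlinarith
  have h4 : 3 ≤ √5 * w.re := by
    refine (abs_le_of_sq_le_sq' ?_ (by positivity)).2
    rw [mul_pow, Real.sq_sqrt (by norm_num)]
    nlinarith [sq_nonneg w.im]
  have h5 : 4 ≤ ‖(w ^ 2 + √5 * w + 2) / 2‖ := by
    refine le_trans ?_ (re_le_norm _)
    have : ((w ^ 2 + √5 * w + 2) / 2).re = (w.re ^ 2 - w.im ^ 2 + √5 * w.re + 2) / 2 := by
      have e2 : (w ^ 2 + √5 * w + 2) / 2 = ((1 / 2 : ℝ) : ℂ) * (w * w + √5 * w + 2) := by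
        push_cast; ring
      rw [e2, re_ofReal_mul]
      simp
      ring
    rw [this]
    nlinarith [sq_nonneg w.im]
  rw [e, norm_mul]
  gcongr

lemma pos_of_continuousOn_ne_zero {g : ℝ → ℝ} {s : ℝ} (hg : ContinuousOn g (Ico s 1))
    (h0 : ∀ t ∈ Ico s 1, g t ≠ 0) (hs : 0 < g s) {t : ℝ} (ht : t ∈ Ico s 1) : 0 < g t := by
  by_contra! hle
  have hss : s ∈ Ico s 1 := ⟨le_rfl, ht.1.trans_lt ht.2⟩
  obtain ⟨u, hu, hu0⟩ := isPreconnected_Ico.intermediate_value ht hss hg ⟨hle, hs.le⟩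
  exact h0 u hu hu0

lemma lt_of_continuousOn_ne {g : ℝ → ℝ} {c s t₀ : ℝ} (hg : ContinuousOn g (Ico s 1))
    (h0 : ∀ t ∈ Ico s 1, g t ≠ c) (ht₀ : t₀ ∈ Ico s 1) (h : g t₀ < c) {t : ℝ}
    (ht : t ∈ Ico s 1) : g t < c := by
  by_contra! hle
  obtain ⟨u, hu, hu0⟩ := isPreconnected_Ico.intermediate_value ht₀ ht hg ⟨h.le, hle⟩
  exact h0 u hu hu0

namespace IsPoincare

variable {f : ℂ → ℂ} (hf : IsPoincare f)
include hf

lemma map_div (z : ℂ) (n : ℕ) : cubic (f (z / 6 ^ (n + 1))) = f (z / 6 ^ n) := by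
  rw [← hf.map_mul]
  congr 1
  rw [pow_succ']
  field_simp

lemma tendsto_map_div (z : ℂ) : Tendsto (fun n : ℕ => f (z / 6 ^ n)) atTop (𝓝 √5) := by
  have h : Tendsto (fun n : ℕ => z / 6 ^ n) atTop (𝓝 0) := by
    have := (tendsto_pow_atTop_nhds_zero_of_norm_lt_one (x := (1 / 6 : ℂ))
      (by norm_num)).const_mul z
    simpa [div_eq_mul_inv] using this
  rw [← hf.map_zero]
  exact (hf.differentiable.continuous.tendsto 0).comp h

lemma exists_sphere_le : ∃ δ > 0, ∃ ε > 0, ∀ z, ‖z‖ = δ → ε ≤ ‖f z - √5‖ := by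
  have han : AnalyticOnNhd ℂ (fun z => f z - √5) univ :=
    (hf.differentiable.sub_const _).differentiableOn.analyticOnNhd isOpen_univ
  have hne : ∀ᶠ z in 𝓝[≠] (0 : ℂ), f z - √5 ≠ 0 := by
    refine (han 0 trivial).eventually_eq_zero_or_eventually_ne_zero.resolve_left fun h => ?_
    obtain ⟨z, hz⟩ := hf.exists_ne
    exact hz (sub_eq_zero.1
      (han.eqOn_zero_of_preconnected_of_eventuallyEq_zero isPreconnected_univ trivial h
        (trivial : z ∈ univ)))
  obtain ⟨r, hr, hball⟩ := Metric.mem_nhdsWithin_iff.1 hne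
  have hδ : 0 < r / 2 := by positivity
  refine ⟨r / 2, hδ, ?_⟩
  have hc : ContinuousOn (fun z => ‖f z - √5‖) (sphere 0 (r / 2)) :=
    (hf.differentiable.continuous.sub continuous_const).norm.continuousOn
  obtain ⟨z₀, hz₀, hmin⟩ := (isCompact_sphere (0 : ℂ) (r / 2)).exists_isMinOn
    (NormedSpace.sphere_nonempty.2 hδ.le) hc
  have hz₀' : ‖z₀‖ = r / 2 := by simpa using hz₀
  refine ⟨‖f z₀ - √5‖, norm_pos_iff.2 (hball ⟨?_, ?_⟩), fun z hz => hmin (by simpa using hz)⟩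
  · rw [mem_ball_zero_iff, hz₀']; linarith
  · intro h
    rw [mem_singleton_iff.1 h, norm_zero] at hz₀'
    linarith

/-- A path to infinity along which a Poincaré function is bounded meets the preimage of the
imaginary axis at arbitrarily late times. -/
lemma exists_re_eq_zero {γ : ℝ → ℂ} {s B : ℝ} (hs1 : s < 1) (hγ : ContinuousOn γ (Ico s 1))
    (hlim : Tendsto (fun t => ‖γ t‖) (𝓝[Ico 0 1] 1) atTop)
    (hB : ∀ t ∈ Ico s 1, ‖f (γ t)‖ ≤ B) : ∃ t ∈ Ico s 1, (f (γ t)).re = 0 := by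
  by_contra! hre
  set w : ℕ → ℝ → ℂ := fun n t => f (γ t / 6 ^ n) with hw
  have hwc : ∀ n, ContinuousOn (w n) (Ico s 1) := fun n =>
    hf.differentiable.continuous.comp_continuousOn (hγ.div_const _)
  have hstep : ∀ n t, cubic (w (n + 1) t) = w n t := fun n t => hf.map_div _ n
  have hss : s ∈ Ico s 1 := ⟨le_rfl, hs1⟩
  have hre' : ∀ n, ∀ t ∈ Ico s 1, (w n t).re ≠ 0 := by
    intro n
    induction n with
    | zero => simpa [hw] using hre
    | succ n ih =>
      intro t ht h0
      refine ih t ht ?_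
      rw [← hstep n t, cubic_re, h0]; simp
  have hbd : ∀ n, ∀ t ∈ Ico s 1, ‖w n t‖ ≤ max B 3 := by
    intro n
    induction n with
    | zero => intro t ht; simpa [hw] using Or.inl (hB t ht)
    | succ n ih =>
      intro t ht
      exact norm_le_of_norm_cubic_le (le_max_right _ _) (by rw [hstep]; exact ih t ht)
  have hpos_s : ∀ᶠ n in atTop, 0 < (w n s).re := by
    have h := (continuous_re.tendsto _).comp (hf.tendsto_map_div (γ s))
    exact h.eventually (lt_mem_nhds (by simp))
  obtain ⟨N, hN⟩ := eventually_atTop.1 hpos_s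
  have hpos : ∀ n ≥ N, ∀ t ∈ Ico s 1, 0 < (w n t).re := fun n hn t ht =>
    pos_of_continuousOn_ne_zero (continuous_re.comp_continuousOn (hwc n)) (hre' n) (hN n hn) ht
  have hcontr : ∀ k, ∀ t ∈ Ico s 1, ‖w (N + k) t - √5‖ ≤ (max B 3 + √5) * (1 / 4) ^ k := by
    intro k
    induction k with
    | zero =>
      intro t ht
      have h1 := norm_sub_le (w N t) (√5 : ℂ)
      rw [norm_real, Real.norm_of_nonneg (Real.sqrt_nonneg _)] at h1
      simpa using h1.trans (add_le_add_left (hbd N t ht) _)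
    | succ k ih =>
      intro t ht
      have h1 := norm_sub_le_norm_cubic_sub (hpos (N + k + 1) (by omega) t ht)
        (by rw [hstep]; exact hpos (N + k) (by omega) t ht)
      rw [hstep] at h1
      have h2 := ih t ht
      rw [pow_succ, ← add_assoc]
      linarith
  obtain ⟨δ, hδ, ε, hε, hsph⟩ := hf.exists_sphere_le
  have hev1 : ∀ᶠ k : ℕ in atTop, (max B 3 + √5) * (1 / 4) ^ k < ε := by
    have := (tendsto_pow_atTop_nhds_zero_of_lt_one (r := (1 / 4 : ℝ)) (by norm_num)
      (by norm_num)).const_mul (max B 3 + √5)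
    rw [mul_zero] at this
    exact this.eventually (gt_mem_nhds hε)
  have hev2 : ∀ᶠ k : ℕ in atTop, ‖γ s‖ * (1 / 6) ^ k < δ := by
    have := (tendsto_pow_atTop_nhds_zero_of_lt_one (r := (1 / 6 : ℝ)) (by norm_num)
      (by norm_num)).const_mul ‖γ s‖
    rw [mul_zero] at this
    exact this.eventually (gt_mem_nhds hδ)
  obtain ⟨k, hk1, hk2⟩ := (hev1.and hev2).exists
  have hnorm : ∀ t, ‖γ t / 6 ^ (N + k)‖ = ‖γ t‖ / 6 ^ (N + k) := fun t => by
    rw [norm_div, norm_pow, norm_ofNat]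
  have hlt : ∀ t ∈ Ico s 1, ‖γ t / 6 ^ (N + k)‖ < δ := by
    refine fun t ht => lt_of_continuousOn_ne (hγ.div_const _).norm (fun u hu h => ?_) hss ?_ ht
    · exact absurd ((hsph _ h).trans (hcontr k u hu)) (not_le.2 hk1)
    · rw [hnorm]
      refine lt_of_le_of_lt ?_ hk2
      rw [one_div, inv_pow, ← div_eq_mul_inv]
      gcongr
      · norm_num
      · omega
  have hev : ∀ᶠ t in 𝓝[<] (1 : ℝ), δ * 6 ^ (N + k) ≤ ‖γ t‖ := by
    rw [← nhdsWithin_Ico_eq_nhdsLT (zero_lt_one' ℝ)]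
    exact hlim.eventually_ge_atTop _
  obtain ⟨t, ht1, ht2⟩ := (hev.and (Ico_mem_nhdsLT hs1)).exists
  have := hlt t ht2
  rw [hnorm, div_lt_iff₀ (by positivity)] at this
  linarith

lemma asymptoticValues_eq_empty : asymptoticValues f = ∅ := by
  refine eq_empty_of_forall_notMem ?_
  rintro a ⟨γ, hγ, hlim, ha⟩
  have hcont := hf.differentiable.continuous
  have hIco : 𝓝[Ico 0 1] (1 : ℝ) = 𝓝[<] 1 := nhdsWithin_Ico_eq_nhdsLT zero_lt_one
  have hlate : ∀ p : ℝ → Prop, (∀ᶠ t in 𝓝[Ico 0 1] (1 : ℝ), p t) →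
      ∃ s ∈ Ico (0 : ℝ) 1, ∀ t ∈ Ico s 1, p t := by
    intro p hp
    rw [hIco] at hp
    obtain ⟨l, hl, h⟩ := (mem_nhdsLT_iff_exists_Ico_subset).1 hp
    exact ⟨max l 0, ⟨le_max_right _ _, max_lt hl zero_lt_one⟩,
      fun t ht => h ⟨(le_max_left _ _).trans ht.1, ht.2⟩⟩
  have hre : a.re = 0 := by
    by_contra hne
    have h1 : ∀ᶠ t in 𝓝[Ico 0 1] (1 : ℝ), (f (γ t)).re ≠ 0 ∧ ‖f (γ t)‖ < ‖a‖ + 1 :=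
      (((continuous_re.tendsto _).comp ha).eventually_ne hne).and
        (ha.norm.eventually (gt_mem_nhds (lt_add_one _)))
    obtain ⟨s, hs, h⟩ := hlate _ h1
    obtain ⟨t, ht, h0⟩ := hf.exists_re_eq_zero hs.2 (hγ.mono (Ico_subset_Ico_left hs.1)) hlim
      (fun t ht => (h t ht).2.le)
    exact (h t ht).1 h0
  have h1 : ∀ᶠ t in 𝓝[Ico 0 1] (1 : ℝ), |(f (γ t)).re| < 1 ∧ ‖f (γ t)‖ < ‖a‖ + 1 := by
    refine Eventually.and ?_ (ha.norm.eventually (gt_mem_nhds (lt_add_one _)))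
    have := ((continuous_re.tendsto _).comp ha).abs
    rw [hre, abs_zero] at this
    exact this.eventually (gt_mem_nhds one_pos)
  obtain ⟨s, hs, h⟩ := hlate _ h1
  have hγs := hγ.mono (Ico_subset_Ico_left hs.1)
  have hbd : ∀ n, ∀ t ∈ Ico s 1, ‖f (γ t / 6 ^ n)‖ ≤ max (‖a‖ + 1) 3 := by
    intro n
    induction n with
    | zero => intro t ht; simpa using Or.inl (h t ht).2.le
    | succ n ih =>
      intro t ht
      exact norm_le_of_norm_cubic_le (le_max_right _ _) (by rw [hf.map_div]; exact ih t ht)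
  have hstrip : ∀ n, ∀ t ∈ Ico s 1, |(f (γ t / 6 ^ n)).re| < 1 := by
    intro n
    induction n with
    | zero => intro t ht; simpa using (h t ht).1
    | succ n ih =>
      have hlim' : Tendsto (fun t => ‖γ t / 6 ^ (n + 1)‖) (𝓝[Ico 0 1] 1) atTop := by
        have : (fun t => ‖γ t / 6 ^ (n + 1)‖) = fun t => ‖γ t‖ / 6 ^ (n + 1) := by
          funext t; rw [norm_div, norm_pow, norm_ofNat]
        rw [this]
        exact hlim.atTop_div_const (by positivity)
      obtain ⟨t₁, ht₁, h0⟩ := hf.exists_re_eq_zero hs.2 (hγs.div_const (6 ^ (n + 1))) hlim'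
        (hbd (n + 1))
      intro t ht
      refine lt_of_continuousOn_ne (continuous_re.comp_continuousOn
        (hcont.comp_continuousOn (hγs.div_const (6 ^ (n + 1))))).abs (fun u hu h1 => ?_) ht₁
        (by simp [h0]) ht
      have h2 := ih u hu
      simp only [Function.comp_apply] at h1
      rw [← hf.map_div, cubic_re, abs_lt] at h2
      have hsq : (f (γ u / 6 ^ (n + 1))).re ^ 2 = 1 := by rw [← sq_abs, h1, one_pow]
      rcases (abs_eq zero_le_one).1 h1 with h3 | h3 <;> rw [h3] at h2 <;>
        nlinarith [sq_nonneg (f (γ u / 6 ^ (n + 1))).im]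
  have h5 := (continuous_re.tendsto _).comp (hf.tendsto_map_div (γ s))
  have h6 : √5 ≤ 1 := le_of_tendsto h5 (Eventually.of_forall fun n =>
    ((abs_lt.1 (hstrip n s ⟨le_rfl, hs.2⟩)).2).le)
  have h7 := Real.sq_sqrt (show (0 : ℝ) ≤ 5 by norm_num)
  nlinarith [Real.sqrt_nonneg 5]

end IsPoincare

/-! ### Entire functions without asymptotic values -/

/-- The set of noncritical points of `f`. -/
def noncritical (f : ℂ → ℂ) : Set ℂ := {z | deriv f z ≠ 0}

section noncritical

variable {f : ℂ → ℂ} (hf : Differentiable ℂ f)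
include hf

lemma isOpen_noncritical : IsOpen (noncritical f) :=
  isOpen_ne_fun hf.deriv.continuous continuous_const

lemma isLocalHomeomorph_noncritical :
    IsLocalHomeomorph (fun z : noncritical f => f z) := by
  have h1 : IsLocalHomeomorphOn f (noncritical f) := by
    refine IsLocalHomeomorphOn.mk _ _ fun z hz => ?_
    have hs : HasStrictDerivAt f (deriv f z) z :=
      (hf.contDiff (n := 1)).contDiffAt.hasStrictDerivAt (by norm_num)
    have hF := hs.hasStrictFDerivAt_equiv hz
    exact ⟨hF.toOpenPartialHomeomorph f, hF.mem_toOpenPartialHomeomorph_source, fun _ _ => rfl⟩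
  have h2 := (isOpen_noncritical hf).isOpenEmbedding_subtypeVal.isLocalHomeomorph
  rw [isLocalHomeomorph_iff_isLocalHomeomorphOn_univ] at h2 ⊢
  exact h1.comp h2 fun z _ => z.2

/-- `g` lifts the path `σ` on `s` through the restriction of `f` to its noncritical points,
starting at `z₀`. -/
def IsLiftOn (f : ℂ → ℂ) (σ : ℝ → ℂ) (z₀ : noncritical f) (s : Set ℝ)
    (g : ℝ → noncritical f) : Prop :=
  ContinuousOn g s ∧ g 0 = z₀ ∧ ∀ t ∈ s, f (g t) = σ t

omit hf in
lemma IsLiftOn.mono {σ : ℝ → ℂ} {z₀ : noncritical f} {s s' : Set ℝ} {g : ℝ → noncritical f}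
    (h : IsLiftOn f σ z₀ s g) (hs : s' ⊆ s) : IsLiftOn f σ z₀ s' g :=
  ⟨h.1.mono hs, h.2.1, fun t ht => h.2.2 t (hs ht)⟩

lemma IsLiftOn.eqOn {σ : ℝ → ℂ} {z₀ : noncritical f} {a : ℝ} (ha : 0 ≤ a)
    {g₁ g₂ : ℝ → noncritical f}
    (h₁ : IsLiftOn f σ z₀ (Icc 0 a) g₁) (h₂ : IsLiftOn f σ z₀ (Icc 0 a) g₂) :
    EqOn g₁ g₂ (Icc 0 a) :=
  (T2Space.isSeparatedMap (fun z : noncritical f => f z)).eqOn_of_comp_eqOn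
    (isLocalHomeomorph_noncritical hf).isLocallyInjective isPreconnected_Icc h₁.1 h₂.1
    (fun t ht => (h₁.2.2 t ht).trans (h₂.2.2 t ht).symm) (left_mem_Icc.2 ha)
    (h₁.2.1.trans h₂.2.1.symm)

/-- Lifts on all compact initial segments of `[0, T)` glue to a lift on `[0, T)`. -/
lemma exists_isLiftOn_Ico {σ : ℝ → ℂ} {z₀ : noncritical f} {T : ℝ}
    (h : ∀ t < T, ∃ t' ≥ t, ∃ g, IsLiftOn f σ z₀ (Icc 0 t') g) :
    ∃ g, IsLiftOn f σ z₀ (Ico 0 T) g := by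
  have : Nonempty (noncritical f) := ⟨z₀⟩
  choose! u hu G hG using h
  have hagree : ∀ s t, 0 ≤ s → s ≤ t → t < T → G s s = G t s := by
    intro s t h0 hst htT
    have hm : ∀ r, s ≤ r → r < T → IsLiftOn f σ z₀ (Icc 0 s) (G r) := fun r hr hrT =>
      (hG r hrT).mono (Icc_subset_Icc_right (hr.trans (hu r hrT)))
    exact IsLiftOn.eqOn hf h0 (hm s le_rfl (hst.trans_lt htT)) (hm t hst htT) ⟨h0, le_rfl⟩
  by_cases hT : T ≤ 0
  · refine ⟨fun _ => z₀, ?_, rfl, ?_⟩ <;> simp [Ico_eq_empty (not_lt.2 hT)]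
  push Not at hT
  refine ⟨fun t => G t t, ?_, (hG 0 hT).2.1, fun t ht => (hG t ht.2).2.2 t ⟨ht.1, hu t ht.2⟩⟩
  intro t ht
  obtain ⟨r, htr, hrT⟩ := exists_between ht.2
  have hc : ContinuousWithinAt (G r) (Icc 0 r) t :=
    (hG r hrT).1.mono (Icc_subset_Icc_right (hu r hrT)) t ⟨ht.1, htr.le⟩
  have hc' : ContinuousWithinAt (fun t => G t t) (Icc 0 r) t :=
    hc.congr (fun s hs => hagree s r hs.1 hs.2 hrT) (hagree t r ht.1 htr.le hrT)
  refine hc'.mono_of_mem_nhdsWithin ?_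
  filter_upwards [self_mem_nhdsWithin, mem_nhdsWithin_of_mem_nhds (Iio_mem_nhds htr)] with s hs hs'
  exact ⟨hs.1, (mem_Iio.1 hs').le⟩

/-- A lift can be continued through any point at which it is frequently close to a point of the
fibre. -/
lemma IsLiftOn.exists_extend {σ : ℝ → ℂ} (hσ : Continuous σ) {z₀ z₁ : noncritical f} {T : ℝ}
    (hz₁ : f z₁ = σ T) {g : ℝ → noncritical f}
    (hlift : ∀ V ∈ 𝓝 z₁, ∀ η > 0, ∃ t, 0 ≤ t ∧ T - η < t ∧ t ≤ T ∧ g t ∈ V ∧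
      IsLiftOn f σ z₀ (Icc 0 t) g) :
    ∃ T' > T, ∃ g', IsLiftOn f σ z₀ (Icc 0 T') g' := by
  obtain ⟨e, hz₁e, he⟩ := isLocalHomeomorph_noncritical hf z₁
  have he' : ∀ z, e z = f z := fun z => (congrFun he z).symm
  have htar : σ ⁻¹' e.target ∈ 𝓝 T := hσ.continuousAt.preimage_mem_nhds
    (e.open_target.mem_nhds (by rw [← hz₁, ← he']; exact e.map_source hz₁e))
  obtain ⟨η, hη, hball⟩ := Metric.mem_nhds_iff.1 htar
  obtain ⟨t, ht0, htη, htT, hts, hg⟩ := hlift e.source (e.open_source.mem_nhds hz₁e) η hη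
  have hsub : ∀ s ∈ Icc t (T + η / 2), σ s ∈ e.target := fun s hs => hball (by
    rw [mem_ball, Real.dist_eq, abs_lt]; constructor <;> linarith [hs.1, hs.2])
  have hpt : e.symm (σ t) = g t := by
    rw [← hg.2.2 t ⟨ht0, le_rfl⟩, ← he', e.left_inv hts]
  have h1 : EqOn (fun s => if s ≤ t then g s else e.symm (σ s)) g (Icc 0 t) :=
    fun s hs => if_pos hs.2
  have h2 : EqOn (fun s => if s ≤ t then g s else e.symm (σ s)) (fun s => e.symm (σ s))
      (Icc t (T + η / 2)) := by
    intro s hs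
    by_cases h : s ≤ t
    · obtain rfl := le_antisymm h hs.1
      simpa using hpt.symm
    · exact if_neg h
  have hle : t ≤ T + η / 2 := by linarith
  refine ⟨T + η / 2, by linarith, fun s => if s ≤ t then g s else e.symm (σ s), ?_, ?_, ?_⟩
  · rw [← Icc_union_Icc_eq_Icc ht0 hle]
    exact (hg.1.congr h1).union_of_isClosed
      ((e.continuousOn_symm.comp hσ.continuousOn hsub).congr h2) isClosed_Icc isClosed_Icc
  · exact (if_pos ht0).trans hg.2.1
  · intro s hs
    rw [← Icc_union_Icc_eq_Icc ht0 hle] at hs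
    rcases hs with hs | hs
    · rw [h1 hs]; exact hg.2.2 s hs
    · rw [h2 hs, ← he', e.right_inv (hsub s hs)]

/-- A lift on `[0, T)` accumulates at a finite point if `f` has no asymptotic values. -/
lemma exists_mapClusterPt_of_isLiftOn (hasy : asymptoticValues f = ∅) {σ : ℝ → ℂ}
    (hσ : Continuous σ) {z₀ : noncritical f} {T : ℝ} (hT : 0 < T) {g : ℝ → noncritical f}
    (hg : IsLiftOn f σ z₀ (Ico 0 T) g) :
    ∃ z, f z = σ T ∧ MapClusterPt z (𝓝[<] T) (fun t => (g t : ℂ)) := by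
  have hscale : Tendsto (fun τ : ℝ => T * τ) (𝓝[Ico 0 1] 1) (𝓝[<] T) := by
    refine tendsto_nhdsWithin_iff.2 ⟨?_, ?_⟩
    · have : Tendsto (fun τ : ℝ => T * τ) (𝓝 1) (𝓝 (T * 1)) := (continuous_const_mul T).tendsto 1
      rw [mul_one] at this
      exact this.mono_left nhdsWithin_le_nhds
    · filter_upwards [self_mem_nhdsWithin] with τ hτ
      exact mul_lt_of_lt_one_right hT hτ.2
  have hlim : Tendsto (fun t => f (g t)) (𝓝[<] T) (𝓝 (σ T)) := by
    refine ((hσ.tendsto T).mono_left nhdsWithin_le_nhds).congr' ?_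
    filter_upwards [Ico_mem_nhdsLT hT] with t ht using (hg.2.2 t ht).symm
  have hnot : ¬ Tendsto (fun τ : ℝ => ‖(g (T * τ) : ℂ)‖) (𝓝[Ico 0 1] 1) atTop := by
    intro h
    have : σ T ∈ asymptoticValues f := by
      refine ⟨fun τ => g (T * τ), ?_, h, hlim.comp hscale⟩
      refine (continuous_subtype_val.comp_continuousOn hg.1).comp
        (continuous_const_mul T).continuousOn fun τ hτ => ⟨?_, ?_⟩
      · exact mul_nonneg hT.le hτ.1
      · exact mul_lt_of_lt_one_right hT hτ.2
    rw [hasy] at this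
    exact this
  rw [Filter.tendsto_atTop] at hnot
  push Not at hnot
  obtain ⟨M, hM⟩ := hnot
  have hfreq : ∃ᶠ t in 𝓝[<] T, (g t : ℂ) ∈ closedBall (0 : ℂ) M := by
    refine hscale.frequently (hM.mono fun τ hτ => ?_)
    simpa using hτ.le
  obtain ⟨z, -, hz⟩ := (isCompact_closedBall (0 : ℂ) M).exists_mapClusterPt_of_frequently hfreq
  refine ⟨z, ?_, hz⟩
  have h1 : MapClusterPt (f z) (𝓝[<] T) (fun t => f (g t)) :=
    hz.continuousAt_comp hf.continuous.continuousAt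
  exact eq_of_nhds_neBot (ClusterPt.mono h1 hlim)

/-- Path lifting for entire functions without asymptotic values. -/
lemma exists_isLiftOn (hasy : asymptoticValues f = ∅) {σ : ℝ → ℂ} (hσ : Continuous σ)
    (hcrit : ∀ t ∈ Icc (0 : ℝ) 1, ∀ z, f z = σ t → z ∈ noncritical f)
    {z₀ : noncritical f} (hz₀ : f z₀ = σ 0) : ∃ g, IsLiftOn f σ z₀ (Icc 0 1) g := by
  set S : Set ℝ := {t | t ∈ Icc 0 1 ∧ ∃ g, IsLiftOn f σ z₀ (Icc 0 t) g} with hS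
  have h0 : (0 : ℝ) ∈ S := by
    refine ⟨by simp, fun _ => z₀, continuousOn_const, rfl, fun t ht => ?_⟩
    obtain rfl : t = 0 := le_antisymm ht.2 ht.1
    exact hz₀
  have hbdd : BddAbove S := ⟨1, fun t ht => ht.1.2⟩
  set T := sSup S with hT
  have hT0 : 0 ≤ T := le_csSup hbdd h0
  have hT1 : T ≤ 1 := csSup_le ⟨0, h0⟩ fun t ht => ht.1.2
  obtain ⟨T', hT', g', hg'⟩ : ∃ T' > T, ∃ g', IsLiftOn f σ z₀ (Icc 0 T') g' := by
    rcases hT0.eq_or_lt with hT0 | hT0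
    · refine IsLiftOn.exists_extend hf hσ (z₁ := z₀) (g := fun _ => z₀) (by rw [← hT0, hz₀]) ?_
      intro V hV η hη
      refine ⟨0, le_rfl, by linarith, hT0.le, mem_of_mem_nhds hV, continuousOn_const, rfl, ?_⟩
      intro t ht
      obtain rfl : t = 0 := le_antisymm ht.2 ht.1
      exact hz₀
    · obtain ⟨g, hg⟩ : ∃ g, IsLiftOn f σ z₀ (Ico 0 T) g := by
        refine exists_isLiftOn_Ico hf fun t ht => ?_
        obtain ⟨t', ht', htt'⟩ := exists_lt_of_lt_csSup ⟨0, h0⟩ ht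
        exact ⟨t', htt'.le, ht'.2⟩
      obtain ⟨z, hz, hclus⟩ := exists_mapClusterPt_of_isLiftOn hf hasy hσ hT0 hg
      refine IsLiftOn.exists_extend hf hσ (z₁ := ⟨z, hcrit T ⟨hT0.le, hT1⟩ z hz⟩) (g := g) hz ?_
      intro V hV η hη
      have hV' : Subtype.val '' V ∈ 𝓝 z :=
        (isOpen_noncritical hf).isOpenEmbedding_subtypeVal.image_mem_nhds.2 hV
      have hnear : Ico (max 0 (T - η / 2)) T ∈ 𝓝[<] T :=
        Ico_mem_nhdsLT (max_lt hT0 (by linarith))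
      obtain ⟨t, ⟨v, hv, hvt⟩, ht⟩ := ((hclus.frequently hV').and_eventually hnear).exists
      have ht0 : 0 ≤ t := (le_max_left _ _).trans ht.1
      have ht1 : T - η / 2 ≤ t := (le_max_right _ _).trans ht.1
      refine ⟨t, ht0, by linarith, ht.2.le, ?_, hg.mono fun s hs => ⟨hs.1, hs.2.trans_lt ht.2⟩⟩
      rwa [← Subtype.ext hvt]
  have hmem : min T' 1 ∈ S :=
    ⟨⟨le_min (hT0.trans hT'.le) zero_le_one, min_le_right _ _⟩, g',
      hg'.mono (Icc_subset_Icc_right (min_le_left _ _))⟩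
  have h1 : 1 ≤ T' := by
    by_contra! h
    have := le_csSup hbdd hmem
    rw [min_eq_left h.le] at this
    linarith
  exact ⟨g', hg'.mono (Icc_subset_Icc_right h1)⟩

/-- If `f` has no asymptotic values, then the center of a disk without critical values is a
regular value. -/
lemma isRegularValue_of_ball (hasy : asymptoticValues f = ∅) {w : ℂ} {ε : ℝ} (hε : 0 < ε)
    (hcrit : f ⁻¹' ball w ε ⊆ noncritical f) : IsRegularValue f w := by
  refine ⟨ball w ε, isOpen_ball, mem_ball_self hε, fun z₀ hz₀ => ?_⟩
  set U := ball w ε with hU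
  set e₀ : noncritical f := ⟨z₀, hcrit hz₀⟩ with he₀
  have hloc := isLocalHomeomorph_noncritical hf
  have hsep := T2Space.isSeparatedMap (fun z : noncritical f => f z)
  set σ : ℂ → ℝ → ℂ := fun u t => AffineMap.lineMap (f z₀) u t with hσ
  have hσU : ∀ u ∈ U, ∀ t ∈ Icc (0 : ℝ) 1, σ u t ∈ U := fun u hu t ht =>
    (convex_ball w ε).lineMap_mem hz₀ hu ht
  have hlift : ∀ u : U, ∃ g, IsLiftOn f (σ u) e₀ (Icc 0 1) g := fun u =>
    exists_isLiftOn hf hasy AffineMap.lineMap_continuous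
      (fun t ht z hz => hcrit (by rw [mem_preimage, hz]; exact hσU u u.2 t ht))
      (by simp [he₀])
  choose g hg using hlift
  let F : C(unitInterval × U, ℂ) := ⟨fun x => σ x.2 x.1, by
    simp only [hσ, AffineMap.lineMap_apply_module']; fun_prop⟩
  let G : unitInterval × U → noncritical f := fun x => g x.2 x.1
  have hG : Continuous G := by
    refine hloc.continuous_lift hsep F ?_ ?_ fun u => ?_
    · funext x
      exact (hg x.2).2.2 x.1 x.1.2
    · refine continuous_const.congr (f := fun _ => e₀) fun u => ?_
      exact ((hg u).2.1).symm
    · exact continuousOn_iff_continuous_domRestrict.1 (hg u).1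
  let s : U → noncritical f := fun u => g u 1
  have hs : Continuous s := hG.comp (Continuous.prodMk_right (1 : unitInterval))
  have hfs : ∀ u, f (s u) = u := fun u => by
    simpa [hσ] using (hg u).2.2 1 (by simp)
  have hs₀ : s ⟨f z₀, hz₀⟩ = e₀ := by
    have hlift := hg ⟨f z₀, hz₀⟩
    have hconst : IsLiftOn f (σ (f z₀)) e₀ (Icc 0 1) fun _ => e₀ :=
      ⟨continuousOn_const, rfl, fun t _ => by simp [hσ, he₀]⟩
    exact IsLiftOn.eqOn hf zero_le_one hlift hconst (by simp)
  set C := connectedComponentIn (f ⁻¹' U) z₀ with hC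
  have hCU : C ⊆ f ⁻¹' U := connectedComponentIn_subset _ _
  have hCz : z₀ ∈ C := mem_connectedComponentIn hz₀
  have hleft : ∀ x : C, s ⟨f x, hCU x.2⟩ = ⟨x, hcrit (hCU x.2)⟩ := by
    have : PreconnectedSpace C :=
      isPreconnected_iff_preconnectedSpace.1 isPreconnected_connectedComponentIn
    have hcont : Continuous fun x : C => f x := hf.continuous.comp continuous_subtype_val
    refine fun x => congrFun (hsep.eq_of_comp_eq hloc.isLocallyInjective
      (g₁ := fun x : C => s ⟨f x, hCU x.2⟩) (g₂ := fun x : C => ⟨x, hcrit (hCU x.2)⟩)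
      (hs.comp (hcont.subtype_mk _)) (continuous_subtype_val.subtype_mk _) ?_ ⟨z₀, hCz⟩ ?_) x
    · funext x; exact hfs _
    · exact hs₀
  have hright : ∀ u : U, (s u : ℂ) ∈ C := by
    have hpre : IsPreconnected (range fun u : U => (s u : ℂ)) := by
      have : PreconnectedSpace U :=
        isPreconnected_iff_preconnectedSpace.1 (convex_ball w ε).isPreconnected
      exact isPreconnected_range (continuous_subtype_val.comp hs)
    have hsub : (range fun u : U => (s u : ℂ)) ⊆ f ⁻¹' U := by
      rintro _ ⟨u, rfl⟩
      rw [mem_preimage, hfs]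
      exact u.2
    exact fun u => hpre.subset_connectedComponentIn ⟨⟨f z₀, hz₀⟩, by simp [hs₀, he₀]⟩ hsub ⟨u, rfl⟩
  refine ⟨{ toFun := fun x => ⟨f x, hCU x.2⟩
            invFun := fun u => ⟨s u, hright u⟩
            left_inv := fun x => Subtype.ext (congrArg (Subtype.val : noncritical f → ℂ) (hleft x))
            right_inv := fun u => Subtype.ext (hfs u)
            continuous_toFun := (hf.continuous.comp continuous_subtype_val).subtype_mk _
            continuous_invFun := (continuous_subtype_val.comp hs).subtype_mk _ }, fun _ => rfl⟩

end noncritical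

namespace IsPoincare

variable {f : ℂ → ℂ} (hf : IsPoincare f)
include hf

lemma six_mul_deriv (z : ℂ) :
    6 * deriv f (6 * z) = (3 * f z ^ 2 - 3) / 2 * deriv f z := by
  have hd : ∀ z, HasDerivAt f (deriv f z) z := fun z => (hf.differentiable z).hasDerivAt
  have h1 : HasDerivAt (fun z => f (6 * z)) (deriv f (6 * z) * 6) z := by
    have h6 : HasDerivAt (fun z : ℂ => 6 * z) 6 z := by
      simpa using (hasDerivAt_id z).const_mul (6 : ℂ)
    exact (hd (6 * z)).comp z h6
  have h2 : HasDerivAt (fun z => f (6 * z)) ((3 * f z ^ 2 * deriv f z - 3 * deriv f z) / 2) z := by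
    have : (fun z => f (6 * z)) = fun z => (f z ^ 3 - 3 * f z) / 2 := funext hf.map_mul
    rw [this]
    simpa using (((hd z).pow 3).sub ((hd z).const_mul 3)).div_const 2
  have := h1.unique h2
  linear_combination this

/-- The critical values lie on the critical cycle of `cubic`. -/
lemma critical_value {z : ℂ} (hz : z ≠ 0) (h : deriv f z = 0) : f z = 1 ∨ f z = -1 := by
  by_contra hne
  have key : ∀ n : ℕ, deriv f (z / 6 ^ n) = 0 ∧ ¬ (f (z / 6 ^ n) = 1 ∨ f (z / 6 ^ n) = -1) := by
    intro n
    induction n with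
    | zero => simpa using ⟨h, not_or.1 hne⟩
    | succ n ih =>
      have hmul : 6 * (z / 6 ^ (n + 1)) = z / 6 ^ n := by rw [pow_succ']; field_simp
      have h1 : ¬ (f (z / 6 ^ (n + 1)) = 1 ∨ f (z / 6 ^ (n + 1)) = -1) := by
        intro h
        refine ih.2 ?_
        rw [← hf.map_div]
        rcases h with h | h <;> rw [h, cubic]
        · right; norm_num
        · left; norm_num
      have h2 := hf.six_mul_deriv (z / 6 ^ (n + 1))
      rw [hmul, ih.1, mul_zero, eq_comm, mul_eq_zero] at h2
      refine ⟨h2.resolve_left fun h0 => h1 ?_, h1⟩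
      refine sq_eq_one_iff.1 ?_
      linear_combination (2 / 3) * h0
  have han : AnalyticOnNhd ℂ (deriv f) univ :=
    hf.differentiable.deriv.differentiableOn.analyticOnNhd isOpen_univ
  have hlim : Tendsto (fun n : ℕ => z / 6 ^ n) atTop (𝓝[≠] 0) := by
    refine tendsto_nhdsWithin_iff.2 ⟨?_, Eventually.of_forall fun n => ?_⟩
    · have := (tendsto_pow_atTop_nhds_zero_of_norm_lt_one (x := (1 / 6 : ℂ))
        (by norm_num)).const_mul z
      simpa [div_eq_mul_inv] using this
    · exact div_ne_zero hz (pow_ne_zero _ (by norm_num))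
  have hfreq : ∃ᶠ w in 𝓝[≠] (0 : ℂ), deriv f w = 0 :=
    hlim.frequently (Frequently.of_forall fun n => (key n).1)
  have hzero := han.eqOn_zero_of_preconnected_of_frequently_eq_zero isPreconnected_univ
    (mem_univ 0) hfreq
  obtain ⟨x, hx⟩ := hf.exists_ne
  exact hx ((is_const_of_deriv_eq_zero hf.differentiable (fun y => hzero (mem_univ y)) x 0).trans
    hf.map_zero)

lemma finite_singularSet : (singularSet f).Finite := by
  have hfin : ({1, -1, (√5 : ℂ)} : Set ℂ).Finite := by simp
  refine hfin.subset fun w hw => ?_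
  by_contra hwS
  obtain ⟨ε, hε, hball⟩ := Metric.isOpen_iff.1 hfin.isClosed.isOpen_compl w hwS
  refine hw (isRegularValue_of_ball hf.differentiable hf.asymptoticValues_eq_empty hε ?_)
  intro z hz h0
  refine hball hz ?_
  by_cases h : z = 0
  · simp [h, hf.map_zero]
  · rcases hf.critical_value h h0 with h | h <;> simp [h]

end IsPoincare

/-! ### Logarithmic area of sublevel sets -/

/-- The part of the sublevel set `{‖f‖ ≤ R}` in the annulus `1 ≤ ‖z‖ ≤ r`. -/
def sublevelAnnulus (f : ℂ → ℂ) (R r : ℝ) : Set ℂ := {z | 1 ≤ ‖z‖ ∧ ‖z‖ ≤ r ∧ ‖f z‖ ≤ R}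

/-- The logarithmic area of `sublevelAnnulus f R r`. -/
noncomputable def logArea (f : ℂ → ℂ) (R r : ℝ) : ℝ :=
  ∫ z in sublevelAnnulus f R r, 1 / ‖z‖ ^ 2

section logArea

variable {f : ℂ → ℂ} {R a b : ℝ}

lemma sublevelAnnulus_mono (hab : a ≤ b) : sublevelAnnulus f R a ⊆ sublevelAnnulus f R b :=
  fun _ hz => ⟨hz.1, hz.2.1.trans hab, hz.2.2⟩

lemma sublevelAnnulus_subset_closedBall : sublevelAnnulus f R a ⊆ closedBall 0 a :=
  fun _ hz => by simpa using hz.2.1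

lemma volume_real_closedBall (z : ℂ) {r : ℝ} (hr : 0 ≤ r) :
    volume.real (closedBall z r) = r ^ 2 * π := by
  simp [measureReal_def, Complex.volume_closedBall, ENNReal.toReal_ofReal hr]

lemma volume_real_ball (z : ℂ) {r : ℝ} (hr : 0 ≤ r) : volume.real (ball z r) = r ^ 2 * π := by
  simp [measureReal_def, Complex.volume_ball, ENNReal.toReal_ofReal hr]

lemma logArea_nonneg : 0 ≤ logArea f R a :=
  integral_nonneg fun z => by positivity

lemma setIntegral_le_of_subset_closedBall {s : Set ℂ} {C r : ℝ} (hC : 0 ≤ C) (hr : 0 ≤ r)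
    (hs : s ⊆ closedBall 0 r) (h : ∀ z ∈ s, 1 / ‖z‖ ^ 2 ≤ C) :
    ∫ z in s, 1 / ‖z‖ ^ 2 ≤ C * (r ^ 2 * π) := by
  have hlt : volume s < ⊤ := (measure_mono hs).trans_lt measure_closedBall_lt_top
  refine (Real.le_norm_self _).trans
    ((norm_setIntegral_le_of_norm_le_const hlt (C := C) ?_).trans ?_)
  · intro z hz
    rw [Real.norm_of_nonneg (by positivity)]
    exact h z hz
  · rw [← volume_real_closedBall 0 hr]
    exact mul_le_mul_of_nonneg_left (measureReal_mono hs measure_closedBall_lt_top.ne) hC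

variable (hf : Continuous f)
include hf

lemma measurableSet_sublevelAnnulus : MeasurableSet (sublevelAnnulus f R a) :=
  ((isClosed_le continuous_const continuous_norm).inter
    ((isClosed_le continuous_norm continuous_const).inter
      (isClosed_le hf.norm continuous_const))).measurableSet

lemma integrableOn_sublevelAnnulus :
    IntegrableOn (fun z : ℂ => 1 / ‖z‖ ^ 2) (sublevelAnnulus f R a) := by
  refine IntegrableOn.of_bound
    ((measure_mono sublevelAnnulus_subset_closedBall).trans_lt measure_closedBall_lt_top)
    (Measurable.aestronglyMeasurable (by fun_prop)) 1 ?_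
  refine (ae_restrict_iff' (measurableSet_sublevelAnnulus hf)).2
    (Eventually.of_forall fun z hz => ?_)
  rw [Real.norm_of_nonneg (by positivity)]
  exact div_le_one_of_le₀ (one_le_pow₀ hz.1) (by positivity)

lemma logArea_sub_logArea (hab : a ≤ b) :
    logArea f R b - logArea f R a =
      ∫ z in sublevelAnnulus f R b \ sublevelAnnulus f R a, 1 / ‖z‖ ^ 2 :=
  (setIntegral_sdiff (measurableSet_sublevelAnnulus hf) (integrableOn_sublevelAnnulus hf)
    (sublevelAnnulus_mono hab)).symm

lemma logArea_mono (hab : a ≤ b) : logArea f R a ≤ logArea f R b := by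
  rw [← sub_nonneg, logArea_sub_logArea hf hab]
  exact integral_nonneg fun z => by positivity

/-- The logarithmic area of an annulus of modulus `log 6` is bounded. -/
lemma logArea_six_mul_le (ha : 0 < a) :
    logArea f R (6 * a) ≤ logArea f R a + 36 * π := by
  have h := setIntegral_le_of_subset_closedBall (C := 1 / a ^ 2) (r := 6 * a)
    (s := sublevelAnnulus f R (6 * a) \ sublevelAnnulus f R a) (by positivity) (by positivity)
    (sdiff_subset.trans sublevelAnnulus_subset_closedBall) fun z hz => by
      have : a < ‖z‖ := by
        by_contra! h
        exact hz.2 ⟨hz.1.1, h, hz.1.2.2⟩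
      gcongr
  rw [← logArea_sub_logArea hf (by linarith)] at h
  have h36 : 1 / a ^ 2 * ((6 * a) ^ 2 * π) = 36 * π := by field_simp; norm_num
  linarith

/-- A ball in the sublevel set contributes to the logarithmic area. -/
lemma logArea_add_le {w : ℂ} {ρ : ℝ} (ha : 1 ≤ a) (hρ : 0 ≤ ρ)
    (hball : ∀ z ∈ ball w ρ, a < ‖z‖ ∧ ‖z‖ ≤ 6 * a ∧ ‖f z‖ ≤ R) :
    logArea f R a + 1 / (6 * a) ^ 2 * (ρ ^ 2 * π) ≤ logArea f R (6 * a) := by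
  have hsub : ball w ρ ⊆ sublevelAnnulus f R (6 * a) \ sublevelAnnulus f R a := fun z hz =>
    ⟨⟨ha.trans (hball z hz).1.le, (hball z hz).2⟩, fun h => (hball z hz).1.not_ge h.2.1⟩
  have hint : IntegrableOn (fun z : ℂ => 1 / ‖z‖ ^ 2)
      (sublevelAnnulus f R (6 * a) \ sublevelAnnulus f R a) :=
    (integrableOn_sublevelAnnulus hf).mono_set sdiff_subset
  have h1 := setIntegral_ge_of_const_le_real (c := 1 / (6 * a) ^ 2) measurableSet_ball
    measure_ball_lt_top.ne (fun z hz => by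
      have := hball z hz
      have : 0 < ‖z‖ := by linarith
      gcongr
      exact (hball z hz).2.1) (hint.mono_set hsub)
  have h2 := setIntegral_mono_set hint (Eventually.of_forall fun z => by
    simp only [Pi.zero_apply]; positivity) hsub.eventuallyLE
  rw [← logArea_sub_logArea hf (by linarith)] at h2
  rw [volume_real_ball w hρ] at h1
  linarith

/-- The lower logarithmic density is positive if the logarithmic area grows by a fixed amount in
each of the annuli `6 ^ n * K < ‖z‖ ≤ 6 ^ (n + 1) * K`. -/
lemma liminf_logArea_pos {c K : ℝ} (hc : 0 < c) (hK : 1 ≤ K)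
    (h : ∀ n : ℕ, logArea f R (6 ^ n * K) + c ≤ logArea f R (6 ^ (n + 1) * K)) :
    0 < liminf (fun r : ℝ => (1 / Real.log r) * logArea f R r) atTop := by
  have h6 : 0 < Real.log 6 := Real.log_pos (by norm_num)
  have hlow : ∀ n : ℕ, n * c ≤ logArea f R (6 ^ n * K) := by
    intro n
    induction n with
    | zero => simpa using logArea_nonneg
    | succ n ih => push_cast; linarith [h n]
  have hup : ∀ n : ℕ, logArea f R (6 ^ n) ≤ logArea f R 1 + n * (36 * π) := by
    intro n
    induction n with
    | zero => simp
    | succ n ih =>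
      have := logArea_six_mul_le (f := f) (R := R) (a := 6 ^ n) hf (by positivity)
      rw [pow_succ']
      push_cast
      linarith
  have hcob : IsCoboundedUnder (· ≥ ·) atTop
      (fun r : ℝ => (1 / Real.log r) * logArea f R r) := by
    refine IsCoboundedUnder.of_frequently_le
      (a := (logArea f R 1 + 36 * π) / Real.log 6) ?_
    have htend : Tendsto (fun n : ℕ => (6 : ℝ) ^ n) atTop atTop :=
      tendsto_pow_atTop_atTop_of_one_lt (by norm_num)
    refine htend.frequently (Eventually.frequently ?_)
    filter_upwards [eventually_ge_atTop 1] with n hn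
    have hn' : (1 : ℝ) ≤ n := by exact_mod_cast hn
    rw [Real.log_pow, one_div_mul_eq_div, div_le_div_iff₀ (by positivity) h6]
    have h1 : logArea f R (6 ^ n) ≤ n * (logArea f R 1 + 36 * π) := by
      nlinarith [hup n, logArea_nonneg (f := f) (R := R) (a := 1)]
    nlinarith
  refine (show 0 < c / (2 * Real.log 6) by positivity).trans_le (le_liminf_of_le hcob ?_)
  filter_upwards [eventually_ge_atTop K,
    Real.tendsto_log_atTop.eventually_ge_atTop (2 * (Real.log K + Real.log 6)),
    Real.tendsto_log_atTop.eventually_gt_atTop 0] with r hr hlog hlog0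
  have hK0 : 0 < K := by linarith
  obtain ⟨n, hn1, hn2⟩ := exists_nat_pow_near ((one_le_div hK0).2 hr) (y := 6) (by norm_num)
  rw [le_div_iff₀ hK0] at hn1
  rw [div_lt_iff₀ hK0] at hn2
  have hr0 : 0 < r := by linarith
  have hlogr : Real.log r ≤ (n + 1) * Real.log 6 + Real.log K := by
    have := Real.log_le_log hr0 hn2.le
    rw [Real.log_mul (by positivity) hK0.ne', Real.log_pow] at this
    exact_mod_cast this
  have hI : n * c ≤ logArea f R r := (hlow n).trans (logArea_mono hf hn1)
  rw [one_div_mul_eq_div, div_le_div_iff₀ (by positivity) hlog0]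
  have h2 : Real.log r ≤ 2 * (n * Real.log 6) := by linarith
  nlinarith [mul_le_mul_of_nonneg_left h2 hc.le, mul_le_mul_of_nonneg_right hI h6.le]

end logArea

/-! ### The Poincaré function -/

/-- The union of two disks around the critical points of `cubic`. -/
def trap : Set ℂ := ball 1 (1 / 2) ∪ ball (-1) (1 / 2)

lemma norm_le_of_mem_trap {w : ℂ} (hw : w ∈ trap) : ‖w‖ ≤ 3 / 2 := by
  rcases hw with hw | hw <;> rw [mem_ball, dist_eq_norm] at hw
  · have := norm_add_le (w - 1) 1
    rw [sub_add_cancel, norm_one] at this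
    linarith
  · have := norm_add_le (w - -1) (-1)
    rw [sub_add_cancel, norm_neg, norm_one] at this
    linarith

lemma norm_sq_mul_lt {u v : ℂ} (hu : ‖u‖ < 1 / 2) (hv : ‖v‖ ≤ 4) :
    ‖u ^ 2 * v / 2‖ < 1 / 2 := by
  rw [norm_div, norm_mul, norm_pow, Complex.norm_ofNat]
  nlinarith [norm_nonneg u, norm_nonneg v, mul_le_mul_of_nonneg_left hv (sq_nonneg ‖u‖)]

lemma cubic_mem_trap {w : ℂ} (hw : w ∈ trap) : cubic w ∈ trap := by
  have h3 : ‖(3 : ℂ)‖ = 3 := by simp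
  rcases hw with hw | hw <;> rw [mem_ball, dist_eq_norm] at hw
  · right
    rw [mem_ball, dist_eq_norm, show cubic w - -1 = (w - 1) ^ 2 * (3 + (w - 1)) / 2 by
      rw [cubic]; ring]
    exact norm_sq_mul_lt hw ((norm_add_le _ _).trans (by linarith))
  · left
    rw [mem_ball, dist_eq_norm, show cubic w - 1 = (w - -1) ^ 2 * ((w - -1) - 3) / 2 by
      rw [cubic]; ring]
    exact norm_sq_mul_lt hw ((norm_sub_le _ _).trans (by linarith))

namespace IsPoincare

variable {f : ℂ → ℂ} (hf : IsPoincare f)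
include hf

lemma transcendentalEntire : TranscendentalEntire f := by
  refine ⟨hf.differentiable, ?_⟩
  rintro ⟨p, hp⟩
  have hcomp : Polynomial.C 2 * p.comp (Polynomial.C 6 * Polynomial.X) + Polynomial.C 3 * p
      = p ^ 3 := by
    refine Polynomial.funext fun z => ?_
    have := hf.map_mul z
    rw [cubic, hp, hp] at this
    simp only [Polynomial.eval_add, Polynomial.eval_mul, Polynomial.eval_C, Polynomial.eval_comp,
      Polynomial.eval_X, Polynomial.eval_pow]
    linear_combination 2 * this
  have hdeg : p.natDegree = 0 := by
    have h1 : (p ^ 3).natDegree ≤ p.natDegree := by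
      rw [← hcomp]
      refine Polynomial.natDegree_add_le_of_degree_le
        ((Polynomial.natDegree_C_mul_le _ _).trans ?_) (Polynomial.natDegree_C_mul_le _ _)
      rw [Polynomial.natDegree_comp, Polynomial.natDegree_C_mul_X _ (by norm_num), mul_one]
    rw [Polynomial.natDegree_pow] at h1
    omega
  obtain ⟨z, hz⟩ := hf.exists_ne
  refine hz ?_
  rw [← hf.map_zero, hp, hp, Polynomial.eq_C_of_natDegree_eq_zero hdeg, Polynomial.eval_C,
    Polynomial.eval_C]

lemma exists_mem_trap : ∃ z, f z ∈ trap := by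
  by_contra! h
  have hfar : ∀ z, 1 / 2 ≤ ‖f z - 1‖ := fun z => by
    by_contra! hz
    exact h z (Or.inl (by rwa [mem_ball, dist_eq_norm]))
  have hne : ∀ z, f z - 1 ≠ 0 := fun z h0 => by
    have := hfar z
    rw [h0, norm_zero] at this
    norm_num at this
  have hd : Differentiable ℂ fun z => (f z - 1)⁻¹ := (hf.differentiable.sub_const 1).inv hne
  have hb : Bornology.IsBounded (range fun z => (f z - 1)⁻¹) := by
    refine isBounded_iff_forall_norm_le.2 ⟨2, ?_⟩
    rintro _ ⟨z, rfl⟩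
    rw [norm_inv]
    exact inv_le_of_inv_le₀ (by norm_num) (by simpa using hfar z)
  obtain ⟨z, hz⟩ := hf.exists_ne
  have := inv_injective (hd.apply_eq_apply_of_bounded hb z 0)
  exact hz ((sub_left_injective this).trans hf.map_zero)

lemma map_pow_mul_mem_trap {z : ℂ} (hz : f z ∈ trap) (n : ℕ) : f (6 ^ n * z) ∈ trap := by
  induction n with
  | zero => simpa using hz
  | succ n ih =>
    rw [pow_succ', mul_assoc, hf.map_mul]
    exact cubic_mem_trap ih

lemma liminf_logArea_pos :
    0 < liminf (fun r : ℝ => (1 / Real.log r) * logArea f (3 / 2) r) atTop := by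
  obtain ⟨z₀, hz₀⟩ := hf.exists_mem_trap
  have hz₀0 : z₀ ≠ 0 := by
    rintro rfl
    have h := norm_le_of_mem_trap hz₀
    rw [hf.map_zero, Complex.norm_real, Real.norm_of_nonneg (by positivity)] at h
    have := Real.sq_sqrt (show (0 : ℝ) ≤ 5 by norm_num)
    nlinarith [Real.sqrt_nonneg 5]
  obtain ⟨n₀, hn₀⟩ := pow_unbounded_of_one_lt (2 / ‖z₀‖) (show (1 : ℝ) < 6 by norm_num)
  obtain ⟨w, hw, hwtrap⟩ : ∃ w : ℂ, 2 ≤ ‖w‖ ∧ f w ∈ trap := by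
    refine ⟨6 ^ n₀ * z₀, ?_, hf.map_pow_mul_mem_trap hz₀ n₀⟩
    rw [div_lt_iff₀ (norm_pos_iff.2 hz₀0)] at hn₀
    simpa using hn₀.le
  have hopen : IsOpen (f ⁻¹' trap) :=
    (isOpen_ball.union isOpen_ball).preimage hf.differentiable.continuous
  obtain ⟨ρ', hρ', hball⟩ := Metric.isOpen_iff.1 hopen w hwtrap
  obtain ⟨ρ, hρ, hρρ', hρ1⟩ : ∃ ρ > 0, ρ ≤ ρ' ∧ ρ ≤ 1 :=
    ⟨min ρ' 1, lt_min hρ' one_pos, min_le_left _ _, min_le_right _ _⟩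
  have hw0 : 0 < ‖w‖ := by linarith
  refine _root_.liminf_logArea_pos hf.differentiable.continuous
    (c := 1 / (3 * ‖w‖) ^ 2 * (ρ ^ 2 * π)) (K := ‖w‖ / 2) (by positivity) (by linarith) fun n => ?_
  have h6 : (0 : ℝ) < 6 ^ n := by positivity
  have h61 : (1 : ℝ) ≤ 6 ^ n := one_le_pow₀ (by norm_num)
  have hstep := logArea_add_le (f := f) (R := 3 / 2) (a := 6 ^ n * (‖w‖ / 2)) (w := 6 ^ n * w)
    (ρ := 6 ^ n * ρ) hf.differentiable.continuous (by nlinarith) (by positivity) fun z hz => by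
      have hz6 : z = 6 ^ n * (z / 6 ^ n) := by field_simp
      generalize z / 6 ^ n = y at hz6
      subst hz6
      rw [mem_ball, dist_eq_norm, ← mul_sub, norm_mul, norm_pow, Complex.norm_ofNat,
        mul_lt_mul_iff_right₀ h6] at hz
      have h1 : ‖y‖ ≤ ‖w‖ + ρ := by linarith [norm_sub_norm_le y w]
      have h2 : ‖w‖ - ρ < ‖y‖ := by linarith [norm_sub_norm_le w y, norm_sub_rev w y]
      refine ⟨?_, ?_, norm_le_of_mem_trap (hf.map_pow_mul_mem_trap (hball ?_) n)⟩
      · rw [norm_mul, norm_pow, Complex.norm_ofNat]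
        exact mul_lt_mul_of_pos_left (by linarith) h6
      · rw [norm_mul, norm_pow, Complex.norm_ofNat, mul_left_comm]
        exact mul_le_mul_of_nonneg_left (by linarith) h6.le
      · rw [mem_ball, dist_eq_norm]
        linarith
  have hc : 1 / (6 * (6 ^ n * (‖w‖ / 2))) ^ 2 * ((6 ^ n * ρ) ^ 2 * π)
      = 1 / (3 * ‖w‖) ^ 2 * (ρ ^ 2 * π) := by
    field_simp
    norm_num
  rwa [hc, ← mul_assoc 6, ← pow_succ'] at hstep

end IsPoincare

theorem counterexample_eremenko_lyubich_conjecture :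
    ∃ f : ℂ → ℂ, TranscendentalEntire f ∧ (singularSet f).Finite ∧
      asymptoticValues f = ∅ ∧
      ∃ R : ℝ, 0 < R ∧
        0 < Filter.liminf (fun r : ℝ =>
            (1 / Real.log r) *
              ∫ z in {z : ℂ | 1 ≤ ‖z‖ ∧ ‖z‖ ≤ r ∧ ‖f z‖ ≤ R}, 1 / ‖z‖ ^ 2)
          Filter.atTop := by
  obtain ⟨f, hf⟩ := exists_isPoincare
  exact ⟨f, hf.transcendentalEntire, hf.finite_singularSet, hf.asymptoticValues_eq_empty, 3 / 2,
    by norm_num, hf.liminf_logArea_pos⟩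
end

section
/- Let V be an open subset of the half-strip {a + ib : a > 1, |b| < π}, let H := {x + iy ∈ ℂ : x > −14·log₊|y|} (with log₊ t = max(0, log t)), and let G : V → H be a holomorphic bijection with holomorphic inverse. Assume: (i) there are constants C₁ > 1 and Q ≥ 1 such that Re z/C₁ ≤ log₊|G(z)| ≤ C₁·Re z for all z ∈ V with Re z ≥ Q; (ii) there are a constant C₂ > 0, an integer k₀ ≥ Q/(2π), and points ζ_k ∈ V for k ≥ k₀ with Re ζ_k = 2πk, dist(ζ_k, ∂V) ≥ C₂, and Re G(ζ_k) = 1. Then Σ_{m ∈ ℤ} |(G⁻¹)′(1 + 2πim)|² = ∞ (the family is not summable). -/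
open Complex Set Filter Topology Metric MeasureTheory
open scoped ENNReal Real

/-- Borel–Carathéodory on the half-radius ball around an arbitrary centre. -/
theorem norm_sub_le_of_re_sub_le {f : ℂ → ℂ} {c : ℂ} {R M : ℝ} (hR : 0 < R) (hM : 0 < M)
    (hf : DifferentiableOn ℂ f (ball c R)) (hre : ∀ z ∈ ball c R, (f z).re - (f c).re ≤ M)
    {z : ℂ} (hz : z ∈ closedBall c (R / 2)) : ‖f z - f c‖ ≤ 2 * M := by
  have hmaps : MapsTo (fun u : ℂ => c + u) (ball 0 R) (ball c R) := by
    intro u hu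
    simpa [mem_ball, dist_eq_norm] using hu
  have hd : DifferentiableOn ℂ (fun u => f (c + u) - f c) (ball 0 R) :=
    (hf.comp (by fun_prop) hmaps).sub_const _
  have hz' : ‖z - c‖ ≤ R / 2 := by simpa [mem_closedBall, dist_eq_norm] using hz
  have h := borelCaratheodory_zero (z := z - c) hM hd
    (fun u hu => by simpa using hre _ (hmaps hu)) hR
    (by rw [mem_ball_zero_iff]; linarith) (by simp)
  simp only [add_sub_cancel] at h
  refine h.trans ?_
  rw [div_le_iff₀ (by linarith)]
  nlinarith

theorem norm_deriv_le_of_re_sub_le {f : ℂ → ℂ} {c : ℂ} {R M : ℝ} (hR : 0 < R) (hM : 0 < M)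
    (hf : DifferentiableOn ℂ f (ball c R)) (hre : ∀ z ∈ ball c R, (f z).re - (f c).re ≤ M) :
    ‖deriv f c‖ ≤ 4 * M / R := by
  have hsub : closedBall c (R / 2) ⊆ ball c R := closedBall_subset_ball (by linarith)
  have hd : DiffContOnCl ℂ (fun z => f z - f c) (ball c (R / 2)) :=
    DifferentiableOn.diffContOnCl
      (((hf.mono (closure_ball_subset_closedBall.trans hsub))).sub_const _)
  have h := norm_deriv_le_of_forall_mem_sphere_norm_le (by linarith) hd
    (fun z hz => norm_sub_le_of_re_sub_le hR hM hf hre (sphere_subset_closedBall hz))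
  rw [deriv_sub_const] at h
  refine h.trans (le_of_eq ?_)
  field_simp
  ring

theorem exists_exp_eq_on_ball {u : ℂ → ℂ} {c : ℂ} {R : ℝ} (hR : 0 < R)
    (hu : DifferentiableOn ℂ u (ball c R)) (hne : ∀ z ∈ ball c R, u z ≠ 0) :
    ∃ g : ℂ → ℂ, DifferentiableOn ℂ g (ball c R) ∧ ∀ z ∈ ball c R, exp (g z) = u z := by
  have hquot : DifferentiableOn ℂ (fun z => deriv u z / u z) (ball c R) :=
    (hu.deriv isOpen_ball).div hu hne
  obtain ⟨g, hgc, hg⟩ := hquot.isExactOn_ball.with_val_at c (log (u c))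
  refine ⟨g, fun z hz => (hg z hz).differentiableAt.differentiableWithinAt, fun z hz => ?_⟩
  have hcc : c ∈ ball c R := mem_ball_self hR
  have hderiv : ∀ x ∈ ball c R, HasDerivAt (fun z => exp (-g z) * u z) 0 x := by
    intro x hx
    have hux : HasDerivAt u (deriv u x) x :=
      (hu.differentiableAt (isOpen_ball.mem_nhds hx)).hasDerivAt
    refine ((hg x hx).neg.cexp.mul hux).congr_deriv ?_
    have := hne x hx
    field_simp
    ring
  have hconst : exp (-g z) * u z = exp (-g c) * u c :=
    isOpen_ball.is_const_of_deriv_eq_zero (convex_ball c R).isPreconnected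
      (fun x hx => (hderiv x hx).differentiableAt.differentiableWithinAt)
      (fun x hx => (hderiv x hx).deriv) hz hcc
  have hc1 : exp (-g c) * u c = 1 := by
    rw [hgc, exp_neg, exp_log (hne c hcc), inv_mul_cancel₀ (hne c hcc)]
  rw [hc1, exp_neg] at hconst
  field_simp at hconst
  exact hconst.symm

/-- A Harnack inequality for the modulus of a zero-free bounded holomorphic function. -/
theorem le_norm_of_nonvanishing {u : ℂ → ℂ} {c : ℂ} {R M δ : ℝ} (hR : 0 < R) (hM : 0 < M)
    (hδ : 0 < δ) (hδ1 : δ < 1) (hu : DifferentiableOn ℂ u (ball c R))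
    (hne : ∀ z ∈ ball c R, u z ≠ 0) (hle : ∀ z ∈ ball c R, ‖u z‖ ≤ M) (hc : δ * M ≤ ‖u c‖)
    {z : ℂ} (hz : z ∈ ball c (R / 2)) : δ ^ 3 * M ≤ ‖u z‖ := by
  obtain ⟨g, hg, hgu⟩ := exists_exp_eq_on_ball hR hu hne
  have hre : ∀ x ∈ ball c R, (g x).re = Real.log ‖u x‖ := fun x hx => by
    rw [← hgu x hx, norm_exp, Real.log_exp]
  have hcc : c ∈ ball c R := mem_ball_self hR
  have hlog : Real.log δ < 0 := Real.log_neg hδ hδ1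
  have hgc : Real.log δ + Real.log M ≤ (g c).re := by
    rw [hre c hcc, ← Real.log_mul hδ.ne' hM.ne']
    exact Real.log_le_log (by positivity) hc
  have hbound : ∀ x ∈ ball c R, (g x).re - (g c).re ≤ -Real.log δ := fun x hx => by
    have : (g x).re ≤ Real.log M := by
      rw [hre x hx]
      exact Real.log_le_log (norm_pos_iff.2 (hne x hx)) (hle x hx)
    linarith
  have hdist := norm_sub_le_of_re_sub_le hR (by linarith) hg hbound (ball_subset_closedBall hz)
  have habs := (abs_le.1 ((abs_re_le_norm (g z - g c)).trans hdist)).1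
  rw [sub_re] at habs
  have hzR : z ∈ ball c R := ball_subset_ball (by linarith) hz
  rw [← hgu z hzR, norm_exp, ← Real.log_le_iff_le_exp (by positivity),
    Real.log_mul (by positivity) hM.ne', Real.log_pow]
  push_cast
  linarith

theorem ball_subset_of_le_infDist_frontier {V : Set ℂ} (hV : IsOpen V) {c : ℂ} {r : ℝ}
    (hr : 0 < r) (hc : c ∈ V) (h : r ≤ infDist c (frontier V)) : ball c r ⊆ V := by
  have hcompl : ball c r ⊆ (frontier V)ᶜ := (ball_subset_ball h).trans ball_infDist_subset_compl
  refine (convex_ball c r).isPreconnected.subset_left_of_subset_union hV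
    isClosed_closure.isOpen_compl (disjoint_compl_right.mono_left subset_closure) ?_
    ⟨c, mem_ball_self hr, hc⟩
  intro x hx
  by_contra hx'
  simp only [Set.mem_union, Set.mem_compl_iff, not_or, not_not] at hx'
  exact hcompl hx (by rw [hV.frontier_eq]; exact ⟨hx'.2, hx'.1⟩)

theorem norm_deriv_le_of_abs_im_lt {F : ℂ → ℂ} {w : ℂ} {R : ℝ} (hR : 0 < R)
    (hF : DifferentiableOn ℂ F (ball w R)) (him : ∀ z ∈ ball w R, |(F z).im| < π) :
    ‖deriv F w‖ ≤ 8 * π / R := by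
  have hd : DifferentiableAt ℂ F w := hF.differentiableAt (ball_mem_nhds w hR)
  have h := norm_deriv_le_of_re_sub_le (f := fun z => -I * F z) (M := 2 * π) hR (by positivity)
    (hF.const_mul _) (fun z hz => by
      have h1 := abs_lt.1 (him z hz)
      have h2 := abs_lt.1 (him w (mem_ball_self hR))
      simp
      linarith [h1.2, h2.1])
  rw [deriv_const_mul _ hd] at h
  simp only [norm_mul, norm_neg, norm_I, one_mul] at h
  exact h.trans (le_of_eq (by ring))

/-- Distortion of a holomorphic map with zero-free derivative into a horizontal strip. -/
theorem strip_distortion {F : ℂ → ℂ} {w : ℂ} {R δ : ℝ} (hR : 0 < R) (hδ : 0 < δ) (hδ1 : δ < 1)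
    (hF : DifferentiableOn ℂ F (ball w R)) (him : ∀ z ∈ ball w R, |(F z).im| < π)
    (hne : ∀ z ∈ ball w R, deriv F z ≠ 0) (hw : δ * (16 * π / R) ≤ ‖deriv F w‖)
    {v : ℂ} (hv : v ∈ ball w (R / 4)) :
    ‖F v - F w‖ ≤ 4 * π ∧ δ ^ 3 * (16 * π / R) ≤ ‖deriv F v‖ := by
  have hsub : ball w (R / 2) ⊆ ball w R := ball_subset_ball (by linarith)
  have hbound : ∀ z ∈ ball w (R / 2), ‖deriv F z‖ ≤ 16 * π / R := by
    intro z hz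
    have hzsub : ball z (R / 2) ⊆ ball w R := by
      refine ball_subset_ball' ?_
      rw [mem_ball] at hz
      linarith
    refine (norm_deriv_le_of_abs_im_lt (by linarith) (hF.mono hzsub)
      (fun x hx => him x (hzsub hx))).trans (le_of_eq ?_)
    field_simp
    ring
  constructor
  · have h := (convex_ball w (R / 2)).norm_image_sub_le_of_norm_deriv_le
      (fun x hx => hF.differentiableAt (isOpen_ball.mem_nhds (hsub hx))) hbound
      (mem_ball_self (by linarith)) (ball_subset_ball (by linarith) hv)
    rw [mem_ball, dist_eq_norm] at hv
    calc ‖F v - F w‖ ≤ 16 * π / R * ‖v - w‖ := h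
      _ ≤ 16 * π / R * (R / 4) := by gcongr
      _ = 4 * π := by field_simp; ring
  · exact le_norm_of_nonvanishing (by linarith) (by positivity) hδ hδ1
      ((hF.deriv isOpen_ball).mono hsub) (fun z hz => hne z (hsub hz)) hbound hw
      (ball_subset_ball (by linarith) hv)

theorem exists_finset_int_of_interval (t : ℝ) {r : ℝ} (hr : 4 * π ≤ r) :
    ∃ S : Finset ℤ, r / (4 * π) ≤ S.card ∧ ∀ m ∈ S, |2 * π * m - t| < r := by
  have hpi := Real.pi_pos
  set n := ⌊r / (2 * π)⌋₊
  have hn : (n : ℝ) * (2 * π) ≤ r := by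
    rw [← le_div_iff₀ (by positivity)]
    exact Nat.floor_le (div_nonneg (by linarith) (by positivity))
  have hn' : r / (2 * π) < n + 1 := Nat.lt_floor_add_one _
  set a := ⌈t / (2 * π)⌉
  have ha : t ≤ a * (2 * π) := by
    rw [← div_le_iff₀ (by positivity)]
    exact Int.le_ceil _
  have ha' : ((a : ℝ) - 1) * (2 * π) < t := by
    rw [← lt_div_iff₀ (by positivity)]
    linarith [Int.ceil_lt_add_one (t / (2 * π))]
  refine ⟨Finset.Ico a (a + n), ?_, fun m hm => ?_⟩
  · rw [Int.card_Ico, add_sub_cancel_left, Int.toNat_natCast]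
    rw [div_lt_iff₀ (by positivity)] at hn'
    rw [div_le_iff₀ (by positivity)]
    linarith
  · rw [Finset.mem_Ico] at hm
    have h1 : (a : ℝ) ≤ m := by exact_mod_cast hm.1
    have h2 : (m : ℝ) + 1 ≤ a + n := by exact_mod_cast hm.2
    rw [abs_lt]
    constructor <;> nlinarith

theorem not_summable_of_disjoint_blocks {f : ℤ → ℝ} (hf : ∀ m, 0 ≤ f m) {S : ℕ → Finset ℤ}
    (hS : Pairwise fun i j => Disjoint (S i) (S j)) {b : ℕ → ℝ} (hb0 : ∀ j, 0 ≤ b j)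
    (hb : ¬ Summable b) (hle : ∀ j, b j ≤ ∑ m ∈ S j, f m) : ¬ Summable f := by
  intro hsum
  refine hb (summable_of_sum_le (c := ∑' m, f m) hb0 fun u => ?_)
  calc ∑ j ∈ u, b j ≤ ∑ j ∈ u, ∑ m ∈ S j, f m := Finset.sum_le_sum fun j _ => hle j
    _ = ∑ m ∈ u.biUnion S, f m := (Finset.sum_biUnion fun i _ j _ hij => hS hij).symm
    _ ≤ ∑' m, f m := hsum.sum_le_tsum _ fun m _ => hf m

theorem logPlus_mono {x y : ℝ} (hx : 0 ≤ x) (hxy : x ≤ y) : logPlus x ≤ logPlus y := by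
  rcases hx.eq_or_lt with rfl | hx
  · simp [logPlus]
  · exact max_le_max le_rfl (Real.log_le_log hx hxy)

/-- The right side of the domain contains large discs around far-away points of `Re w = 1`. -/
theorem ball_subset_tract_target {w : ℂ} {x : ℝ} (hx : 1 ≤ x) (hre : w.re = 1)
    (hw : 2 * π * x ≤ logPlus ‖w‖) :
    ball w x ⊆ {z : ℂ | -14 * logPlus |z.im| < z.re} := by
  have hpi := Real.pi_gt_three
  have hlog : 2 * π * x ≤ Real.log ‖w‖ := by
    rcases le_max_iff.1 hw with h | h
    · nlinarith
    · exact h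
  have hw0 : 0 < ‖w‖ := by
    by_contra h
    have : ‖w‖ = 0 := le_antisymm (not_lt.1 h) (norm_nonneg _)
    rw [this, Real.log_zero] at hlog
    nlinarith
  have hexp : Real.exp (2 * x) ≤ ‖w‖ := by
    rw [← Real.le_log_iff_exp_le hw0]
    nlinarith
  have hex : x + 1 ≤ Real.exp x := Real.add_one_le_exp x
  have hlarge : Real.exp x + 1 + x ≤ ‖w‖ := by
    rw [two_mul, Real.exp_add] at hexp
    nlinarith
  have hwim : ‖w‖ ≤ 1 + |w.im| := by
    simpa [hre] using norm_le_abs_re_add_abs_im w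
  intro z hz
  rw [mem_ball, dist_eq_norm] at hz
  have h1 := (abs_lt.1 ((abs_re_le_norm (z - w)).trans_lt hz)).1
  have h2 := (abs_im_le_norm (z - w)).trans_lt hz
  rw [sub_re] at h1
  rw [sub_im] at h2
  have h3 : |w.im| ≤ |z.im| + |z.im - w.im| := by
    have := abs_sub_abs_le_abs_sub w.im z.im
    rw [abs_sub_comm] at this
    linarith
  have h4 : x ≤ logPlus |z.im| := by
    refine le_max_of_le_right ((Real.le_log_iff_exp_le ?_).2 ?_)
    · linarith [Real.exp_pos x]
    · linarith
  change -14 * logPlus |z.im| < z.re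
  linarith

theorem tract_model_not_summable (V : Set ℂ) (hVopen : IsOpen V)
    (hVsub : V ⊆ {z : ℂ | 1 < z.re ∧ |z.im| < Real.pi})
    (G Ginv : ℂ → ℂ)
    (hG : DifferentiableOn ℂ G V)
    (hGinv : DifferentiableOn ℂ Ginv {z : ℂ | -14 * logPlus |z.im| < z.re})
    (hGmaps : Set.MapsTo G V {z : ℂ | -14 * logPlus |z.im| < z.re})
    (hGinvmaps : Set.MapsTo Ginv {z : ℂ | -14 * logPlus |z.im| < z.re} V)
    (hleft : ∀ z ∈ V, Ginv (G z) = z)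
    (hright : ∀ w ∈ {z : ℂ | -14 * logPlus |z.im| < z.re}, G (Ginv w) = w)
    (C₁ Q : ℝ) (hC₁ : 1 < C₁) (hQ : 1 ≤ Q)
    (hgrowth : ∀ z ∈ V, Q ≤ z.re →
      z.re / C₁ ≤ logPlus ‖G z‖ ∧ logPlus ‖G z‖ ≤ C₁ * z.re)
    (C₂ : ℝ) (hC₂ : 0 < C₂) (k₀ : ℕ) (hk₀ : Q / (2 * Real.pi) ≤ (k₀ : ℝ))
    (ζ : ℕ → ℂ)
    (hζ : ∀ k : ℕ, k₀ ≤ k → ζ k ∈ V ∧ (ζ k).re = 2 * Real.pi * k ∧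
      C₂ ≤ Metric.infDist (ζ k) (frontier V) ∧ (G (ζ k)).re = 1) :
    ¬ Summable (fun m : ℤ =>
        ‖deriv Ginv (1 + 2 * (Real.pi : ℂ) * (m : ℂ) * Complex.I)‖ ^ 2) := by
  have hpi := Real.pi_gt_three
  set f : ℤ → ℝ := fun m => ‖deriv Ginv (1 + 2 * (Real.pi : ℂ) * (m : ℂ) * Complex.I)‖ ^ 2 with hf
  set A : ℝ := 4 * (1 + 14 * (C₁ * (2 * π + C₂))) / C₂ with hA
  have hA0 : 0 < A := by positivity
  set δ : ℝ := min (1 / (16 * π * C₁ * A)) (1 / 2) with hδ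
  have hδ0 : 0 < δ := by positivity
  have hδ1 : δ < 1 := (min_le_right _ _).trans_lt (by norm_num)
  obtain ⟨K, hK⟩ := exists_nat_gt (k₀ + (Q + C₂) + 16 * π * C₁)
  have hblock : ∀ k : ℕ, K ≤ k → ∃ S : Finset ℤ,
      (∀ m ∈ S, ‖Ginv (1 + 2 * (Real.pi : ℂ) * (m : ℂ) * Complex.I) - ζ k‖ ≤ 4 * π) ∧
      16 * π * C₁ * δ ^ 6 * (1 / k) ≤ ∑ m ∈ S, f m := by
    intro k hk
    have hkK : k₀ + (Q + C₂) + 16 * π * C₁ < (k : ℝ) := hK.trans_le (by exact_mod_cast hk)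
    have hC₁π : 1 < 16 * π * C₁ := by nlinarith
    have hk0' : (0 : ℝ) ≤ k₀ := k₀.cast_nonneg
    have hk1 : (1 : ℝ) < k := by linarith
    obtain ⟨hζV, hζre, hζd, hζG⟩ := hζ k (by
      have : (k₀ : ℝ) ≤ k := by linarith
      exact_mod_cast this)
    have hζQ : Q + C₂ ≤ (ζ k).re := by
      rw [hζre]
      nlinarith
    have hball : ball (ζ k) C₂ ⊆ V := ball_subset_of_le_infDist_frontier hVopen hC₂ hζV hζd
    set w := G (ζ k) with hw
    have hFw : Ginv w = ζ k := hleft _ hζV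
    set R : ℝ := k / C₁ with hR
    have hR1 : 16 * π ≤ R := by
      rw [hR, le_div_iff₀ (by linarith)]
      linarith
    have hR0 : 0 < R := by linarith
    have hwlog : 2 * π * R ≤ logPlus ‖w‖ := by
      refine le_of_eq_of_le ?_ (hgrowth _ hζV (by linarith)).1
      rw [hζre, hR]
      ring
    have hsub := ball_subset_tract_target (by linarith) hζG hwlog
    have hFd : DifferentiableOn ℂ Ginv (ball w R) := hGinv.mono hsub
    have hcomp : ∀ v ∈ ball w R, deriv G (Ginv v) * deriv Ginv v = 1 := by
      intro v hv
      have hGd : HasDerivAt G (deriv G (Ginv v)) (Ginv v) :=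
        (hG.differentiableAt (hVopen.mem_nhds (hGinvmaps (hsub hv)))).hasDerivAt
      have hGi : HasDerivAt Ginv (deriv Ginv v) v :=
        (hFd.differentiableAt (isOpen_ball.mem_nhds hv)).hasDerivAt
      have hid : (G ∘ Ginv) =ᶠ[𝓝 v] id := by
        filter_upwards [isOpen_ball.mem_nhds hv] with x hx using hright x (hsub hx)
      exact (hGd.comp v hGi).unique ((hasDerivAt_id v).congr_of_eventuallyEq hid)
    have hGderiv : ‖deriv G (ζ k)‖ ≤ A * k := by
      have h := norm_deriv_le_of_re_sub_le (f := fun z => -G z)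
        (M := 1 + 14 * (C₁ * (2 * π * k + C₂))) hC₂ (by positivity)
        (hG.mono hball).neg (fun z hz => by
          have hzV := hball hz
          rw [mem_ball, dist_eq_norm] at hz
          have hzre := abs_lt.1 ((abs_re_le_norm (z - ζ k)).trans_lt hz)
          rw [sub_re] at hzre
          have h1 := (hgrowth z hzV (by linarith [hzre.1])).2
          have h2 : C₁ * z.re ≤ C₁ * (2 * π * k + C₂) := by
            gcongr
            linarith [hzre.2]
          have h3 := hGmaps hzV
          have h4 := logPlus_mono (abs_nonneg _) (abs_im_le_norm (G z))
          simp only [Set.mem_ofPred_eq] at h3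
          simp only [neg_re]
          linarith)
      rw [deriv.fun_neg, norm_neg] at h
      refine h.trans ?_
      rw [hA, div_mul_eq_mul_div, div_le_div_iff_of_pos_right hC₂]
      have h1 : C₂ ≤ C₂ * k := by nlinarith
      have h2 : C₁ * C₂ ≤ C₁ * (C₂ * k) := by gcongr
      linarith
    have hFderiv : δ * (16 * π / R) ≤ ‖deriv Ginv w‖ := by
      have h := congrArg norm (hcomp w (mem_ball_self hR0))
      rw [norm_mul, norm_one, hFw] at h
      have h1 : 1 ≤ A * k * ‖deriv Ginv w‖ := by
        rw [← h]
        gcongr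
      calc δ * (16 * π / R) ≤ 1 / (16 * π * C₁ * A) * (16 * π / R) := by
            gcongr
            exact min_le_left _ _
        _ = 1 / (A * k) := by
            rw [hR]
            field_simp
        _ ≤ ‖deriv Ginv w‖ := by
            rw [div_le_iff₀ (by positivity)]
            linarith
    have hdist := fun v hv => strip_distortion (v := v) hR0 hδ0 hδ1 hFd
      (fun z hz => (hVsub (hGinvmaps (hsub hz))).2)
      (fun z hz => right_ne_zero_of_mul_eq_one (hcomp z hz)) hFderiv hv
    obtain ⟨S, hcard, hS⟩ := exists_finset_int_of_interval w.im (r := R / 4) (by linarith)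
    have hmem : ∀ m ∈ S, 1 + 2 * (Real.pi : ℂ) * (m : ℂ) * Complex.I ∈ ball w (R / 4) := by
      intro m hm
      have heq : 1 + 2 * (Real.pi : ℂ) * (m : ℂ) * Complex.I - w
          = ((2 * π * m - w.im : ℝ) : ℂ) * Complex.I := by
        apply Complex.ext <;> simp [hζG]
      rw [mem_ball, dist_eq_norm, heq, norm_mul, norm_I, mul_one, norm_real, Real.norm_eq_abs]
      exact hS m hm
    refine ⟨S, fun m hm => hFw ▸ (hdist _ (hmem m hm)).1, ?_⟩
    calc 16 * π * C₁ * δ ^ 6 * (1 / k)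
        = R / 4 / (4 * π) * (δ ^ 3 * (16 * π / R)) ^ 2 := by
          rw [hR]
          field_simp
          norm_num
      _ ≤ S.card * (δ ^ 3 * (16 * π / R)) ^ 2 := by gcongr
      _ = ∑ m ∈ S, (δ ^ 3 * (16 * π / R)) ^ 2 := by rw [Finset.sum_const, nsmul_eq_mul]
      _ ≤ ∑ m ∈ S, f m := Finset.sum_le_sum fun m hm => by
          have := (hdist _ (hmem m hm)).2
          simp only [hf]
          gcongr
  have hKpos : k₀ ≤ K := by
    have : (k₀ : ℝ) ≤ K := by nlinarith
    exact_mod_cast this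
  choose S hSnear hSsum using fun j : ℕ => hblock (5 * (j + K)) (by omega)
  refine not_summable_of_disjoint_blocks (fun m => by positivity) (S := S) ?_
    (b := fun j => 16 * π * C₁ * δ ^ 6 * (1 / ((5 * (j + K) : ℕ) : ℝ)))
    (fun j => by positivity) ?_ hSsum
  · intro i j hij
    rw [Finset.disjoint_left]
    intro m hi hj
    have hnorm : ‖ζ (5 * (i + K)) - ζ (5 * (j + K))‖ ≤ 8 * π := by
      have h1 := hSnear i m hi
      have h2 := hSnear j m hj
      rw [norm_sub_rev] at h1
      have := norm_add_le_of_le h1 h2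
      rw [sub_add_sub_cancel] at this
      linarith
    have habs := (abs_re_le_norm _).trans hnorm
    rw [sub_re, (hζ _ (by omega)).2.1, (hζ _ (by omega)).2.1] at habs
    have hgap : (1 : ℝ) ≤ |(i : ℝ) - j| := by
      have : (1 : ℤ) ≤ |(i : ℤ) - j| := Int.one_le_abs (sub_ne_zero.2 (by exact_mod_cast hij))
      exact_mod_cast this
    have heq : 2 * π * ((5 * (i + K) : ℕ) : ℝ) - 2 * π * ((5 * (j + K) : ℕ) : ℝ)
        = 10 * π * ((i : ℝ) - j) := by
      push_cast
      ring
    rw [heq, abs_mul, abs_of_pos (by positivity)] at habs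
    nlinarith
  · have hc : 16 * π * C₁ * δ ^ 6 * (1 / 5) ≠ 0 := by positivity
    have heq : (fun j : ℕ => 16 * π * C₁ * δ ^ 6 * (1 / ((5 * (j + K) : ℕ) : ℝ)))
        = fun j : ℕ => 16 * π * C₁ * δ ^ 6 * (1 / 5) * (1 / ((j + K : ℕ) : ℝ)) := by
      funext j
      push_cast
      rw [← one_div_mul_one_div]
      ring
    rw [heq, summable_mul_left_iff hc]
    exact mt (summable_nat_add_iff (f := fun n : ℕ => 1 / (n : ℝ)) K).1
      Real.not_summable_one_div_natCast
end
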